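/- arXiv:2310.01948 — 4 statements merged into one kernel-verified Lean document; each statement's English description precedes it below -/
import Mathlib

section
/- Let m ≥ 1, p ≥ 1, l ≥ 1, e_j ∈ ℝ, η_j > 0 with e_j + η_j > 0 for 1 ≤ j ≤ p+m; b_i > 0 for 1 ≤ i ≤ p with Σ_{i=1}^p b_i > 1; and a_k ∈ ℝ, α_k > 0, γ_k > 0, β_k ∈ (0,1) with a_k + α_k > 0 for 1 ≤ k ≤ l; set c_k = a_k − α_kγ_k + α_k. Let γ₀ exceed all the numbers −e_j/η_j (1 ≤ j ≤ p+m) and −c_k/(α_kγ_k) (1 ≤ k ≤ l), and define for x > 0: H(x) = (1/(2π)) ∫_{t∈ℝ} [ Π_{i=1}^p Γ(e_i+η_i(γ₀+it))/Γ(e_i+b_i+η_i(γ₀+it)) · Π_{j=p+1}^{p+m} Γ(e_j+η_j(γ₀+it)) · Π_{k=1}^l Γ(c_k+α_kγ_k(γ₀+it))/Γ(1−β_k+β_k c_k+α_kβ_kγ_k(γ₀+it)) ] · x^{−(γ₀+it)} dt. Then H(x) is real and nonnegative for every x > 0, H is integrable on (0,∞), and ρ₇ = H/K₇ is a probability density on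 (0,∞) with all moments finite, where K₇ = Π_{i=1}^p [Γ(e_i+η_i)/Γ(e_i+b_i+η_i)] · Π_{j=p+1}^{p+m} Γ(e_j+η_j) · Π_{k=1}^l [Γ(a_k+α_k)/Γ(1−β_k+β_k(a_k+α_k))]. -/
open MeasureTheory Finset Filter Complex Real

/-- The Fox-H kernel of type `(m+p+l,0;p+l,m+p+l)` for class (C7), with
`c_k = a_k − α_kγ_k + α_k`. -/
noncomputable def foxKernelC7 (m p l : ℕ) (e η b a α g βw : ℕ → ℝ) (s : ℂ) : ℂ :=
  (∏ i ∈ Finset.range p,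
    Complex.Gamma ((e i : ℝ) + η i * s) / Complex.Gamma ((e i + b i : ℝ) + η i * s)) *
  (∏ j ∈ Finset.Ico p (p + m), Complex.Gamma ((e j : ℝ) + η j * s)) *
  ∏ k ∈ Finset.range l,
    Complex.Gamma (((a k - α k * g k + α k : ℝ) : ℂ) + (α k * g k : ℝ) * s) /
    Complex.Gamma (((1 - βw k + βw k * (a k - α k * g k + α k) : ℝ) : ℂ) +
      (α k * βw k * g k : ℝ) * s)

/-- The corresponding Fox-H function on `(0,∞)` defined by the vertical contour `L_{iγ₀∞}`. -/
noncomputable def foxHposC7 (m p l : ℕ) (e η b a α g βw : ℕ → ℝ) (γ₀ : ℝ) (x : ℝ) : ℂ :=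
  (1 / (2 * π)) * ∫ t : ℝ, foxKernelC7 m p l e η b a α g βw ((γ₀ : ℂ) + (t : ℂ) * Complex.I) *
    Complex.exp (-((γ₀ : ℂ) + (t : ℂ) * Complex.I) * (Real.log x : ℂ))

open scoped ComplexOrder

/-- `PosSpectrum g` says that `g` is integrable with nonnegative Fourier transform. -/
structure PosSpectrum (g : ℝ → ℂ) : Prop where
  integrable : Integrable g
  nonneg : ∀ u : ℝ, 0 ≤ ∫ t : ℝ, g t * Complex.exp (-(t * u * Complex.I))

/-- Bounded measurable functions, dominated by their value at `0`, multiplication by which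
preserves nonnegativity of the Fourier transform. -/
structure PosMult (φ : ℝ → ℂ) : Prop where
  measurable : Measurable φ
  norm_le : ∀ t, ‖φ t‖ ≤ (φ 0).re
  mul : ∀ g, PosSpectrum g → PosSpectrum (fun t => φ t * g t)

namespace PosMult

lemma of_nonneg {φ : ℝ → ℂ} (hm : Measurable φ) (hn : ∀ t, ‖φ t‖ ≤ (φ 0).re)
    (h : ∀ g, PosSpectrum g → ∀ u : ℝ,
      0 ≤ ∫ t : ℝ, φ t * g t * Complex.exp (-(t * u * Complex.I))) : PosMult φ :=
  ⟨hm, hn, fun g hg => ⟨hg.integrable.bdd_mul hm.aestronglyMeasurable (ae_of_all _ hn), h g hg⟩⟩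

lemma im_zero {φ : ℝ → ℂ} (h : PosMult φ) : (φ 0).im = 0 := by
  have h0 := h.norm_le 0
  have h1 : (φ 0).re ≤ ‖φ 0‖ := Complex.re_le_norm _
  exact ((Complex.abs_re_eq_norm).1 (le_antisymm (Complex.abs_re_le_norm _)
    (h0.trans (le_abs_self _))))

lemma re_nonneg {φ : ℝ → ℂ} (h : PosMult φ) : 0 ≤ (φ 0).re :=
  (norm_nonneg _).trans (h.norm_le 0)

lemma const {c : ℂ} (hc : 0 ≤ c) : PosMult (fun _ => c) := by
  have hc' := Complex.nonneg_iff.1 hc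
  refine of_nonneg measurable_const (fun _ => ?_) fun g hg u => ?_
  · rw [← (Complex.abs_re_eq_norm).2 hc'.2.symm, abs_of_nonneg hc'.1]
  · simp_rw [mul_assoc, integral_const_mul]
    have := hg.nonneg u
    simp_rw [mul_assoc] at this
    exact mul_nonneg hc this

lemma mul' {φ ψ : ℝ → ℂ} (h : PosMult φ) (k : PosMult ψ) : PosMult (fun t => φ t * ψ t) where
  measurable := h.measurable.mul k.measurable
  norm_le t := by
    rw [norm_mul, Complex.mul_re, h.im_zero, zero_mul, sub_zero]
    exact mul_le_mul (h.norm_le t) (k.norm_le t) (norm_nonneg _) h.re_nonneg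
  mul g hg := by simpa only [mul_assoc] using h.mul _ (k.mul g hg)

lemma add' {φ ψ : ℝ → ℂ} (h : PosMult φ) (k : PosMult ψ) : PosMult (fun t => φ t + ψ t) := by
  refine of_nonneg (h.measurable.add k.measurable)
    (fun t => (norm_add_le _ _).trans (add_le_add (h.norm_le t) (k.norm_le t))) fun g hg u => ?_
  have hb : ∀ f : ℝ → ℂ, Integrable f →
      Integrable (fun t : ℝ => f t * Complex.exp (-(t * u * Complex.I))) := fun f hf =>
    hf.mul_bdd (c := 1) (by fun_prop) (ae_of_all _ fun t => by
      rw [Complex.norm_exp]; simp)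
  simp_rw [add_mul]
  rw [integral_add (hb _ (h.mul g hg).integrable) (hb _ (k.mul g hg).integrable)]
  exact add_nonneg ((h.mul g hg).nonneg u) ((k.mul g hg).nonneg u)

lemma prod {ι : Type*} (s : Finset ι) {φ : ι → ℝ → ℂ} (h : ∀ i ∈ s, PosMult (φ i)) :
    PosMult (fun t => ∏ i ∈ s, φ i t) := by
  classical
  induction s using Finset.induction_on with
  | empty => simpa using const zero_le_one
  | insert a s ha ih =>
    simp_rw [Finset.prod_insert ha]
    exact (h a (by simp)).mul' (ih fun i hi => h i (by simp [hi]))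

lemma of_tendsto {φ : ℕ → ℝ → ℂ} {ψ : ℝ → ℂ} (h : ∀ᶠ n in atTop, PosMult (φ n))
    (hl : ∀ t, Tendsto (fun n => φ n t) atTop (nhds (ψ t))) : PosMult ψ := by
  obtain ⟨N, hN⟩ := eventually_atTop.1 h
  have hl' : ∀ t, Tendsto (fun n => φ (n + N) t) atTop (nhds (ψ t)) :=
    fun t => (hl t).comp (tendsto_add_atTop_nat N)
  have hP : ∀ n, PosMult (φ (n + N)) := fun n => hN _ (by simp)
  have hre : Tendsto (fun n => (φ (n + N) 0).re) atTop (nhds (ψ 0).re) :=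
    (Complex.continuous_re.tendsto _).comp (hl' 0)
  refine of_nonneg (measurable_of_tendsto_metrizable (fun n => (hP n).measurable)
    (tendsto_pi_nhds.2 hl')) (fun t => le_of_tendsto_of_tendsto' (hl' t).norm hre
      fun n => (hP n).norm_le t) fun g hg u => ?_
  obtain ⟨C, hC⟩ := hre.bddAbove_range
  have hT : Tendsto (fun n => ∫ t : ℝ, φ (n + N) t * g t * Complex.exp (-(t * u * Complex.I)))
      atTop (nhds (∫ t : ℝ, ψ t * g t * Complex.exp (-(t * u * Complex.I)))) := by
    refine tendsto_integral_of_dominated_convergence (fun t => C * ‖g t‖) (fun n => ?_)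
      (hg.integrable.norm.const_mul C) (fun n => ae_of_all _ fun t => ?_)
      (ae_of_all _ fun t => ((hl' t).mul_const _).mul_const _)
    · exact (((hP n).measurable.aestronglyMeasurable).mul hg.integrable.1).mul (by fun_prop)
    · rw [norm_mul, norm_mul, Complex.norm_exp]
      have : ‖φ (n + N) t‖ ≤ C := ((hP n).norm_le t).trans (hC ⟨n, rfl⟩)
      simpa using mul_le_mul_of_nonneg_right this (norm_nonneg (g t))
  exact isClosed_Ici.mem_of_tendsto hT
    (Eventually.of_forall fun n => ((hP n).mul g hg).nonneg u)

lemma exp_mul_I (c : ℝ) : PosMult (fun t => Complex.exp (t * c * Complex.I)) := by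
  refine of_nonneg (by fun_prop) (fun t => by rw [Complex.norm_exp]; simp) fun g hg u => ?_
  convert hg.nonneg (u - c) using 3 with t
  rw [mul_comm (Complex.exp _), mul_assoc, ← Complex.exp_add]
  congr 2
  push_cast
  ring

lemma inv {x : ℝ} (hx : 0 < x) (y : ℝ) : PosMult (fun t => ((x : ℂ) + t * y * Complex.I)⁻¹) := by
  have hre : ∀ t : ℝ, ((x : ℂ) + t * y * Complex.I).re = x := fun t => by simp
  refine of_nonneg (by fun_prop) (fun t => ?_) fun g hg u => ?_
  · rw [norm_inv]
    simp only [Complex.ofReal_zero, zero_mul, add_zero, ← Complex.ofReal_inv, Complex.ofReal_re]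
    refine inv_anti₀ hx ?_
    simpa [hre] using Complex.re_le_norm ((x : ℂ) + t * y * Complex.I)
  have hinv : ∀ t : ℝ, ((x : ℂ) + t * y * Complex.I)⁻¹ =
      ∫ v in Set.Ioi (0 : ℝ), Complex.exp (-((x : ℂ) + t * y * Complex.I) * v) := fun t => by
    rw [integral_exp_mul_complex_Ioi (by simpa using hx)]
    rw [Complex.ofReal_zero, mul_zero, Complex.exp_zero, neg_div_neg_eq, one_div]
  have hsw : ∫ t : ℝ, ((x : ℂ) + t * y * Complex.I)⁻¹ * g t * Complex.exp (-(t * u * Complex.I)) =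
      ∫ v in Set.Ioi (0 : ℝ), ∫ t : ℝ, Complex.exp (-((x : ℂ) + t * y * Complex.I) * v) * g t *
        Complex.exp (-(t * u * Complex.I)) := by
    simp_rw [hinv, ← integral_mul_const]
    refine integral_integral_swap ?_
    have h1 : IntegrableOn (fun v : ℝ => Complex.exp (-(x : ℂ) * v)) (Set.Ioi 0) :=
      integrableOn_exp_mul_complex_Ioi (by simpa using hx) 0
    refine (hg.integrable.mul_prod h1).mono ?_ (ae_of_all _ fun p => ?_)
    · refine (AEStronglyMeasurable.mul (Continuous.aestronglyMeasurable ?_)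
        hg.integrable.1.comp_fst).mul (Continuous.aestronglyMeasurable ?_)
      · fun_prop
      · fun_prop
    · simp [Function.uncurry, Complex.norm_exp, mul_comm]
  rw [hsw]
  refine integral_nonneg fun v => ?_
  have : ∀ t : ℝ, Complex.exp (-((x : ℂ) + t * y * Complex.I) * v) * g t *
        Complex.exp (-(t * u * Complex.I)) =
      (Real.exp (-(x * v)) : ℂ) * (g t * Complex.exp (-(t * (u + y * v : ℝ) * Complex.I))) := by
    intro t
    rw [Complex.ofReal_exp, mul_comm _ (g t), mul_assoc, ← Complex.exp_add, mul_left_comm,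
      ← Complex.exp_add]
    congr 2
    push_cast
    ring
  simp_rw [this, integral_const_mul]
  exact mul_nonneg (by exact_mod_cast (Real.exp_pos _).le) (hg.nonneg _)

lemma gamma {x : ℝ} (hx : 0 < x) (y : ℝ) :
    PosMult (fun t => Complex.Gamma ((x : ℂ) + t * y * Complex.I)) := by
  refine of_tendsto (φ := fun n t => Complex.GammaSeq ((x : ℂ) + t * y * Complex.I) n) ?_
    fun t => Complex.GammaSeq_tendsto_Gamma _
  filter_upwards [eventually_gt_atTop 0] with n hn
  have hn' : (0 : ℝ) < n := by exact_mod_cast hn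
  have hc : (0 : ℂ) ≤ ((n : ℝ) ^ x * n.factorial : ℝ) := by
    exact_mod_cast (by positivity : (0 : ℝ) ≤ (n : ℝ) ^ x * n.factorial)
  convert ((const hc).mul' (exp_mul_I (y * Real.log n))).mul'
    (prod (Finset.range (n + 1)) fun j _ => inv (by positivity : 0 < x + j) y) using 2 with t
  have hexp : (n : ℂ) ^ ((x : ℂ) + t * y * Complex.I) =
      ((n : ℝ) ^ x : ℝ) * Complex.exp (t * (y * Real.log n : ℝ) * Complex.I) := by
    rw [Complex.cpow_add _ _ (by exact_mod_cast hn.ne'), Complex.ofReal_cpow hn'.le,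
      Complex.cpow_def_of_ne_zero (y := t * y * Complex.I) (by exact_mod_cast hn.ne'),
      ← Complex.natCast_log]
    push_cast
    congr 2
    ring
  rw [Complex.GammaSeq, hexp, div_eq_mul_inv, ← Finset.prod_inv_distrib]
  push_cast
  simp_rw [add_right_comm (x : ℂ)]
  ring

lemma gamma_div_gamma {x : ℝ} (hx : 0 < x) (y : ℝ) {δ κ : ℝ} (hδ : 0 ≤ δ) (hκ : 0 < κ)
    (hκ1 : κ ≤ 1) :
    PosMult (fun t => Complex.Gamma ((x : ℂ) + t * y * Complex.I) /
      Complex.Gamma ((δ : ℂ) + κ * ((x : ℂ) + t * y * Complex.I))) := by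
  refine of_tendsto (φ := fun n t => Complex.GammaSeq ((x : ℂ) + t * y * Complex.I) n /
    Complex.GammaSeq ((δ : ℂ) + κ * ((x : ℂ) + t * y * Complex.I)) n) ?_
    fun t => (Complex.GammaSeq_tendsto_Gamma _).div (Complex.GammaSeq_tendsto_Gamma _)
      (Complex.Gamma_ne_zero_of_re_pos ?_)
  swap
  · simp; positivity
  filter_upwards [eventually_gt_atTop 0] with n hn
  have hn' : (0 : ℝ) < n := by exact_mod_cast hn
  have hnC : (n : ℂ) ≠ 0 := by exact_mod_cast hn.ne'
  have hc : (0 : ℂ) ≤ ((n : ℝ) ^ (x - (δ + κ * x)) : ℝ) := by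
    exact_mod_cast (by positivity : (0 : ℝ) ≤ (n : ℝ) ^ (x - (δ + κ * x)))
  have hfac : ∀ j : ℕ, PosMult (fun t : ℝ => (κ : ℂ) + ((δ + j * (1 - κ) : ℝ) : ℂ) *
      (((x + j : ℝ) : ℂ) + t * y * Complex.I)⁻¹) := fun j =>
    (const (by exact_mod_cast hκ.le)).add' ((const (by
      have : 0 ≤ 1 - κ := by linarith
      exact_mod_cast (by positivity : 0 ≤ δ + j * (1 - κ)))).mul' (inv (by positivity) y))
  convert ((const hc).mul' (exp_mul_I (y * (1 - κ) * Real.log n))).mul'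
    (prod (Finset.range (n + 1)) fun j _ => hfac j) using 2 with t
  have hz : ∀ j : ℕ, (x : ℂ) + t * y * Complex.I + j ≠ 0 := fun j h => by
    have := congrArg Complex.re h
    simp at this
    have : 0 < x + j := by positivity
    linarith
  have hw : ∀ j : ℕ, (δ : ℂ) + κ * ((x : ℂ) + t * y * Complex.I) + j ≠ 0 := fun j h => by
    have := congrArg Complex.re h
    simp at this
    have : 0 < δ + κ * x + j := by positivity
    linarith
  have hexp : (n : ℂ) ^ ((x : ℂ) + t * y * Complex.I) /
      (n : ℂ) ^ ((δ : ℂ) + κ * ((x : ℂ) + t * y * Complex.I)) =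
      ((n : ℝ) ^ (x - (δ + κ * x)) : ℝ) *
        Complex.exp (t * (y * (1 - κ) * Real.log n : ℝ) * Complex.I) := by
    rw [← Complex.cpow_sub _ _ hnC, Complex.ofReal_cpow hn'.le, Complex.cpow_def_of_ne_zero hnC,
      Complex.ofReal_natCast, Complex.cpow_def_of_ne_zero hnC, ← Complex.exp_add,
      ← Complex.natCast_log]
    congr 1
    push_cast
    ring
  have hprod : ∏ j ∈ Finset.range (n + 1), ((κ : ℂ) + ((δ + j * (1 - κ) : ℝ) : ℂ) *
      (((x + j : ℝ) : ℂ) + t * y * Complex.I)⁻¹) =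
      (∏ j ∈ Finset.range (n + 1), ((δ : ℂ) + κ * ((x : ℂ) + t * y * Complex.I) + j)) /
      ∏ j ∈ Finset.range (n + 1), ((x : ℂ) + t * y * Complex.I + j) := by
    rw [← Finset.prod_div_distrib]
    refine Finset.prod_congr rfl fun j _ => ?_
    have h := hz j
    push_cast
    rw [add_right_comm (x : ℂ) (j : ℂ), eq_div_iff h, add_mul, mul_assoc _ _⁻¹, inv_mul_cancel₀ h]
    ring
  rw [hprod, ← hexp, Complex.GammaSeq, Complex.GammaSeq]
  have h1 := Finset.prod_ne_zero_iff.2 fun j (_ : j ∈ Finset.range (n + 1)) => hz j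
  have h2 := Finset.prod_ne_zero_iff.2 fun j (_ : j ∈ Finset.range (n + 1)) => hw j
  have h3 : (n.factorial : ℂ) ≠ 0 := by exact_mod_cast n.factorial_ne_zero
  have h4 : (n : ℂ) ^ ((δ : ℂ) + κ * ((x : ℂ) + t * y * Complex.I)) ≠ 0 := by
    simp [Complex.cpow_eq_zero_iff, hnC]
  field_simp

/-- An integrable multiplier has itself a nonnegative Fourier transform. -/
lemma posSpectrum {φ : ℝ → ℂ} (h : PosMult φ) (hi : Integrable φ) : PosSpectrum φ := by
  refine ⟨hi, fun u => ?_⟩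
  have hG : ∀ b : ℝ, 0 < b → PosSpectrum (fun t : ℝ => Complex.exp (-(b : ℂ) * t ^ 2)) := by
    intro b hb
    refine ⟨integrable_cexp_neg_mul_sq (by simpa using hb), fun v => ?_⟩
    have := fourierIntegral_gaussian (b := b) (by simpa using hb) (-(v : ℂ))
    have h2 : ∫ t : ℝ, Complex.exp (-(b : ℂ) * t ^ 2) * Complex.exp (-(t * v * Complex.I)) =
        ((π / b) ^ (1 / 2 : ℝ) * Real.exp (-v ^ 2 / (4 * b)) : ℝ) := by
      rw [Complex.ofReal_mul, Complex.ofReal_cpow (by positivity), Complex.ofReal_exp]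
      push_cast
      rw [neg_sq] at this
      rw [← this]
      refine integral_congr_ae (ae_of_all _ fun t => ?_)
      simp only
      rw [mul_comm]
      congr 2
      ring
    rw [h2]
    exact_mod_cast (by positivity)
  have hT : Tendsto (fun n : ℕ => ∫ t : ℝ, φ t * Complex.exp (-((1 / (n + 1) : ℝ) : ℂ) * t ^ 2) *
      Complex.exp (-(t * u * Complex.I))) atTop
      (nhds (∫ t : ℝ, φ t * Complex.exp (-(t * u * Complex.I)))) := by
    refine tendsto_integral_of_dominated_convergence (fun t => ‖φ t‖) (fun n => ?_)
      hi.norm (fun n => ae_of_all _ fun t => ?_) (ae_of_all _ fun t => ?_)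
    · exact (hi.1.mul (by fun_prop)).mul (by fun_prop)
    · rw [norm_mul, norm_mul]
      have h1 : ‖Complex.exp (-(t * u * Complex.I))‖ = 1 := by rw [Complex.norm_exp]; simp
      have h2 : ‖Complex.exp (-((1 / (n + 1) : ℝ) : ℂ) * t ^ 2)‖ ≤ 1 := by
        rw [Complex.norm_exp, Real.exp_le_one_iff]
        have : (-((1 / (n + 1) : ℝ) : ℂ) * t ^ 2) = ((-(1 / (n + 1)) * t ^ 2 : ℝ) : ℂ) := by
          push_cast; ring
        rw [this, Complex.ofReal_re, neg_mul]
        exact neg_nonpos.2 (by positivity)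
      rw [h1, mul_one]
      exact mul_le_of_le_one_right (norm_nonneg _) h2
    · have h0 : Tendsto (fun n : ℕ => Complex.exp (-((1 / (n + 1) : ℝ) : ℂ) * t ^ 2)) atTop
          (nhds (Complex.exp (-((0 : ℝ) : ℂ) * t ^ 2))) := by
        have hcont : Continuous fun r : ℝ => Complex.exp (-(r : ℂ) * t ^ 2) := by fun_prop
        exact (hcont.tendsto 0).comp tendsto_one_div_add_atTop_nhds_zero_nat
      simp only [Complex.ofReal_zero, neg_zero, zero_mul, Complex.exp_zero] at h0
      simpa using (h0.const_mul (φ t)).mul_const (Complex.exp (-(t * u * Complex.I)))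
  exact isClosed_Ici.mem_of_tendsto hT
    (Eventually.of_forall fun n => (h.mul _ (hG _ (by positivity))).nonneg u)

end PosMult

/-- `F` is holomorphic over the set `U` of real parts, with quadratic decay along vertical lines,
uniformly over compact intervals of real parts. -/
structure VerticalDecay (U : Set ℝ) (F : ℂ → ℂ) : Prop where
  isOpen : IsOpen U
  isUpperSet : IsUpperSet U
  differentiableOn : DifferentiableOn ℂ F (Complex.re ⁻¹' U)
  bound : ∀ a ∈ U, ∀ b, ∃ C, ∀ σ ∈ Set.Icc a b, ∀ t : ℝ,
    ‖F ((σ : ℂ) + (t : ℂ) * Complex.I)‖ ≤ C * (1 + t ^ 2)⁻¹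

/-- The Mellin-Barnes integral of `F` along the vertical line through `γ`. -/
noncomputable def mellinBarnes (F : ℂ → ℂ) (γ x : ℝ) : ℂ :=
  (1 / (2 * π)) * ∫ t : ℝ, F ((γ : ℂ) + (t : ℂ) * Complex.I) *
    Complex.exp (-((γ : ℂ) + (t : ℂ) * Complex.I) * (Real.log x : ℂ))

namespace VerticalDecay

variable {U : Set ℝ} {F : ℂ → ℂ}

lemma continuous_line (h : VerticalDecay U F) {a : ℝ} (ha : a ∈ U) :
    Continuous fun t : ℝ => F ((a : ℂ) + (t : ℂ) * Complex.I) := by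
  refine h.differentiableOn.continuousOn.comp_continuous (by fun_prop) fun t => ?_
  simpa using ha

lemma integrable_line (h : VerticalDecay U F) {a : ℝ} (ha : a ∈ U) :
    Integrable fun t : ℝ => F ((a : ℂ) + (t : ℂ) * Complex.I) := by
  obtain ⟨C, hC⟩ := h.bound a ha a
  exact (integrable_inv_one_add_sq.const_mul C).mono' (h.continuous_line ha).aestronglyMeasurable
    (ae_of_all _ fun t => hC a (by simp) t)

lemma mul_exp (h : VerticalDecay U F) (L : ℝ) :
    VerticalDecay U (fun s => F s * Complex.exp (-s * L)) where
  isOpen := h.isOpen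
  isUpperSet := h.isUpperSet
  differentiableOn := h.differentiableOn.mul (by fun_prop)
  bound a ha b := by
    obtain ⟨C, hC⟩ := h.bound a ha b
    refine ⟨C * Real.exp (max |a| |b| * |L|), fun σ hσ t => ?_⟩
    have h1 : ‖Complex.exp (-((σ : ℂ) + (t : ℂ) * Complex.I) * L)‖ ≤
        Real.exp (max |a| |b| * |L|) := by
      rw [Complex.norm_exp, Real.exp_le_exp]
      simp only [neg_mul, Complex.neg_re, Complex.re_mul_ofReal, Complex.add_re, Complex.ofReal_re,
        Complex.re_ofReal_mul, Complex.I_re, mul_zero, add_zero]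
      refine (neg_le_abs _).trans ?_
      rw [abs_mul]
      exact mul_le_mul_of_nonneg_right (abs_le_max_abs_abs hσ.1 hσ.2) (abs_nonneg _)
    rw [norm_mul]
    calc _ ≤ C * (1 + t ^ 2)⁻¹ * Real.exp (max |a| |b| * |L|) :=
          mul_le_mul (hC σ hσ t) h1 (norm_nonneg _) ((norm_nonneg _).trans (hC σ hσ t))
      _ = _ := by ring

lemma integral_line_eq_of_le (h : VerticalDecay U F) {a b : ℝ} (ha : a ∈ U) (hab : a ≤ b) :
    ∫ t : ℝ, F ((a : ℂ) + (t : ℂ) * Complex.I) = ∫ t : ℝ, F ((b : ℂ) + (t : ℂ) * Complex.I) := by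
  obtain ⟨C, hC⟩ := h.bound a ha b
  have hrect : ∀ T : ℝ, (∫ x : ℝ in a..b, F (x + (-T : ℝ) * Complex.I)) -
      (∫ x : ℝ in a..b, F (x + T * Complex.I)) +
      Complex.I • (∫ y : ℝ in (-T)..T, F (b + y * Complex.I)) -
      Complex.I • (∫ y : ℝ in (-T)..T, F (a + y * Complex.I)) = 0 := fun T => by
    have := Complex.integral_boundary_rect_eq_zero_of_differentiableOn F ⟨a, -T⟩ ⟨b, T⟩
      (h.differentiableOn.mono fun s hs => h.isUpperSet ?_ ha)
    · simpa using this
    · rw [Complex.mem_reProdIm] at hs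
      simp only [Set.uIcc_of_le hab] at hs
      exact hs.1.1
  have hhor : ∀ r : ℝ → ℝ, (∀ T, r T ^ 2 = T ^ 2) →
      Tendsto (fun T : ℝ => ∫ x : ℝ in a..b, F (x + (r T : ℝ) * Complex.I)) atTop (nhds 0) := by
    intro r hr
    have hlim : Tendsto (fun T : ℝ => C * (1 + T ^ 2)⁻¹ * |b - a|) atTop (nhds 0) := by
      have : Tendsto (fun T : ℝ => (1 + T ^ 2)⁻¹) atTop (nhds 0) :=
        tendsto_inv_atTop_zero.comp (tendsto_atTop_add_const_left _ _
          (tendsto_pow_atTop (by norm_num)))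
      simpa using (this.const_mul C).mul_const |b - a|
    refine squeeze_zero_norm (fun T => ?_) hlim
    refine intervalIntegral.norm_integral_le_of_norm_le_const fun x hx => ?_
    rw [Set.uIoc_of_le hab] at hx
    rw [← hr T]
    exact hC x ⟨hx.1.le, hx.2⟩ _
  have hver : ∀ c ∈ U, Tendsto (fun T : ℝ => ∫ y : ℝ in (-T)..T, F (c + y * Complex.I)) atTop
      (nhds (∫ t : ℝ, F ((c : ℂ) + (t : ℂ) * Complex.I))) := fun c hc =>
    intervalIntegral_tendsto_integral (h.integrable_line hc) tendsto_neg_atTop_atBot tendsto_id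
  have hlim := (((hhor (fun T => -T) (by simp)).sub (hhor (fun T => T) (by simp))).add
    ((hver b (h.isUpperSet hab ha)).const_smul Complex.I)).sub ((hver a ha).const_smul Complex.I)
  simp only [hrect] at hlim
  have := tendsto_nhds_unique hlim tendsto_const_nhds
  rw [sub_self, zero_add, ← smul_sub, smul_eq_zero] at this
  exact (sub_eq_zero.1 (this.resolve_left Complex.I_ne_zero)).symm

lemma mellinBarnes_eq (h : VerticalDecay U F) {a b : ℝ} (ha : a ∈ U) (hb : b ∈ U) (x : ℝ) :
    mellinBarnes F a x = mellinBarnes F b x := by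
  unfold mellinBarnes
  congr 1
  rcases le_total a b with hab | hab
  · exact (h.mul_exp (Real.log x)).integral_line_eq_of_le ha hab
  · exact ((h.mul_exp (Real.log x)).integral_line_eq_of_le hb hab).symm

lemma norm_mellinBarnes_le (h : VerticalDecay U F) {a b : ℝ} (ha : a ∈ U) (hb : b ∈ U) :
    ∃ C, ∀ x > 0, ‖mellinBarnes F a x‖ ≤ C * x ^ (-b) := by
  refine ⟨1 / (2 * π) * ∫ t : ℝ, ‖F ((b : ℂ) + (t : ℂ) * Complex.I)‖, fun x hx => ?_⟩
  rw [h.mellinBarnes_eq ha hb, mellinBarnes, norm_mul, mul_assoc]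
  have h1 : ‖(1 / (2 * π) : ℂ)‖ = 1 / (2 * π) := by
    simp [abs_of_pos Real.pi_pos]
  rw [h1]
  refine mul_le_mul_of_nonneg_left ?_ (by positivity)
  refine (norm_integral_le_integral_norm _).trans_eq ?_
  rw [← integral_mul_const]
  refine integral_congr_ae (ae_of_all _ fun t => ?_)
  simp only [norm_mul, Complex.norm_exp]
  congr 1
  rw [Real.rpow_def_of_pos hx]
  congr 1
  simp [mul_comm]

lemma continuousOn_mellinBarnes (h : VerticalDecay U F) {a : ℝ} (ha : a ∈ U) :
    ContinuousOn (mellinBarnes F a) (Set.Ioi 0) := by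
  have hc : Continuous fun L : ℝ => ∫ t : ℝ, F ((a : ℂ) + (t : ℂ) * Complex.I) *
      Complex.exp (-(t * L : ℝ) * Complex.I) := by
    refine continuous_of_dominated (bound := fun t => ‖F ((a : ℂ) + (t : ℂ) * Complex.I)‖)
      (fun L => ?_) (fun L => ae_of_all _ fun t => ?_) (h.integrable_line ha).norm
      (ae_of_all _ fun t => by fun_prop)
    · exact (h.integrable_line ha).1.mul (by fun_prop)
    · rw [norm_mul, Complex.norm_exp]
      simp
  have heq : ∀ x : ℝ, mellinBarnes F a x = (1 / (2 * π)) * (Complex.exp (-a * Real.log x) *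
      ∫ t : ℝ, F ((a : ℂ) + (t : ℂ) * Complex.I) *
      Complex.exp (-(t * Real.log x : ℝ) * Complex.I)) := fun x => by
    rw [mellinBarnes, ← integral_const_mul (Complex.exp (-a * Real.log x))]
    congr 2
    funext t
    rw [mul_left_comm, ← Complex.exp_add]
    congr 2
    push_cast
    ring
  have hlog : ContinuousOn Real.log (Set.Ioi 0) :=
    Real.continuousOn_log.mono fun x hx => ne_of_gt hx
  rw [funext heq]
  exact continuousOn_const.mul (ContinuousOn.mul (by fun_prop) (hc.comp_continuousOn hlog))

lemma mellinConvergent (h : VerticalDecay U F) {a s : ℝ} (ha : a ∈ U) (hs : s ∈ U) :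
    MellinConvergent (mellinBarnes F a) s := by
  obtain ⟨ε, hε, hball⟩ := Metric.isOpen_iff.1 h.isOpen s hs
  have hlo : s - ε / 2 ∈ U := hball (by simp [abs_of_pos hε, hε])
  have hup : s + 1 ∈ U := h.isUpperSet (by simp) hs
  obtain ⟨C, hC⟩ := h.norm_mellinBarnes_le ha hlo
  obtain ⟨D, hD⟩ := h.norm_mellinBarnes_le ha hup
  refine mellinConvergent_of_isBigO_rpow (a := s + 1) (b := s - ε / 2)
    ((h.continuousOn_mellinBarnes ha).locallyIntegrableOn measurableSet_Ioi) ?_ (by simp) ?_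
    (by simp [hε])
  · refine Asymptotics.IsBigO.of_bound D ?_
    filter_upwards [eventually_gt_atTop 0] with x hx
    rw [Real.norm_of_nonneg (Real.rpow_nonneg hx.le _)]
    exact hD x hx
  · refine Asymptotics.IsBigO.of_bound C ?_
    filter_upwards [self_mem_nhdsWithin] with x hx
    rw [Real.norm_of_nonneg (Real.rpow_nonneg (le_of_lt hx) _)]
    exact hC x hx

lemma integrableOn_pow_mul (h : VerticalDecay U F) {a : ℝ} (ha : a ∈ U) (h1 : (1 : ℝ) ∈ U)
    (n : ℕ) : IntegrableOn (fun x : ℝ => (x : ℂ) ^ n * mellinBarnes F a x) (Set.Ioi 0) := by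
  have := h.mellinConvergent ha (h.isUpperSet (by simp : (1 : ℝ) ≤ n + 1) h1)
  simpa [MellinConvergent] using this

open scoped FourierTransform in
lemma integral_mellinBarnes (h : VerticalDecay U F) {a : ℝ} (ha : a ∈ U) (h1 : (1 : ℝ) ∈ U) :
    ∫ x in Set.Ioi (0 : ℝ), mellinBarnes F a x = F 1 := by
  set ψ : ℝ → ℂ := fun y => F ((1 : ℝ) + 2 * π * y * Complex.I) with hψ
  have hcont : Continuous ψ := by
    have := (h.continuous_line h1).comp (continuous_const.mul continuous_id : Continuous
      fun y : ℝ => 2 * π * y)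
    simpa [hψ, Function.comp_def] using this
  have hint : Integrable ψ := by
    have := (h.integrable_line h1).comp_mul_left' (by positivity : 2 * π ≠ 0)
    simpa [hψ] using this
  have hH : ∀ u : ℝ, Real.exp (-u) • mellinBarnes F a (Real.exp (-u)) = 𝓕⁻ ψ u := fun u => by
    have hM : mellinBarnes F 1 (Real.exp (-u)) = mellinInv 1 F (Real.exp (-u)) := by
      rw [mellinBarnes, mellinInv, Complex.real_smul]
      push_cast
      congr 2
      funext t
      rw [Complex.cpow_def_of_ne_zero (Complex.exp_ne_zero _), ← Complex.ofReal_neg,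
        ← Complex.ofReal_exp, ← Complex.ofReal_log (Real.exp_pos _).le, smul_eq_mul, mul_comm]
      congr 2
      ring
    rw [h.mellinBarnes_eq ha h1, hM, mellinInv_eq_fourierInv _ _ (Real.exp_pos _), Real.log_exp,
      neg_neg, Complex.ofReal_one, Complex.cpow_neg_one, Complex.real_smul, smul_eq_mul,
      mul_inv_cancel_left₀ (by simp)]
    simp [hψ]
  have hmel := mellin_eq_fourier (mellinBarnes F a) (s := 1)
  simp only [Complex.one_re, Complex.one_im, zero_div, neg_mul, one_mul, hH] at hmel
  have hI : Integrable (𝓕 ψ) := by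
    have hi := h.integrableOn_pow_mul ha h1 0
    rw [← Real.range_exp, ← Set.image_univ,
      integrableOn_image_iff_integrableOn_abs_deriv_smul MeasurableSet.univ
        (fun x _ => (Real.hasDerivAt_exp x).hasDerivWithinAt) Real.exp_injective.injOn,
      integrableOn_univ] at hi
    refine hi.congr (ae_of_all _ fun w => ?_)
    have := hH (-w)
    rw [neg_neg, Real.fourierInv_eq_fourier_neg, neg_neg] at this
    simpa using this
  change _ = 𝓕 (𝓕⁻ ψ) 0 at hmel
  rw [hcont.fourier_fourierInv_eq hint hI] at hmel
  simpa [mellin, hψ] using hmel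

end VerticalDecay

section Kernel

variable {m p l : ℕ} {e η b a α g βw : ℕ → ℝ}

/-- The real parts lying to the right of all poles of the kernel. -/
def foxAbscissae (m p l : ℕ) (e η a α g : ℕ → ℝ) : Set ℝ :=
  {σ | (∀ j < p + m, 0 < e j + η j * σ) ∧
    ∀ k < l, 0 < (a k - α k * g k + α k) + α k * g k * σ}

lemma isUpperSet_foxAbscissae (hη : ∀ j < p + m, 0 < η j) (hα : ∀ k < l, 0 < α k)
    (hg : ∀ k < l, 0 < g k) : IsUpperSet (foxAbscissae m p l e η a α g) := by
  intro σ τ hστ hσ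
  refine ⟨fun j hj => (hσ.1 j hj).trans_le ?_, fun k hk => (hσ.2 k hk).trans_le ?_⟩
  · have := hη j hj
    gcongr
  · have := mul_pos (hα k hk) (hg k hk)
    gcongr

lemma isOpen_foxAbscissae : IsOpen (foxAbscissae m p l e η a α g) := by
  have : foxAbscissae m p l e η a α g =
      (⋂ j ∈ Set.Iio (p + m), {σ | 0 < e j + η j * σ}) ∩
      ⋂ k ∈ Set.Iio l, {σ | 0 < (a k - α k * g k + α k) + α k * g k * σ} := by
    ext; simp [foxAbscissae]
  rw [this]
  exact ((Set.finite_Iio _).isOpen_biInter fun j _ =>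
      isOpen_lt continuous_const (by fun_prop)).inter
    ((Set.finite_Iio _).isOpen_biInter fun k _ => isOpen_lt continuous_const (by fun_prop))

lemma differentiableOn_gamma_affine {U : Set ℝ} {x y : ℝ} (h : ∀ σ ∈ U, 0 < x + y * σ) :
    DifferentiableOn ℂ (fun s => Complex.Gamma ((x : ℂ) + y * s)) (Complex.re ⁻¹' U) := by
  intro s hs
  have hd : DifferentiableAt ℂ Complex.Gamma ((x : ℂ) + y * s) := by
    refine Complex.differentiableAt_Gamma _ fun n hn => ?_
    have h1 := congrArg Complex.re hn
    simp only [Complex.add_re, Complex.ofReal_re, Complex.re_ofReal_mul, Complex.neg_re,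
      Complex.natCast_re] at h1
    have := h _ hs
    have : (0 : ℝ) ≤ n := n.cast_nonneg
    linarith
  exact (DifferentiableAt.comp s hd (by fun_prop)).differentiableWithinAt

lemma differentiable_inv_gamma_affine (x y : ℂ) :
    Differentiable ℂ (fun s => (Complex.Gamma (x + y * s))⁻¹) :=
  Complex.differentiable_one_div_Gamma.comp (by fun_prop : Differentiable ℂ fun s => x + y * s)

lemma differentiableOn_foxKernelC7 : DifferentiableOn ℂ (foxKernelC7 m p l e η b a α g βw)
    (Complex.re ⁻¹' foxAbscissae m p l e η a α g) := by
  refine (DifferentiableOn.mul ?_ ?_).mul ?_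
  · refine DifferentiableOn.fun_finsetProd fun i hi => ?_
    simp_rw [div_eq_mul_inv]
    exact (differentiableOn_gamma_affine fun σ hσ =>
      hσ.1 i (by have := Finset.mem_range.1 hi; omega)).mul
      (differentiable_inv_gamma_affine _ _).differentiableOn
  · exact DifferentiableOn.fun_finsetProd fun j hj => differentiableOn_gamma_affine fun σ hσ =>
      hσ.1 j (Finset.mem_Ico.1 hj).2
  · refine DifferentiableOn.fun_finsetProd fun k hk => ?_
    simp_rw [div_eq_mul_inv]
    exact (differentiableOn_gamma_affine fun σ hσ => hσ.2 k (Finset.mem_range.1 hk)).mul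
      (differentiable_inv_gamma_affine _ _).differentiableOn

lemma posMult_gamma_affine {x y σ : ℝ} (h : 0 < x + y * σ) :
    PosMult fun t : ℝ => Complex.Gamma ((x : ℂ) + y * ((σ : ℂ) + (t : ℂ) * Complex.I)) := by
  convert PosMult.gamma h y using 3 with t
  push_cast
  ring

lemma posMult_gamma_div_gamma_affine {x y x' y' δ κ σ : ℝ} (h : 0 < x + y * σ) (hδ : 0 ≤ δ)
    (hκ : 0 < κ) (hκ1 : κ ≤ 1) (hx' : x' = δ + κ * x) (hy' : y' = κ * y) :
    PosMult fun t : ℝ => Complex.Gamma ((x : ℂ) + y * ((σ : ℂ) + (t : ℂ) * Complex.I)) /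
      Complex.Gamma ((x' : ℂ) + y' * ((σ : ℂ) + (t : ℂ) * Complex.I)) := by
  subst hx' hy'
  convert PosMult.gamma_div_gamma h y hδ hκ hκ1 using 3 with t
  · push_cast
    ring_nf
  · congr 1
    push_cast
    ring

lemma posMult_foxKernelC7_left (hb : ∀ i < p, 0 < b i) {σ : ℝ}
    (hσ : σ ∈ foxAbscissae m p l e η a α g) :
    PosMult fun t : ℝ => ∏ i ∈ Finset.range p,
      Complex.Gamma ((e i : ℝ) + η i * ((σ : ℂ) + (t : ℂ) * Complex.I)) /
        Complex.Gamma ((e i + b i : ℝ) + η i * ((σ : ℂ) + (t : ℂ) * Complex.I)) :=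
  PosMult.prod _ fun i hi => by
    have hi := Finset.mem_range.1 hi
    exact posMult_gamma_div_gamma_affine (hσ.1 i (by omega)) (hb i hi).le one_pos le_rfl
      (by ring) (by ring)

lemma posMult_foxKernelC7_right (hβw : ∀ k < l, βw k ∈ Set.Ioo (0 : ℝ) 1) {σ : ℝ}
    (hσ : σ ∈ foxAbscissae m p l e η a α g) :
    PosMult fun t : ℝ => ∏ k ∈ Finset.range l,
      Complex.Gamma (((a k - α k * g k + α k : ℝ) : ℂ) +
        (α k * g k : ℝ) * ((σ : ℂ) + (t : ℂ) * Complex.I)) /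
      Complex.Gamma (((1 - βw k + βw k * (a k - α k * g k + α k) : ℝ) : ℂ) +
        (α k * βw k * g k : ℝ) * ((σ : ℂ) + (t : ℂ) * Complex.I)) :=
  PosMult.prod _ fun k hk => by
    have hk := Finset.mem_range.1 hk
    exact posMult_gamma_div_gamma_affine (hσ.2 k hk) (sub_nonneg.2 (hβw k hk).2.le)
      (hβw k hk).1 (hβw k hk).2.le rfl (by ring)

lemma posMult_foxKernelC7 (hb : ∀ i < p, 0 < b i) (hβw : ∀ k < l, βw k ∈ Set.Ioo (0 : ℝ) 1)
    {σ : ℝ} (hσ : σ ∈ foxAbscissae m p l e η a α g) :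
    PosMult fun t : ℝ => foxKernelC7 m p l e η b a α g βw ((σ : ℂ) + (t : ℂ) * Complex.I) :=
  ((posMult_foxKernelC7_left hb hσ).mul' (PosMult.prod _ fun j hj =>
    posMult_gamma_affine (hσ.1 j (Finset.mem_Ico.1 hj).2))).mul' (posMult_foxKernelC7_right hβw hσ)

lemma posMult_mul_foxKernelC7 (hm : 1 ≤ m) (hb : ∀ i < p, 0 < b i)
    (hβw : ∀ k < l, βw k ∈ Set.Ioo (0 : ℝ) 1) {σ : ℝ}
    (hσ : σ ∈ foxAbscissae m p l e η a α g) :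
    PosMult fun t : ℝ => ((e p : ℂ) + η p * ((σ : ℂ) + (t : ℂ) * Complex.I)) *
      ((e p : ℂ) + η p * ((σ : ℂ) + (t : ℂ) * Complex.I) + 1) *
      foxKernelC7 m p l e η b a α g βw ((σ : ℂ) + (t : ℂ) * Complex.I) := by
  have hp := hσ.1 p (by omega)
  have hG : PosMult fun t : ℝ =>
      Complex.Gamma (((e p + 2 : ℝ) : ℂ) + η p * ((σ : ℂ) + (t : ℂ) * Complex.I)) :=
    posMult_gamma_affine (by linarith)
  convert ((posMult_foxKernelC7_left hb hσ).mul' (hG.mul'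
    (PosMult.prod (Finset.Ico (p + 1) (p + m)) fun j hj =>
      posMult_gamma_affine (hσ.1 j (Finset.mem_Ico.1 hj).2)))).mul'
    (posMult_foxKernelC7_right hβw hσ) using 2 with t
  rw [foxKernelC7, Finset.prod_eq_prod_Ico_succ_bot (by omega : p < p + m)]
  have hre : ((e p : ℂ) + η p * ((σ : ℂ) + (t : ℂ) * Complex.I)).re = e p + η p * σ := by simp
  have hΓ : Complex.Gamma (((e p + 2 : ℝ) : ℂ) + η p * ((σ : ℂ) + (t : ℂ) * Complex.I)) =
      ((e p : ℂ) + η p * ((σ : ℂ) + (t : ℂ) * Complex.I)) *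
      ((e p : ℂ) + η p * ((σ : ℂ) + (t : ℂ) * Complex.I) + 1) *
      Complex.Gamma ((e p : ℂ) + η p * ((σ : ℂ) + (t : ℂ) * Complex.I)) := by
    set w := (e p : ℂ) + η p * ((σ : ℂ) + (t : ℂ) * Complex.I)
    have h0 : w ≠ 0 := fun h => by rw [h] at hre; simp at hre; linarith
    have h1 : w + 1 ≠ 0 := fun h => by
      have := congrArg Complex.re h
      simp [hre] at this
      linarith
    rw [mul_comm w, mul_assoc, ← Complex.Gamma_add_one _ h0, ← Complex.Gamma_add_one _ h1]
    congr 1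
    simp only [w]
    push_cast
    ring
  rw [hΓ]
  ring

lemma verticalDecay_foxKernelC7 (hm : 1 ≤ m) (hη : ∀ j < p + m, 0 < η j)
    (hb : ∀ i < p, 0 < b i) (hα : ∀ k < l, 0 < α k) (hg : ∀ k < l, 0 < g k)
    (hβw : ∀ k < l, βw k ∈ Set.Ioo (0 : ℝ) 1) :
    VerticalDecay (foxAbscissae m p l e η a α g) (foxKernelC7 m p l e η b a α g βw) where
  isOpen := isOpen_foxAbscissae
  isUpperSet := isUpperSet_foxAbscissae hη hα hg
  differentiableOn := differentiableOn_foxKernelC7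
  bound c hc d := by
    have hηp := hη p (by omega)
    have hcp := hc.1 p (by omega)
    set P : ℂ → ℂ := fun s => ((e p : ℂ) + η p * s) * ((e p : ℂ) + η p * s + 1) *
      foxKernelC7 m p l e η b a α g βw s with hP
    have hmem : ∀ σ ∈ Set.Icc c d, σ ∈ foxAbscissae m p l e η a α g := fun σ hσ =>
      isUpperSet_foxAbscissae hη hα hg hσ.1 hc
    have hcont : ContinuousOn (fun σ : ℝ => ‖P σ‖) (Set.Icc c d) := by
      have hPc : ContinuousOn P (Complex.re ⁻¹' foxAbscissae m p l e η a α g) :=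
        ContinuousOn.mul (Continuous.continuousOn (by fun_prop))
          differentiableOn_foxKernelC7.continuousOn
      exact (hPc.comp Complex.continuous_ofReal.continuousOn fun σ hσ => hmem σ hσ).norm
    obtain ⟨C, hC⟩ := isCompact_Icc.exists_bound_of_continuousOn hcont
    set q := min ((e p + η p * c) ^ 2) (η p ^ 2)
    have hq0 : 0 < q := lt_min (by positivity) (by positivity)
    refine ⟨C / q, fun σ hσ t => ?_⟩
    set s : ℂ := (σ : ℂ) + (t : ℂ) * Complex.I with hs
    set w : ℂ := (e p : ℂ) + η p * s with hw
    have hPs : ‖P s‖ ≤ C := by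
      have h1 := (posMult_mul_foxKernelC7 hm hb hβw (hmem σ hσ)).norm_le t
      refine (h1.trans (Complex.re_le_norm _)).trans ?_
      simpa [hP] using hC σ hσ
    have hre : w.re = e p + η p * σ := by simp [hw, hs]
    have him : w.im = η p * t := by simp [hw, hs]
    have hle : e p + η p * c ≤ w.re := by
      rw [hre]
      have := hσ.1
      gcongr
    have hw2 : q * (1 + t ^ 2) ≤ ‖w‖ ^ 2 := by
      rw [← Complex.normSq_eq_norm_sq, Complex.normSq_apply, him]
      have h1 : q ≤ (e p + η p * c) ^ 2 := min_le_left _ _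
      have h2 : q * t ^ 2 ≤ η p ^ 2 * t ^ 2 := by
        gcongr
        exact min_le_right _ _
      nlinarith [mul_self_le_mul_self hcp.le hle]
    have hw1 : ‖w‖ ≤ ‖w + 1‖ := by
      refine (sq_le_sq₀ (norm_nonneg _) (norm_nonneg _)).1 ?_
      rw [← Complex.normSq_eq_norm_sq, ← Complex.normSq_eq_norm_sq, Complex.normSq_apply,
        Complex.normSq_apply]
      simp only [Complex.add_re, Complex.one_re, Complex.add_im, Complex.one_im, add_zero]
      nlinarith
    have hmain : q * (1 + t ^ 2) * ‖foxKernelC7 m p l e η b a α g βw s‖ ≤ C := by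
      refine le_trans ?_ hPs
      rw [hP]
      simp only [norm_mul]
      refine mul_le_mul_of_nonneg_right (hw2.trans ?_) (norm_nonneg _)
      rw [sq]
      exact mul_le_mul_of_nonneg_left hw1 (norm_nonneg _)
    rw [← div_eq_mul_inv, div_div, le_div_iff₀ (by positivity), mul_comm]
    exact hmain

end Kernel

/-- the class (C7) Fox-H function is nonnegative and integrable on `(0,∞)`,
and its normalization `ρ₇ = H/K₇` is a probability density with all moments finite. -/
theorem foxH_classC7_density
    (m p l : ℕ) (hm : 1 ≤ m) (hp : 1 ≤ p) (hl : 1 ≤ l)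
    (e η b a α g βw : ℕ → ℝ)
    (hη : ∀ j < p + m, 0 < η j) (heη : ∀ j < p + m, 0 < e j + η j)
    (hb : ∀ i < p, 0 < b i) (hbsum : 1 < ∑ i ∈ Finset.range p, b i)
    (hα : ∀ k < l, 0 < α k) (hg : ∀ k < l, 0 < g k)
    (hβw : ∀ k < l, βw k ∈ Set.Ioo (0 : ℝ) 1) (haα : ∀ k < l, 0 < a k + α k)
    (γ₀ : ℝ)
    (hγ₀e : ∀ j < p + m, -(e j) / η j < γ₀)
    (hγ₀c : ∀ k < l, -(a k - α k * g k + α k) / (α k * g k) < γ₀)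
    (K₇ : ℝ)
    (hK₇ : K₇ = (∏ i ∈ Finset.range p, (Real.Gamma (e i + η i) / Real.Gamma (e i + b i + η i))) *
      (∏ j ∈ Finset.Ico p (p + m), Real.Gamma (e j + η j)) *
      ∏ k ∈ Finset.range l,
        (Real.Gamma (a k + α k) / Real.Gamma (1 - βw k + βw k * (a k + α k)))) :
    (∀ x > (0 : ℝ), (foxHposC7 m p l e η b a α g βw γ₀ x).im = 0 ∧
      0 ≤ (foxHposC7 m p l e η b a α g βw γ₀ x).re) ∧
    IntegrableOn (foxHposC7 m p l e η b a α g βw γ₀) (Set.Ioi 0) volume ∧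
    (∫ x in Set.Ioi (0 : ℝ), (foxHposC7 m p l e η b a α g βw γ₀ x).re / K₇) = 1 ∧
    ∀ n : ℕ, IntegrableOn
      (fun x : ℝ => x ^ n * ((foxHposC7 m p l e η b a α g βw γ₀ x).re / K₇))
      (Set.Ioi 0) volume := by
  have h1 : (1 : ℝ) ∈ foxAbscissae m p l e η a α g := by
    refine ⟨fun j hj => by simpa using heη j hj, fun k hk => ?_⟩
    have := haα k hk
    linarith
  have hγ : γ₀ ∈ foxAbscissae m p l e η a α g := by
    refine ⟨fun j hj => ?_, fun k hk => ?_⟩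
    · have := hγ₀e j hj
      rw [div_lt_iff₀ (hη j hj)] at this
      linarith
    · have := hγ₀c k hk
      rw [div_lt_iff₀ (mul_pos (hα k hk) (hg k hk))] at this
      linarith
  have hV := verticalDecay_foxKernelC7 (e := e) (a := a) hm hη hb hα hg hβw
  have hK : 0 < K₇ := by
    rw [hK₇]
    refine mul_pos (mul_pos (Finset.prod_pos fun i hi => ?_) (Finset.prod_pos fun j hj => ?_))
      (Finset.prod_pos fun k hk => ?_)
    · have hi := Finset.mem_range.1 hi
      have h2 := heη i (by omega)
      have := hb i hi
      exact div_pos (Real.Gamma_pos_of_pos h2) (Real.Gamma_pos_of_pos (by linarith))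
    · exact Real.Gamma_pos_of_pos (heη j (Finset.mem_Ico.1 hj).2)
    · have hk := Finset.mem_range.1 hk
      have := mul_pos (hβw k hk).1 (haα k hk)
      have := (hβw k hk).2
      exact div_pos (Real.Gamma_pos_of_pos (haα k hk)) (Real.Gamma_pos_of_pos (by linarith))
  have hF1 : foxKernelC7 m p l e η b a α g βw 1 = K₇ := by
    rw [hK₇, foxKernelC7]
    simp only [Complex.ofReal_mul, Complex.ofReal_prod, Complex.ofReal_div, ← Complex.Gamma_ofReal]
    refine congrArg₂ _ (congrArg₂ _ (Finset.prod_congr rfl fun i _ => ?_)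
      (Finset.prod_congr rfl fun j _ => ?_)) (Finset.prod_congr rfl fun k _ => ?_)
    · simp
    · simp
    · congr 2 <;>
      · push_cast
        ring
  have hI : ∀ n : ℕ, IntegrableOn
      (fun x : ℝ => (x : ℂ) ^ n * foxHposC7 m p l e η b a α g βw γ₀ x) (Set.Ioi 0) :=
    hV.integrableOn_pow_mul hγ h1
  have hH : IntegrableOn (foxHposC7 m p l e η b a α g βw γ₀) (Set.Ioi 0) := by simpa using hI 0
  refine ⟨fun x _ => ?_, hH, ?_, fun n => ?_⟩
  · have hnn : 0 ≤ foxHposC7 m p l e η b a α g βw γ₀ x := by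
      have hS := ((posMult_foxKernelC7 hb hβw hγ).posSpectrum (hV.integrable_line hγ)).nonneg
        (Real.log x)
      have heq : foxHposC7 m p l e η b a α g βw γ₀ x =
          (1 / (2 * π) * Real.exp (-γ₀ * Real.log x) : ℝ) *
          ∫ t : ℝ, foxKernelC7 m p l e η b a α g βw ((γ₀ : ℂ) + (t : ℂ) * Complex.I) *
            Complex.exp (-(t * Real.log x * Complex.I)) := by
        rw [foxHposC7, Complex.ofReal_mul, mul_assoc,
          ← integral_const_mul (Real.exp (-γ₀ * Real.log x) : ℂ)]
        push_cast
        congr 2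
        funext t
        rw [mul_left_comm, ← Complex.exp_add]
        congr 2
        ring
      rw [heq]
      exact mul_nonneg (by exact_mod_cast (by positivity)) hS
    rw [Complex.nonneg_iff] at hnn
    exact ⟨hnn.2.symm, hnn.1⟩
  · rw [integral_div]
    have h2 := hV.integral_mellinBarnes hγ h1
    have h3 : ∫ x in Set.Ioi (0 : ℝ), (foxHposC7 m p l e η b a α g βw γ₀ x).re =
        (∫ x in Set.Ioi (0 : ℝ), foxHposC7 m p l e η b a α g βw γ₀ x).re :=
      Complex.reCLM.integral_comp_comm hH
    rw [h3]
    change (∫ x in Set.Ioi (0 : ℝ), mellinBarnes _ γ₀ x).re / K₇ = 1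
    rw [h2, hF1, Complex.ofReal_re, div_self hK.ne']
  · refine ((hI n).re.div_const K₇).congr (ae_of_all _ fun x => ?_)
    change ((x : ℂ) ^ n * foxHposC7 m p l e η b a α g βw γ₀ x).re / K₇ = _
    rw [← Complex.ofReal_pow, Complex.re_ofReal_mul, mul_div_assoc]
end

section
/- Let l ≥ 1, a_k ∈ ℝ, α_k > 0, γ_k > 0, β_k ∈ (0,1) with a_k + α_k > 0 for 1 ≤ k ≤ l, and suppose Σ_{k=1}^l α_kγ_k(1−β_k) < 1. Then the power series f(s) = (1/K₄) · Σ_{n=0}^∞ [Π_{k=1}^l Γ(a_k+α_k+α_kγ_k n) / Π_{k=1}^l Γ(1+β_k(a_k+α_k−1)+α_kβ_kγ_k n)] · (−s)^n/n!, with K₄ = Π_{k=1}^l [Γ(a_k+α_k)/Γ(1+β_k(a_k+α_k−1))], converges absolutely for every s ∈ ℂ, and its restriction to (0,∞) is completely monotone: f is infinitely differentiable on (0,∞) and (−1)^k f^{(k)}(s) ≥ 0 for every s > 0 and every integer k ≥ 0. -/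
open MeasureTheory Finset Filter Complex Real

open scoped Nat

/-- Coefficients whose exponential generating series converges absolutely everywhere. -/
def EntireCoeff (q : ℕ → ℝ) : Prop := ∀ r : ℝ, Summable fun n : ℕ => |q n| * |r| ^ n / (n ! : ℝ)

/-- The exponential generating series of `q`, evaluated at `-s`. -/
noncomputable def altExpGen (q : ℕ → ℝ) (s : ℝ) : ℝ := ∑' n : ℕ, q n * (-s) ^ n / (n ! : ℝ)

lemma norm_altExpGen_term (q : ℕ → ℝ) (s : ℝ) (n : ℕ) :
    ‖q n * (-s) ^ n / (n ! : ℝ)‖ = |q n| * |s| ^ n / (n ! : ℝ) := by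
  simp

lemma EntireCoeff.summable {q : ℕ → ℝ} (hq : EntireCoeff q) (s : ℝ) :
    Summable fun n : ℕ => q n * (-s) ^ n / (n ! : ℝ) :=
  Summable.of_norm (by simpa only [norm_altExpGen_term] using hq s)

lemma EntireCoeff.mono {q p : ℕ → ℝ} (hq : EntireCoeff q) (C : ℝ) (h : ∀ n, |p n| ≤ C * |q n|) :
    EntireCoeff p := by
  intro r
  refine Summable.of_nonneg_of_le (fun n => by positivity) (fun n => ?_) ((hq r).mul_left C)
  rw [← mul_div_assoc, ← mul_assoc]
  gcongr
  exact h n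

lemma EntireCoeff.one : EntireCoeff fun _ => 1 := by
  intro r
  simpa using Real.summable_pow_div_factorial |r|

lemma EntireCoeff.geom_mul {q : ℕ → ℝ} (hq : EntireCoeff q) (A ρ : ℝ) :
    EntireCoeff fun n => A * ρ ^ n * q n := by
  intro r
  refine ((hq (ρ * r)).mul_left |A|).congr fun n => ?_
  simp only [abs_mul, abs_pow]
  ring

lemma EntireCoeff.shift {q : ℕ → ℝ} (hq : EntireCoeff q) : EntireCoeff fun n => q (n + 1) := by
  intro r
  have h := (summable_nat_add_iff 1).2 (hq (2 * (|r| + 1)))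
  refine Summable.of_nonneg_of_le (fun n => by positivity) (fun n => ?_) h
  have h1 : (n : ℝ) + 1 ≤ 2 ^ (n + 1) := by
    have := (Nat.lt_two_pow_self (n := n + 1)).le
    exact_mod_cast this
  have h2 : |r| ^ n ≤ (|r| + 1) ^ (n + 1) :=
    (pow_le_pow_left₀ (abs_nonneg r) (by linarith) n).trans
      (pow_le_pow_right₀ (by linarith [abs_nonneg r]) (Nat.le_succ n))
  have hr : |2 * (|r| + 1)| = 2 * (|r| + 1) := abs_of_nonneg (by positivity)
  rw [hr, Nat.factorial_succ, div_le_div_iff₀ (by positivity) (by positivity), mul_pow]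
  push_cast
  calc |q (n + 1)| * |r| ^ n * (((n : ℝ) + 1) * n !)
      ≤ |q (n + 1)| * (|r| + 1) ^ (n + 1) * (2 ^ (n + 1) * n !) := by gcongr
    _ = _ := by ring

lemma hasDerivAt_altExpGen {q : ℕ → ℝ} (hq : EntireCoeff q) (s : ℝ) :
    HasDerivAt (altExpGen q) (-altExpGen (fun n => q (n + 1)) s) s := by
  set g' : ℕ → ℝ → ℝ := fun n y => q n * (n * (-y) ^ (n - 1) * (-1)) / (n ! : ℝ) with hg'
  have hsucc : ∀ n y, g' (n + 1) y = -(q (n + 1) * (-y) ^ n / (n ! : ℝ)) := by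
    intro n y
    simp only [hg', Nat.add_sub_cancel, Nat.factorial_succ]
    push_cast
    field_simp
  set u : ℕ → ℝ := fun n => |q n| * (n * (|s| + 1) ^ (n - 1)) / (n ! : ℝ) with hu
  have hsum : Summable u := by
    refine (summable_nat_add_iff 1).1 ((hq.shift (|s| + 1)).congr fun n => ?_)
    simp only [hu, Nat.add_sub_cancel, Nat.factorial_succ, abs_of_nonneg (by positivity : 0 ≤ |s| + 1)]
    push_cast
    field_simp
  have hs : s ∈ Metric.ball (0 : ℝ) (|s| + 1) := by simp
  have key : HasDerivAt (altExpGen q) (∑' n, g' n s) s := by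
    refine hasDerivAt_tsum_of_isPreconnected hsum Metric.isOpen_ball
      (convex_ball (0 : ℝ) (|s| + 1)).isPreconnected (fun n y _ => ?_) (fun n y hy => ?_) hs
      (hq.summable s) hs
    · exact ((((hasDerivAt_id y).neg.pow n)).const_mul (q n)).div_const _
    · simp only [Metric.mem_ball, dist_zero_right, Real.norm_eq_abs] at hy
      simp only [hg', hu, norm_div, norm_mul, norm_pow, norm_neg, Real.norm_eq_abs, Nat.abs_cast,
        abs_one, mul_one]
      gcongr
  have hg : Summable fun n => g' n s := by
    refine (summable_nat_add_iff 1).1 ((hq.shift.summable s).neg.congr fun n => ?_)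
    simp [hsucc]
  convert key using 1
  rw [hg.tsum_eq_zero_add]
  simp only [hsucc, tsum_neg]
  simp [hg', altExpGen]

lemma EntireCoeff.shift_add {q : ℕ → ℝ} (hq : EntireCoeff q) (k : ℕ) :
    EntireCoeff fun n => q (n + k) := by
  induction k with
  | zero => exact hq
  | succ k ih => simpa only [add_right_comm, add_assoc] using ih.shift

lemma iteratedDeriv_altExpGen {q : ℕ → ℝ} (hq : EntireCoeff q) (k : ℕ) :
    iteratedDeriv k (altExpGen q) = fun s => (-1) ^ k * altExpGen (fun n => q (n + k)) s := by
  induction k with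
  | zero => ext s; simp
  | succ k ih =>
    ext s
    rw [iteratedDeriv_succ, ih, ((hasDerivAt_altExpGen (hq.shift_add k) s).const_mul _).deriv]
    simp only [add_right_comm, add_assoc]
    ring_nf

lemma contDiff_altExpGen {q : ℕ → ℝ} (hq : EntireCoeff q) :
    ContDiff ℝ (⊤ : ℕ∞) (altExpGen q) := by
  refine contDiff_of_differentiable_iteratedDeriv fun m _ s => ?_
  rw [iteratedDeriv_altExpGen hq m]
  exact ((hasDerivAt_altExpGen (hq.shift_add m) s).const_mul _).differentiableAt

/-- Coefficients of an entire function of `-s` that is nonnegative for `s ≥ 0`. -/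
structure NonnegGen (q : ℕ → ℝ) : Prop where
  entire : EntireCoeff q
  nonneg : ∀ s, 0 ≤ s → 0 ≤ altExpGen q s

lemma NonnegGen.one : NonnegGen fun _ => 1 := by
  refine ⟨EntireCoeff.one, fun s _ => ?_⟩
  have : altExpGen (fun _ => 1) s = Real.exp (-s) := by
    rw [Real.exp_eq_exp_ℝ, NormedSpace.exp_eq_tsum_div]
    simp [altExpGen]
  rw [this]
  positivity

lemma NonnegGen.geom_mul {q : ℕ → ℝ} (hq : NonnegGen q) {A ρ : ℝ} (hA : 0 ≤ A) (hρ : 0 ≤ ρ) :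
    NonnegGen fun n => A * ρ ^ n * q n := by
  refine ⟨hq.entire.geom_mul A ρ, fun s hs => ?_⟩
  have : altExpGen (fun n => A * ρ ^ n * q n) s = A * altExpGen q (ρ * s) := by
    simp only [altExpGen, ← tsum_mul_left]
    congr 1 with n
    rw [← mul_neg, mul_pow]
    ring
  rw [this]
  exact mul_nonneg hA (hq.nonneg _ (by positivity))

lemma NonnegGen.add {q p : ℕ → ℝ} (hq : NonnegGen q) (hp : NonnegGen p) :
    NonnegGen fun n => q n + p n := by
  constructor
  · intro r
    refine Summable.of_nonneg_of_le (fun n => by positivity) (fun n => ?_)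
      ((hq.entire r).add (hp.entire r))
    rw [← add_div, ← add_mul]
    gcongr
    exact abs_add_le _ _
  · intro s hs
    have : altExpGen (fun n => q n + p n) s = altExpGen q s + altExpGen p s := by
      simp only [altExpGen]
      rw [← (hq.entire.summable s).tsum_add (hp.entire.summable s)]
      congr 1 with n
      ring
    rw [this]
    exact add_nonneg (hq.nonneg s hs) (hp.nonneg s hs)

lemma NonnegGen.div_linear {q : ℕ → ℝ} (hq : NonnegGen q) {e d : ℝ} (he : -1 < e) (hd : 0 ≤ d) :
    NonnegGen fun n => q n / (1 + (e + d * n)) := by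
  have hpos : ∀ n : ℕ, 0 < 1 + (e + d * n) := fun n => by
    have : 0 ≤ d * n := by positivity
    linarith
  have hent : EntireCoeff fun n => q n / (1 + (e + d * n)) := by
    refine hq.entire.mono (1 + e)⁻¹ fun n => ?_
    rw [abs_div, abs_of_pos (hpos n), div_eq_inv_mul]
    have : 0 ≤ d * n := by positivity
    gcongr
    · linarith
    · linarith
  refine ⟨hent, fun s hs => ?_⟩
  have hint : ∀ n : ℕ, ∫ u in Set.Ioc (0 : ℝ) 1, u ^ (e + d * n) = 1 / (1 + (e + d * n)) := by
    intro n
    have h1 := hpos n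
    rw [← intervalIntegral.integral_of_le zero_le_one, integral_rpow (Or.inl (by linarith)),
      Real.zero_rpow (by linarith), Real.one_rpow, sub_zero, add_comm]
  have hintble : ∀ n : ℕ, Integrable (fun u : ℝ => u ^ (e + d * n))
      (volume.restrict (Set.Ioc (0 : ℝ) 1)) := fun n =>
    (intervalIntegrable_iff_integrableOn_Ioc_of_le zero_le_one).1
      (intervalIntegral.intervalIntegrable_rpow' (by linarith [hpos n]))
  set F : ℕ → ℝ → ℝ := fun n u => q n * (-s) ^ n / (n ! : ℝ) * u ^ (e + d * n) with hF
  have hnorm : ∀ n : ℕ, ∫ u in Set.Ioc (0 : ℝ) 1, ‖F n u‖ =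
      |q n / (1 + (e + d * n))| * |s| ^ n / (n ! : ℝ) := by
    intro n
    have : ∀ u ∈ Set.Ioc (0 : ℝ) 1, ‖F n u‖ = |q n| * |s| ^ n / (n ! : ℝ) * u ^ (e + d * n) := by
      intro u hu
      rw [hF, norm_mul, norm_altExpGen_term, Real.norm_of_nonneg (Real.rpow_nonneg hu.1.le _)]
    rw [setIntegral_congr_fun measurableSet_Ioc this, integral_const_mul, hint, abs_div,
      abs_of_pos (hpos n)]
    ring
  have key := hasSum_integral_of_summable_integral_norm (F := F)
    (μ := volume.restrict (Set.Ioc (0 : ℝ) 1)) (fun n => (hintble n).const_mul _)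
    (by simpa only [hnorm] using hent s)
  have heq : altExpGen (fun n => q n / (1 + (e + d * n))) s =
      ∫ u in Set.Ioc (0 : ℝ) 1, ∑' n, F n u := by
    rw [← key.tsum_eq]
    simp only [altExpGen, hF, integral_const_mul, hint]
    congr 1 with n
    ring
  rw [heq]
  refine setIntegral_nonneg measurableSet_Ioc fun u hu => ?_
  have : ∑' n, F n u = u ^ e * altExpGen q (u ^ d * s) := by
    simp only [altExpGen, hF, ← tsum_mul_left]
    congr 1 with n
    rw [Real.rpow_add hu.1, Real.rpow_mul hu.1.le, Real.rpow_natCast, ← mul_neg, mul_pow]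
    ring
  rw [this]
  exact mul_nonneg (Real.rpow_nonneg hu.1.le _)
    (hq.nonneg _ (mul_nonneg (Real.rpow_nonneg hu.1.le _) hs))

lemma NonnegGen.of_tendsto {Q : ℕ → ℕ → ℝ} {q : ℕ → ℝ} (hQ : ∀ N, NonnegGen (Q N))
    (hq : EntireCoeff q) (hlim : ∀ n, Tendsto (fun N => Q N n) atTop (nhds (q n)))
    (M : ℕ) (hM : ∀ n, M ≤ n → ∀ N, |Q N n| ≤ q n) : NonnegGen q := by
  refine ⟨hq, fun s hs => ?_⟩
  have hsum : Summable fun n : ℕ => (|q n| + 1) * |s| ^ n / (n ! : ℝ) := by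
    refine ((hq s).add (EntireCoeff.one s)).congr fun n => ?_
    simp only [abs_one]
    ring
  have hev : ∀ᶠ N in atTop, ∀ n, |Q N n| ≤ |q n| + 1 := by
    have h1 : ∀ᶠ N in atTop, ∀ n ∈ Finset.range M, |Q N n| < |q n| + 1 :=
      (Filter.eventually_all_finset _).2 fun n _ =>
        (hlim n).abs.eventually_lt_const (by linarith)
    filter_upwards [h1] with N hN n
    rcases lt_or_ge n M with h | h
    · exact (hN n (Finset.mem_range.2 h)).le
    · linarith [hM n h N, le_abs_self (q n)]
  have hT : Tendsto (fun N => altExpGen (Q N) s) atTop (nhds (altExpGen q s)) := by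
    refine tendsto_tsum_of_dominated_convergence hsum
      (fun n => ((hlim n).mul_const _).div_const _) ?_
    filter_upwards [hev] with N hN n
    rw [norm_altExpGen_term]
    gcongr
    exact hN n
  exact ge_of_tendsto' hT fun N => (hQ N).nonneg s hs

/-- The `j`-th factor of the Euler product of `Γ(1 + t) / Γ(1 + β t)`. -/
noncomputable def eulerFactor (β t : ℝ) (j : ℕ) : ℝ :=
  (1 + 1 / ((j : ℝ) + 1)) ^ ((1 - β) * t) * ((1 + β * t / (j + 1)) / (1 + t / (j + 1)))

lemma one_add_div_pos {t : ℝ} (ht : -1 < t) (j : ℕ) : 0 < 1 + t / ((j : ℝ) + 1) := by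
  have hj : (0 : ℝ) < j + 1 := by positivity
  have : 1 + t / ((j : ℝ) + 1) = (j + 1 + t) / (j + 1) := by field_simp
  rw [this]
  have : (0 : ℝ) ≤ j := by positivity
  exact div_pos (by linarith) hj

lemma neg_one_lt_mul {β t : ℝ} (hβ : β ∈ Set.Ioo (0 : ℝ) 1) (ht : -1 < t) : -1 < β * t := by
  nlinarith [hβ.1, hβ.2]

lemma eulerFactor_pos {β t : ℝ} (hβ : β ∈ Set.Ioo (0 : ℝ) 1) (ht : -1 < t) (j : ℕ) :
    0 < eulerFactor β t j := by
  have h1 := one_add_div_pos ht j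
  have h2 := one_add_div_pos (neg_one_lt_mul hβ ht) j
  unfold eulerFactor
  positivity

lemma one_le_eulerFactor {β t : ℝ} (hβ : β ∈ Set.Ioo (0 : ℝ) 1) (ht : 1 ≤ t) (j : ℕ) :
    1 ≤ eulerFactor β t j := by
  have hx : 0 < 1 + t / ((j : ℝ) + 1) := one_add_div_pos (by linarith) j
  have hβ0 := hβ.1.le
  have hβ1 : 0 ≤ 1 - β := by linarith [hβ.2]
  have h1 : (1 + t / ((j : ℝ) + 1)) ^ β ≤ 1 + β * t / (j + 1) := by
    have := Real.geom_mean_le_arith_mean2_weighted hβ0 hβ1 hx.le zero_le_one (by ring)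
    rw [Real.one_rpow] at this
    calc _ ≤ _ := by simpa using this
      _ = _ := by ring
  have h2 : (1 + t / ((j : ℝ) + 1)) ^ (1 - β) ≤ (1 + 1 / ((j : ℝ) + 1)) ^ ((1 - β) * t) := by
    rw [mul_comm (1 - β) t, Real.rpow_mul (by positivity)]
    refine Real.rpow_le_rpow hx.le ?_ hβ1
    have hs : (-1 : ℝ) ≤ 1 / ((j : ℝ) + 1) := by
      have : (0 : ℝ) ≤ 1 / ((j : ℝ) + 1) := by positivity
      linarith
    simpa [div_eq_mul_inv] using one_add_mul_self_le_rpow_one_add hs ht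
  unfold eulerFactor
  rw [← mul_div_assoc, le_div_iff₀ hx, one_mul]
  calc 1 + t / ((j : ℝ) + 1)
      = (1 + t / ((j : ℝ) + 1)) ^ (1 - β) * (1 + t / ((j : ℝ) + 1)) ^ β := by
        rw [← Real.rpow_add hx, sub_add_cancel, Real.rpow_one]
    _ ≤ _ := mul_le_mul h2 h1 (by positivity) (by positivity)

lemma prod_one_add_inv (N : ℕ) : ∏ j ∈ Finset.range N, (1 + 1 / ((j : ℝ) + 1)) = N + 1 := by
  induction N with
  | zero => simp
  | succ N ih => rw [Finset.prod_range_succ, ih]; push_cast; field_simp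

lemma gammaSeq_one_add {t : ℝ} (ht : -1 < t) {n : ℕ} (hn : n ≠ 0) :
    Real.GammaSeq (1 + t) n * ∏ j ∈ Finset.range (n + 1), (1 + t / ((j : ℝ) + 1)) =
      (n : ℝ) ^ t * (n / (n + 1)) := by
  have h : ∏ j ∈ Finset.range (n + 1), (1 + t / ((j : ℝ) + 1)) =
      (∏ j ∈ Finset.range (n + 1), (1 + t + (j : ℝ))) / ((n + 1)! : ℝ) := by
    rw [← Finset.prod_range_add_one_eq_factorial]
    push_cast
    rw [← Finset.prod_div_distrib]
    refine Finset.prod_congr rfl fun j _ => ?_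
    have : (j : ℝ) + 1 ≠ 0 := by positivity
    field_simp
    ring
  have hP : ∏ j ∈ Finset.range (n + 1), (1 + t + (j : ℝ)) ≠ 0 :=
    Finset.prod_ne_zero_iff.2 fun j _ => by
      have : (0 : ℝ) ≤ j := by positivity
      linarith
  have hn' : (0 : ℝ) < n := by positivity
  rw [h, Real.GammaSeq, Nat.factorial_succ, Real.rpow_add hn', Real.rpow_one]
  push_cast
  field_simp

lemma tendsto_prod_eulerFactor {β t : ℝ} (hβ : β ∈ Set.Ioo (0 : ℝ) 1) (ht : -1 < t) :
    Tendsto (fun N => ∏ j ∈ Finset.range N, eulerFactor β t j) atTop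
      (nhds (Real.Gamma (1 + t) / Real.Gamma (1 + β * t))) := by
  have hβt := neg_one_lt_mul hβ ht
  rw [← tendsto_add_atTop_iff_nat 1]
  have h1 := (Real.GammaSeq_tendsto_Gamma (1 + t)).div (Real.GammaSeq_tendsto_Gamma (1 + β * t))
    (Real.Gamma_pos_of_pos (by linarith)).ne'
  have h2 : Tendsto (fun n : ℕ => (1 + 2 / (n : ℝ)) ^ ((1 - β) * t)) atTop (nhds 1) := by
    have : Tendsto (fun n : ℕ => 1 + 2 / (n : ℝ)) atTop (nhds 1) := by
      simpa using (tendsto_const_div_atTop_nhds_zero_nat (2 : ℝ)).const_add 1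
    simpa using this.rpow_const (p := (1 - β) * t) (Or.inl one_ne_zero)
  have h3 := h2.mul h1
  rw [one_mul] at h3
  refine h3.congr' ?_
  filter_upwards [eventually_ne_atTop 0] with n hn
  have hn' : (0 : ℝ) < n := by positivity
  have e1 := gammaSeq_one_add ht hn
  have e2 := gammaSeq_one_add hβt hn
  have p1 : 0 < ∏ j ∈ Finset.range (n + 1), (1 + t / ((j : ℝ) + 1)) :=
    Finset.prod_pos fun j _ => one_add_div_pos ht j
  have p2 : 0 < ∏ j ∈ Finset.range (n + 1), (1 + β * t / ((j : ℝ) + 1)) :=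
    Finset.prod_pos fun j _ => one_add_div_pos hβt j
  simp only [eulerFactor, Finset.prod_mul_distrib, Finset.prod_div_distrib, Pi.div_apply]
  rw [Real.finsetProd_rpow _ _ (fun j _ => by positivity), prod_one_add_inv,
    eq_div_of_mul_eq p1.ne' e1, eq_div_of_mul_eq p2.ne' e2]
  have e3 : ((n + 1 : ℕ) : ℝ) + 1 = (1 + 2 / (n : ℝ)) * n := by
    push_cast; field_simp; ring
  have e4 : (n : ℝ) ^ t = n ^ ((1 - β) * t) * n ^ (β * t) := by
    rw [← Real.rpow_add hn']; ring_nf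
  rw [e3, Real.mul_rpow (by positivity) hn'.le, e4]
  have : 0 < (n : ℝ) ^ (β * t) := by positivity
  field_simp

lemma NonnegGen.eulerFactor_mul {q : ℕ → ℝ} (hq : NonnegGen q) {β p c : ℝ}
    (hβ : β ∈ Set.Ioo (0 : ℝ) 1) (hp : -1 < p) (hc : 0 ≤ c) (j : ℕ) :
    NonnegGen fun n => eulerFactor β (p + c * n) j * q n := by
  have hj : (0 : ℝ) < j + 1 := by positivity
  have he : -1 < p / ((j : ℝ) + 1) := by linarith [one_add_div_pos hp j]
  have hd : 0 ≤ c / ((j : ℝ) + 1) := by positivity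
  have hβ1 : 0 ≤ 1 - β := by linarith [hβ.2]
  have h1 := (hq.geom_mul hβ.1.le zero_le_one).add
    ((hq.div_linear he hd).geom_mul hβ1 zero_le_one)
  set B : ℝ := 1 + 1 / ((j : ℝ) + 1) with hB
  have hB0 : 0 < B := by positivity
  have h2 := h1.geom_mul (A := B ^ ((1 - β) * p)) (ρ := B ^ ((1 - β) * c))
    (by positivity) (by positivity)
  convert h2 using 2 with n
  have hx : 0 < 1 + (p / ((j : ℝ) + 1) + c / (j + 1) * n) := by
    have : 0 ≤ c / ((j : ℝ) + 1) * n := by positivity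
    linarith
  have hB' : B ^ ((1 - β) * (p + c * n)) = B ^ ((1 - β) * p) * (B ^ ((1 - β) * c)) ^ n := by
    rw [← Real.rpow_natCast, ← Real.rpow_mul hB0.le, ← Real.rpow_add hB0]
    ring_nf
  have e1 : 1 + (p + c * n) / ((j : ℝ) + 1) = 1 + (p / ((j : ℝ) + 1) + c / (j + 1) * n) := by ring
  have e2 : 1 + β * (p + c * n) / ((j : ℝ) + 1) =
      β * (1 + (p / ((j : ℝ) + 1) + c / (j + 1) * n)) + (1 - β) := by ring
  rw [eulerFactor, ← hB, hB', e1, e2, add_div, mul_div_cancel_right₀ _ hx.ne']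
  ring

lemma NonnegGen.prod_eulerFactor_mul {q : ℕ → ℝ} (hq : NonnegGen q) {β p c : ℝ}
    (hβ : β ∈ Set.Ioo (0 : ℝ) 1) (hp : -1 < p) (hc : 0 ≤ c) (N : ℕ) :
    NonnegGen fun n => (∏ j ∈ Finset.range N, eulerFactor β (p + c * n) j) * q n := by
  induction N with
  | zero => simpa using hq
  | succ N ih =>
    convert ih.eulerFactor_mul hβ hp hc N using 2 with n
    rw [Finset.prod_range_succ]
    ring

lemma NonnegGen.prod_eulerFactor (l N : ℕ) {β b c : ℕ → ℝ}
    (hβ : ∀ k < l, β k ∈ Set.Ioo (0 : ℝ) 1) (hb : ∀ k < l, 0 < b k) (hc : ∀ k < l, 0 < c k) :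
    NonnegGen fun n => ∏ k ∈ Finset.range l, ∏ j ∈ Finset.range N,
      eulerFactor (β k) (b k - 1 + c k * n) j := by
  induction l with
  | zero => simpa using NonnegGen.one
  | succ l ih =>
    have h0 := ih (fun k hk => hβ k (by lia)) (fun k hk => hb k (by lia))
      (fun k hk => hc k (by lia))
    convert h0.prod_eulerFactor_mul (hβ l (by lia))
      (show -1 < b l - 1 by linarith [hb l (by lia)]) (hc l (by lia)).le N using 2 with n
    rw [Finset.prod_range_succ, mul_comm]

/-- The moment-type ratio appearing in each factor of the Wright coefficients. -/
noncomputable def gammaRatio (β b c : ℝ) (n : ℕ) : ℝ :=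
  Real.Gamma (b + c * n) / Real.Gamma (1 + β * (b - 1) + c * β * n)

lemma gammaRatio_den_pos {β b c : ℝ} (hβ : β ∈ Set.Ioo (0 : ℝ) 1) (hb : 0 < b) (hc : 0 < c)
    (n : ℕ) : 0 < 1 + β * (b - 1) + c * β * n := by
  have h1 := neg_one_lt_mul hβ (show -1 < b - 1 by linarith)
  have h2 : 0 ≤ c * β * n := mul_nonneg (mul_nonneg hc.le hβ.1.le) n.cast_nonneg
  linarith

lemma gammaRatio_pos {β b c : ℝ} (hβ : β ∈ Set.Ioo (0 : ℝ) 1) (hb : 0 < b) (hc : 0 < c)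
    (n : ℕ) : 0 < gammaRatio β b c n :=
  div_pos (Real.Gamma_pos_of_pos (by positivity))
    (Real.Gamma_pos_of_pos (gammaRatio_den_pos hβ hb hc n))

lemma gammaRatio_add (β b c : ℝ) (n m : ℕ) :
    gammaRatio β b c (n + m) = gammaRatio β (b + c * m) c n := by
  unfold gammaRatio
  push_cast
  congr 2 <;> ring

lemma Real.Gamma_add_le_rpow_mul {x c : ℝ} (hx : 0 < x) (hc : 0 < c) :
    Real.Gamma (x + c) ≤ (x + c) ^ c * Real.Gamma x := by
  have hxc : 0 < x + c := by positivity
  have h := Real.convexOn_log_Gamma.slope_mono_adjacent (x := x) (y := x + c) (z := x + c + 1)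
    hx (by simp only [Set.mem_Ioi]; positivity) (by linarith) (by linarith)
  have g1 := Real.Gamma_pos_of_pos hx
  have g2 := Real.Gamma_pos_of_pos hxc
  simp only [Function.comp_apply, Real.Gamma_add_one hxc.ne',
    Real.log_mul hxc.ne' g2.ne', add_sub_cancel_left, add_sub_cancel_right, div_one] at h
  rw [div_le_iff₀ hc] at h
  rw [← Real.log_le_log_iff g2 (by positivity), Real.log_mul (by positivity) g1.ne',
    Real.log_rpow hxc]
  linarith

lemma Real.rpow_mul_Gamma_le {x c : ℝ} (hx : 1 < x) (hc : 0 < c) :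
    (x - 1) ^ c * Real.Gamma x ≤ Real.Gamma (x + c) := by
  have hx1 : 0 < x - 1 := by linarith
  have hxc : 0 < x + c := by linarith
  have h := Real.convexOn_log_Gamma.slope_mono_adjacent (x := x - 1) (y := x) (z := x + c)
    hx1 hxc (by linarith) (by linarith)
  have g0 := Real.Gamma_pos_of_pos hx1
  have g1 := Real.Gamma_pos_of_pos (show 0 < x by linarith)
  have g2 := Real.Gamma_pos_of_pos hxc
  have e : Real.Gamma x = (x - 1) * Real.Gamma (x - 1) := by
    rw [← Real.Gamma_add_one hx1.ne', sub_add_cancel]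
  have e' : Real.log (Real.Gamma x) = Real.log (x - 1) + Real.log (Real.Gamma (x - 1)) := by
    rw [e, Real.log_mul hx1.ne' g0.ne']
  simp only [Function.comp_apply, sub_sub_cancel, div_one, add_sub_cancel_left] at h
  rw [le_div_iff₀ hc] at h
  rw [← Real.log_le_log_iff (by positivity) g2, Real.log_mul (by positivity) g1.ne',
    Real.log_rpow hx1]
  rw [show Real.log (x - 1) = Real.log (Real.Gamma x) - Real.log (Real.Gamma (x - 1)) by linarith]
  linarith

lemma gammaRatio_succ_le {β b c : ℝ} (hβ : β ∈ Set.Ioo (0 : ℝ) 1) (hb : 0 < b) (hc : 0 < c) :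
    ∃ K, ∀ᶠ n : ℕ in atTop,
      gammaRatio β b c (n + 1) ≤ K * ((n : ℝ) + 1) ^ (c * (1 - β)) * gammaRatio β b c n := by
  have hβ0 := hβ.1
  have hcβ : 0 < c * β := by positivity
  refine ⟨(b + c) ^ c / (c * β / 2) ^ (c * β), ?_⟩
  have hlarge : ∀ᶠ n : ℕ in atTop, (c * β / 2 - β * (b - 1)) / (c * β / 2) < (n : ℝ) :=
    tendsto_natCast_atTop_atTop.eventually_gt_atTop _
  filter_upwards [hlarge] with n hn
  rw [div_lt_iff₀ (by positivity)] at hn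
  have hn1 : (0 : ℝ) < n + 1 := by positivity
  set x : ℝ := b + c * n with hx
  set y : ℝ := 1 + β * (b - 1) + c * β * n with hy
  have hx0 : 0 < x := by positivity
  have hy1 : (c * β / 2) * (n + 1) ≤ y - 1 := by rw [hy]; linarith
  have hy1' : 0 < y - 1 := lt_of_lt_of_le (by positivity) hy1
  have gx := Real.Gamma_pos_of_pos hx0
  have gy := Real.Gamma_pos_of_pos (show 0 < y by linarith)
  have U : Real.Gamma (x + c) ≤ ((b + c) * (n + 1)) ^ c * Real.Gamma x := by
    refine (Real.Gamma_add_le_rpow_mul hx0 hc).trans ?_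
    gcongr
    have : 0 ≤ b * n := by positivity
    rw [hx]; linarith
  have L : ((c * β / 2) * (n + 1)) ^ (c * β) * Real.Gamma y ≤ Real.Gamma (y + c * β) := by
    refine le_trans ?_ (Real.rpow_mul_Gamma_le (by linarith) hcβ)
    gcongr
  have ex : b + c * ((n + 1 : ℕ) : ℝ) = x + c := by rw [hx]; push_cast; ring
  have ey : 1 + β * (b - 1) + c * β * ((n + 1 : ℕ) : ℝ) = y + c * β := by rw [hy]; push_cast; ring
  have en : ((n : ℝ) + 1) ^ (c * (1 - β)) = ((n : ℝ) + 1) ^ c / ((n : ℝ) + 1) ^ (c * β) := by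
    rw [← Real.rpow_sub hn1]; ring_nf
  unfold gammaRatio
  rw [ex, ey, ← hx, ← hy]
  calc Real.Gamma (x + c) / Real.Gamma (y + c * β)
      ≤ (((b + c) * (n + 1)) ^ c * Real.Gamma x) /
          (((c * β / 2) * (n + 1)) ^ (c * β) * Real.Gamma y) := by gcongr
    _ = _ := by
      rw [en, Real.mul_rpow (by positivity) hn1.le, Real.mul_rpow (by positivity) hn1.le]
      field_simp

lemma prod_gammaRatio_succ_le (l : ℕ) {β b c : ℕ → ℝ}
    (hβ : ∀ k < l, β k ∈ Set.Ioo (0 : ℝ) 1) (hb : ∀ k < l, 0 < b k) (hc : ∀ k < l, 0 < c k) :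
    ∃ K, ∀ᶠ n : ℕ in atTop, ∏ k ∈ Finset.range l, gammaRatio (β k) (b k) (c k) (n + 1) ≤
      K * ((n : ℝ) + 1) ^ (∑ k ∈ Finset.range l, c k * (1 - β k)) *
        ∏ k ∈ Finset.range l, gammaRatio (β k) (b k) (c k) n := by
  induction l with
  | zero => exact ⟨1, by simp⟩
  | succ l ih =>
    obtain ⟨K, hK⟩ := ih (fun k hk => hβ k (by lia)) (fun k hk => hb k (by lia))
      (fun k hk => hc k (by lia))
    obtain ⟨K', hK'⟩ := gammaRatio_succ_le (hβ l (by lia)) (hb l (by lia)) (hc l (by lia))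
    refine ⟨K * K', ?_⟩
    filter_upwards [hK, hK'] with n h h'
    have hpos : ∀ m, 0 ≤ ∏ k ∈ Finset.range l, gammaRatio (β k) (b k) (c k) m := fun m =>
      Finset.prod_nonneg fun k hk => by
        have := Finset.mem_range.1 hk
        exact (gammaRatio_pos (hβ k (by lia)) (hb k (by lia)) (hc k (by lia)) m).le
    rw [Finset.prod_range_succ, Finset.prod_range_succ, Finset.sum_range_succ,
      Real.rpow_add (by positivity)]
    refine (mul_le_mul h h' (gammaRatio_pos (hβ l (by lia)) (hb l (by lia))
      (hc l (by lia)) _).le ((hpos _).trans h)).trans_eq ?_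
    ring

lemma entireCoeff_prod_gammaRatio (l : ℕ) {β b c : ℕ → ℝ}
    (hβ : ∀ k < l, β k ∈ Set.Ioo (0 : ℝ) 1) (hb : ∀ k < l, 0 < b k) (hc : ∀ k < l, 0 < c k)
    (hsum : ∑ k ∈ Finset.range l, c k * (1 - β k) < 1) :
    EntireCoeff fun n => ∏ k ∈ Finset.range l, gammaRatio (β k) (b k) (c k) n := by
  intro r
  obtain ⟨K, hK⟩ := prod_gammaRatio_succ_le l hβ hb hc
  set σ := ∑ k ∈ Finset.range l, c k * (1 - β k) with hσ
  have hpos : ∀ m, 0 < ∏ k ∈ Finset.range l, gammaRatio (β k) (b k) (c k) m := fun m =>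
    Finset.prod_pos fun k hk => by
      have := Finset.mem_range.1 hk
      exact gammaRatio_pos (hβ k this) (hb k this) (hc k this) m
  have hlim : Tendsto (fun n : ℕ => K * |r| * ((n : ℝ) + 1) ^ (-(1 - σ))) atTop (nhds 0) := by
    have h1 : Tendsto (fun n : ℕ => (n : ℝ) + 1) atTop atTop :=
      tendsto_atTop_add_const_right _ _ tendsto_natCast_atTop_atTop
    simpa using ((tendsto_rpow_neg_atTop (by linarith : 0 < 1 - σ)).comp h1).const_mul (K * |r|)
  refine summable_of_ratio_norm_eventually_le (r := 1 / 2) (by norm_num) ?_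
  filter_upwards [hK, hlim.eventually_le_const (by norm_num : (0 : ℝ) < 1 / 2)] with n h1 h2
  have hn1 : (0 : ℝ) < n + 1 := by positivity
  rw [Real.norm_of_nonneg (by positivity), Real.norm_of_nonneg (by positivity),
    abs_of_pos (hpos _), abs_of_pos (hpos _), Nat.factorial_succ]
  push_cast
  have e : ((n : ℝ) + 1) ^ (-(1 - σ)) = ((n : ℝ) + 1) ^ σ / (n + 1) := by
    rw [neg_sub, Real.rpow_sub hn1, Real.rpow_one]
  rw [e] at h2
  have hP := hpos n
  calc _ ≤ (K * ((n : ℝ) + 1) ^ σ * ∏ k ∈ Finset.range l, gammaRatio (β k) (b k) (c k) n) *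
        |r| ^ (n + 1) / ((n + 1) * n !) := by gcongr
    _ = (K * |r| * (((n : ℝ) + 1) ^ σ / (n + 1))) *
        ((∏ k ∈ Finset.range l, gammaRatio (β k) (b k) (c k) n) * |r| ^ n / n !) := by
      field_simp
      ring
    _ ≤ _ := by gcongr

lemma nonnegGen_prod_gammaRatio (l : ℕ) {β b c : ℕ → ℝ}
    (hβ : ∀ k < l, β k ∈ Set.Ioo (0 : ℝ) 1) (hb : ∀ k < l, 0 < b k) (hc : ∀ k < l, 0 < c k)
    (hsum : ∑ k ∈ Finset.range l, c k * (1 - β k) < 1) :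
    NonnegGen fun n => ∏ k ∈ Finset.range l, gammaRatio (β k) (b k) (c k) n := by
  have ht : ∀ k < l, ∀ n : ℕ, -1 < b k - 1 + c k * n := fun k hk n => by
    have := mul_nonneg (hc k hk).le n.cast_nonneg
    linarith [hb k hk]
  have hlim : ∀ k < l, ∀ n : ℕ, Tendsto
      (fun N => ∏ j ∈ Finset.range N, eulerFactor (β k) (b k - 1 + c k * n) j) atTop
      (nhds (gammaRatio (β k) (b k) (c k) n)) := fun k hk n => by
    have h := tendsto_prod_eulerFactor (hβ k hk) (ht k hk n)
    convert h using 2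
    unfold gammaRatio
    congr 2 <;> ring
  have hev : ∀ᶠ n : ℕ in atTop, ∀ k ∈ Finset.range l, 1 ≤ b k - 1 + c k * n :=
    (Filter.eventually_all_finset _).2 fun k hk =>
      (tendsto_atTop_add_const_left _ _ (tendsto_natCast_atTop_atTop.const_mul_atTop
        (hc k (Finset.mem_range.1 hk)))).eventually_ge_atTop 1
  obtain ⟨M, hM⟩ := eventually_atTop.1 hev
  refine NonnegGen.of_tendsto (fun N => NonnegGen.prod_eulerFactor l N hβ hb hc)
    (entireCoeff_prod_gammaRatio l hβ hb hc hsum)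
    (fun n => tendsto_finsetProd _ fun k hk => hlim k (Finset.mem_range.1 hk) n) M
    fun n hn N => ?_
  have hpos : ∀ k ∈ Finset.range l, ∀ N,
      0 < ∏ j ∈ Finset.range N, eulerFactor (β k) (b k - 1 + c k * n) j := fun k hk N =>
    have hk := Finset.mem_range.1 hk
    Finset.prod_pos fun j _ => eulerFactor_pos (hβ k hk) (ht k hk n) j
  rw [abs_of_pos (Finset.prod_pos fun k hk => hpos k hk N)]
  refine Finset.prod_le_prod (fun k hk => (hpos k hk N).le) fun k hk => ?_
  have hk' := Finset.mem_range.1 hk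
  refine Monotone.ge_of_tendsto (monotone_nat_of_le_succ fun m => ?_) (hlim k hk' n) N
  rw [Finset.prod_range_succ]
  exact le_mul_of_one_le_right (hpos k hk m).le (one_le_eulerFactor (hβ k hk') (hM n hn k hk) m)

/-- the generalized Wright function
`(1/K₄)·_lΨ_l[(a_k+α_k,α_kγ_k);(1+β_k(a_k+α_k−1),α_kβ_kγ_k)|−s]` (Laplace transform of
the class (C4) Fox-H density) is entire and completely monotone on `(0,∞)`. -/
theorem wright_C4_completely_monotone
    (l : ℕ) (hl : 1 ≤ l)
    (a α g βw : ℕ → ℝ)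
    (hα : ∀ k < l, 0 < α k) (hg : ∀ k < l, 0 < g k)
    (hβw : ∀ k < l, βw k ∈ Set.Ioo (0 : ℝ) 1) (haα : ∀ k < l, 0 < a k + α k)
    (hsum : ∑ k ∈ Finset.range l, α k * g k * (1 - βw k) < 1)
    (K₄ : ℝ)
    (hK₄ : K₄ = ∏ k ∈ Finset.range l,
      (Real.Gamma (a k + α k) / Real.Gamma (1 + βw k * (a k + α k - 1))))
    (f : ℝ → ℝ)
    (hf : ∀ s : ℝ, f s = (1 / K₄) *
      ∑' n : ℕ, ((∏ k ∈ Finset.range l, Real.Gamma (a k + α k + α k * g k * n)) /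
        (∏ k ∈ Finset.range l, Real.Gamma (1 + βw k * (a k + α k - 1) + α k * βw k * g k * n))) *
        (-s) ^ n / (n.factorial : ℝ)) :
    (∀ z : ℂ, Summable fun n : ℕ =>
      ‖(((∏ k ∈ Finset.range l, Real.Gamma (a k + α k + α k * g k * n)) /
          (∏ k ∈ Finset.range l,
            Real.Gamma (1 + βw k * (a k + α k - 1) + α k * βw k * g k * n)) : ℝ) : ℂ) *
        z ^ n / (n.factorial : ℝ)‖) ∧
    ContDiffOn ℝ (⊤ : ℕ∞) f (Set.Ioi 0) ∧
    ∀ k : ℕ, ∀ s > (0 : ℝ), 0 ≤ (-1 : ℝ) ^ k * iteratedDerivWithin k f (Set.Ioi 0) s := by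
  have hb := haα
  have hc : ∀ k < l, 0 < α k * g k := fun k hk => mul_pos (hα k hk) (hg k hk)
  set q : ℕ → ℝ := fun n => ∏ k ∈ Finset.range l,
    gammaRatio (βw k) (a k + α k) (α k * g k) n with hq_def
  have hcoef : ∀ n : ℕ, (∏ k ∈ Finset.range l, Real.Gamma (a k + α k + α k * g k * n)) /
      (∏ k ∈ Finset.range l,
        Real.Gamma (1 + βw k * (a k + α k - 1) + α k * βw k * g k * n)) = q n := by
    intro n
    simp only [hq_def, gammaRatio, Finset.prod_div_distrib, mul_right_comm (α _) (g _) (βw _)]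
  have hq : EntireCoeff q := entireCoeff_prod_gammaRatio l hβw hb hc hsum
  have hK₄pos : 0 < K₄ := by
    have : K₄ = q 0 := by simp [hK₄, hq_def, gammaRatio]
    rw [this]
    exact Finset.prod_pos fun k hk =>
      have hk := Finset.mem_range.1 hk
      gammaRatio_pos (hβw k hk) (hb k hk) (hc k hk) 0
  have hfE : f = fun s => (1 / K₄) * altExpGen q s := by
    ext s
    simp only [hf s, hcoef, altExpGen]
  have hcd : ContDiff ℝ (⊤ : ℕ∞) f := hfE ▸ contDiff_const.mul (contDiff_altExpGen hq)
  refine ⟨fun z => ?_, hcd.contDiffOn, fun k s hs => ?_⟩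
  · refine (hq ‖z‖).congr fun n => ?_
    simp only [hcoef, norm_div, norm_mul, norm_pow, Complex.norm_real, Nat.abs_cast,
      Real.norm_eq_abs, abs_norm]
  · rw [iteratedDerivWithin_of_isOpen isOpen_Ioi hs, hfE, iteratedDeriv_const_mul_field,
      iteratedDeriv_altExpGen hq]
    have hnn : NonnegGen fun n => q (n + k) := by
      simp only [hq_def, gammaRatio_add]
      refine nonnegGen_prod_gammaRatio l hβw (fun i hi => ?_) hc hsum
      exact add_pos_of_pos_of_nonneg (hb i hi) (mul_nonneg (hc i hi).le k.cast_nonneg)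
    have e : (-1 : ℝ) ^ k * (1 / K₄ * ((-1) ^ k * altExpGen (fun n => q (n + k)) s)) =
        1 / K₄ * altExpGen (fun n => q (n + k)) s := by
      have : (-1 : ℝ) ^ k * (-1) ^ k = 1 := by rw [← mul_pow]; simp
      linear_combination (1 / K₄ * altExpGen (fun n => q (n + k)) s) * this
    rw [e]
    exact mul_nonneg (by positivity) (hnn.nonneg s (le_of_lt hs))
end

section
/- Let m ≥ 1, p ≥ 1, l ≥ 1, e_i ∈ ℝ, η_i > 0 with e_i + η_i > 0 for 1 ≤ i ≤ m+p; b_i > 0 for 1 ≤ i ≤ p with Σ_{i=1}^p b_i > 1; a_k ∈ ℝ, α_k > 0, γ_k > 0, β_k ∈ (0,1) with a_k + α_k > 0 for 1 ≤ k ≤ l; and suppose Σ_{i=p+1}^{p+m} η_i + Σ_{k=1}^l α_kγ_k(1−β_k) < 1. Then the power series f(s) = (1/K₇) · Σ_{n=0}^∞ [Π_{i=1}^{m+p} Γ(e_i+η_i(1+n)) · Π_{k=1}^l Γ(a_k+α_k+α_kγ_k n)] / [Π_{i=1}^{p} Γ(e_i+b_i+η_i(1+n)) · Π_{k=1}^l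 Γ(1+β_k(a_k+α_k−1)+α_kβ_kγ_k n)] · (−s)^n/n!, with K₇ = Π_{i=1}^p [Γ(e_i+η_i)/Γ(e_i+b_i+η_i)] · Π_{i=p+1}^{p+m} Γ(e_i+η_i) · Π_{k=1}^l [Γ(a_k+α_k)/Γ(1+β_k(a_k+α_k−1))], converges absolutely for every s ∈ ℂ, and its restriction to (0,∞) is completely monotone: f is infinitely differentiable on (0,∞) and (−1)^k f^{(k)}(s) ≥ 0 for every s > 0 and every integer k ≥ 0. -/
open MeasureTheory Finset Filter Complex Real

theorem hasDerivAt_sum_range_exp_neg (N : ℕ) (x : ℝ) :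
    HasDerivAt (fun x : ℝ => ∑ n ∈ Finset.range (N + 1), (-x) ^ n / (n.factorial : ℝ))
      (-∑ n ∈ Finset.range N, (-x) ^ n / (n.factorial : ℝ)) x := by
  induction N with
  | zero => simpa using hasDerivAt_const x (1 : ℝ)
  | succ N ih =>
    have h := ih.add (((hasDerivAt_neg x).pow (N + 1)).div_const ((N + 1).factorial : ℝ))
    simp_rw [Finset.sum_range_succ _ (N + 1)]
    refine h.congr_deriv ?_
    rw [Finset.sum_range_succ, Nat.factorial_succ]
    push_cast
    field_simp
    ring_nf

/-- The remainders of the exponential series at `-x` alternate in sign. -/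
theorem exp_neg_remainder_nonneg (N : ℕ) {x : ℝ} (hx : 0 ≤ x) :
    0 ≤ (-1) ^ N * (Real.exp (-x) - ∑ n ∈ Finset.range N, (-x) ^ n / (n.factorial : ℝ)) := by
  induction N generalizing x with
  | zero => simpa using (Real.exp_pos _).le
  | succ N ih =>
    have hderiv (y : ℝ) : HasDerivAt (fun x : ℝ => (-1) ^ (N + 1) *
        (Real.exp (-x) - ∑ n ∈ Finset.range (N + 1), (-x) ^ n / (n.factorial : ℝ)))
        ((-1) ^ N * (Real.exp (-y) - ∑ n ∈ Finset.range N, (-y) ^ n / (n.factorial : ℝ))) y := by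
      refine (((hasDerivAt_neg y).exp.sub (hasDerivAt_sum_range_exp_neg N y)).const_mul
        ((-1) ^ (N + 1))).congr_deriv ?_
      rw [pow_succ]
      ring
    have hmono : MonotoneOn (fun x : ℝ => (-1) ^ (N + 1) *
        (Real.exp (-x) - ∑ n ∈ Finset.range (N + 1), (-x) ^ n / (n.factorial : ℝ)))
        (Set.Ici 0) := by
      refine monotoneOn_of_deriv_nonneg (convex_Ici 0)
        (fun y _ => (hderiv y).continuousAt.continuousWithinAt)
        (fun y _ => (hderiv y).differentiableAt.differentiableWithinAt) fun y hy => ?_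
      rw [(hderiv y).deriv]
      exact ih (interior_subset hy)
    have := hmono (Set.mem_Ici.2 le_rfl) hx hx
    simpa [Finset.sum_range_succ'] using this

theorem sum_range_odd_exp_neg_nonneg (M : ℕ) {x : ℝ} (hx : 0 ≤ x) :
    0 ≤ ∑ n ∈ Finset.range (2 * M + 1), (-x) ^ n / (n.factorial : ℝ) := by
  have := exp_neg_remainder_nonneg (2 * M + 1) hx
  rw [pow_succ, pow_mul] at this
  have hexp := Real.exp_pos (-x)
  norm_num at this
  linarith

/-- `c` is a Stieltjes moment sequence, expressed through the Riesz functional: polynomials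
`∑ q n t ^ n` that are nonnegative on `[0,∞)` are sent to nonnegative numbers. -/
def IsStieltjes (c : ℕ → ℝ) : Prop :=
  ∀ (N : ℕ) (q : ℕ → ℝ), (∀ t : ℝ, 0 ≤ t → 0 ≤ ∑ n ∈ Finset.range N, q n * t ^ n) →
    0 ≤ ∑ n ∈ Finset.range N, q n * c n

namespace IsStieltjes

theorem pow {r : ℝ} (hr : 0 ≤ r) : IsStieltjes fun n => r ^ n := fun _ _ h => h r hr

theorem one : IsStieltjes fun _ => 1 := by
  simpa using pow (zero_le_one' ℝ)

theorem mul {c d : ℕ → ℝ} (hc : IsStieltjes c) (hd : IsStieltjes d) :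
    IsStieltjes fun n => c n * d n := by
  intro N q h
  have key := hc N (fun n => q n * d n) fun t ht => by
    have := hd N (fun n => q n * t ^ n) fun u hu => by
      simpa only [mul_pow, mul_assoc] using h (t * u) (mul_nonneg ht hu)
    simpa only [mul_right_comm] using this
  simpa only [mul_assoc, mul_comm (d _)] using key

theorem const_mul {c : ℕ → ℝ} (hc : IsStieltjes c) {r : ℝ} (hr : 0 ≤ r) :
    IsStieltjes fun n => r * c n := by
  intro N q h
  have := mul_nonneg hr (hc N q h)
  simpa only [Finset.mul_sum, mul_left_comm] using this

theorem add {c d : ℕ → ℝ} (hc : IsStieltjes c) (hd : IsStieltjes d) :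
    IsStieltjes fun n => c n + d n := by
  intro N q h
  simpa only [mul_add, Finset.sum_add_distrib] using add_nonneg (hc N q h) (hd N q h)

theorem prod {ι : Type*} (s : Finset ι) {c : ι → ℕ → ℝ} (h : ∀ i ∈ s, IsStieltjes (c i)) :
    IsStieltjes fun n => ∏ i ∈ s, c i n := by
  classical
  induction s using Finset.induction_on with
  | empty => simpa using one
  | insert i s hi ih =>
    simp only [Finset.prod_insert hi]
    exact (h i (by simp)).mul (ih fun j hj => h j (by simp [hj]))

theorem of_tendsto {C : ℕ → ℕ → ℝ} {c : ℕ → ℝ} (hC : ∀ᶠ N in atTop, IsStieltjes (C N))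
    (h : ∀ n, Tendsto (fun N => C N n) atTop (nhds (c n))) : IsStieltjes c := by
  intro M q hq
  refine ge_of_tendsto (tendsto_finsetSum (Finset.range M) fun n _ => (h n).const_mul (q n)) ?_
  filter_upwards [hC] with N hN using hN M q hq

/-- The moments of the density `x ^ (A - 1)` in the variable `x ^ B` on `[0,1]`. -/
theorem inv_affine {A B : ℝ} (hA : 0 < A) (hB : 0 < B) :
    IsStieltjes fun n => (A + B * n)⁻¹ := by
  intro N q h
  have hexp : ∀ n : ℕ, -1 < A - 1 + B * n := fun n => by
    have : 0 ≤ B * (n : ℝ) := by positivity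
    linarith
  have hint : ∀ n ∈ Finset.range N,
      IntervalIntegrable (fun x : ℝ => q n * x ^ (A - 1 + B * n)) volume 0 1 := fun n _ =>
    (intervalIntegral.intervalIntegrable_rpow' (hexp n)).const_mul _
  have key : ∫ x in (0 : ℝ)..1, ∑ n ∈ Finset.range N, q n * x ^ (A - 1 + B * n) =
      ∑ n ∈ Finset.range N, q n * (A + B * n)⁻¹ := by
    rw [intervalIntegral.integral_finsetSum hint]
    refine Finset.sum_congr rfl fun n _ => ?_
    rw [intervalIntegral.integral_const_mul, integral_rpow (Or.inl (hexp n)),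
      show A - 1 + B * n + 1 = A + B * n by ring, Real.zero_rpow
        (by have : 0 ≤ B * (n : ℝ) := by positivity
            linarith), Real.one_rpow, sub_zero, one_div]
  rw [← key]
  refine intervalIntegral.integral_nonneg_of_ae_restrict zero_le_one ?_
  rw [← restrict_Ioc_eq_restrict_Icc]
  filter_upwards [ae_restrict_mem measurableSet_Ioc] with x hx
  have hx0 : 0 < x := hx.1
  have := mul_nonneg (Real.rpow_nonneg hx0.le (A - 1)) (h (x ^ B) (Real.rpow_nonneg hx0.le _))
  rw [Finset.mul_sum] at this
  refine this.trans_eq (Finset.sum_congr rfl fun n _ => ?_)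
  rw [Real.rpow_add hx0, Real.rpow_mul hx0.le, Real.rpow_natCast]
  ring

theorem shift {c : ℕ → ℝ} (hc : IsStieltjes c) (k : ℕ) : IsStieltjes fun n => c (n + k) := by
  induction k with
  | zero => exact hc
  | succ k ih =>
    intro N q h
    have := ih (N + 1) (fun n => if n = 0 then 0 else q (n - 1)) fun t ht => by
      simpa [Finset.sum_range_succ', pow_succ, ← mul_assoc, ← Finset.sum_mul]
        using mul_nonneg (h t ht) ht
    simpa [Finset.sum_range_succ', add_assoc, add_comm 1 k] using this

theorem tsum_nonneg {c : ℕ → ℝ} (hc : IsStieltjes c) (k : ℕ) {s : ℝ} (hs : 0 ≤ s)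
    (hsum : Summable fun n : ℕ => c (n + k) * (-s) ^ n / (n.factorial : ℝ)) :
    0 ≤ ∑' n : ℕ, c (n + k) * (-s) ^ n / (n.factorial : ℝ) := by
  have hodd : Tendsto (fun M : ℕ => 2 * M + 1) atTop atTop :=
    tendsto_atTop_mono (fun M => show M ≤ 2 * M + 1 by omega) tendsto_id
  refine ge_of_tendsto' (hsum.hasSum.tendsto_sum_nat.comp hodd) fun M => ?_
  have := hc.shift k (2 * M + 1) (fun n => (-s) ^ n / (n.factorial : ℝ)) fun t ht => by
    have := sum_range_odd_exp_neg_nonneg M (mul_nonneg hs ht)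
    simpa only [div_mul_eq_mul_div, ← mul_pow, neg_mul] using this
  simpa only [Function.comp, mul_comm (c _), div_mul_eq_mul_div] using this

end IsStieltjes

theorem gammaSeq_div_isStieltjes {A B κ β : ℝ} (hA : 0 < A) (hB : 0 < B) (hκ : 0 ≤ κ)
    (hβ : β ∈ Set.Icc (0 : ℝ) 1) {N : ℕ} (hN : 0 < N) :
    IsStieltjes fun n => Real.GammaSeq (A + B * n) N / Real.GammaSeq (κ + β * (A + B * n)) N := by
  obtain ⟨hβ0, hβ1⟩ := hβ
  have hN' : (0 : ℝ) < N := by exact_mod_cast hN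
  have hfac : ∀ j ∈ Finset.range (N + 1),
      IsStieltjes fun n : ℕ => β + (κ + (1 - β) * j) * (A + j + B * n)⁻¹ := fun j _ => by
    have h1 := IsStieltjes.one.const_mul hβ0
    simp only [mul_one] at h1
    have hj : (0 : ℝ) ≤ j := j.cast_nonneg
    exact h1.add ((IsStieltjes.inv_affine (by positivity) hB).const_mul
      (add_nonneg hκ (mul_nonneg (by linarith) hj)))
  have hgeom := (IsStieltjes.pow (Real.rpow_nonneg hN'.le (B - β * B))).const_mul
    (Real.rpow_nonneg hN'.le (A - κ - β * A))
  convert hgeom.mul (IsStieltjes.prod _ hfac) using 2 with n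
  have hx : 0 < A + B * (n : ℝ) := by positivity
  have hfac' : ∀ j ∈ Finset.range (N + 1), β + (κ + (1 - β) * j) * (A + j + B * n)⁻¹ =
      (κ + β * (A + B * n) + j) / (A + B * n + j) := fun j _ => by
    have hj : (0 : ℝ) ≤ j := j.cast_nonneg
    have : A + j + B * (n : ℝ) ≠ 0 := by positivity
    have : A + B * (n : ℝ) + j ≠ 0 := by positivity
    rw [eq_div_iff this, add_right_comm A]
    field_simp
    ring
  rw [Finset.prod_congr rfl hfac', Finset.prod_div_distrib, Real.GammaSeq, Real.GammaSeq,
    ← Real.rpow_natCast, ← Real.rpow_mul hN'.le, ← Real.rpow_add hN',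
    show A - κ - β * A + (B - β * B) * n = A + B * n - (κ + β * (A + B * n)) by ring,
    Real.rpow_sub hN']
  have : (N.factorial : ℝ) ≠ 0 := by positivity
  field_simp

theorem gamma_div_gamma_isStieltjes {A B κ β : ℝ} (hA : 0 < A) (hB : 0 < B) (hκ : 0 ≤ κ)
    (hβ : β ∈ Set.Icc (0 : ℝ) 1) (hκβ : 0 < κ + β) :
    IsStieltjes fun n => Real.Gamma (A + B * n) / Real.Gamma (κ + β * (A + B * n)) := by
  refine IsStieltjes.of_tendsto (C := fun N n =>
    Real.GammaSeq (A + B * n) N / Real.GammaSeq (κ + β * (A + B * n)) N) ?_ fun n => ?_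
  · filter_upwards [eventually_gt_atTop 0] with N hN
    exact gammaSeq_div_isStieltjes hA hB hκ hβ hN
  · have hx : 0 < A + B * (n : ℝ) := by positivity
    have hy : 0 < κ + β * (A + B * n) := by
      obtain ⟨hβ0, hβ1⟩ := hβ
      rcases hκ.eq_or_lt with h | h
      · have : 0 < β := by linarith
        positivity
      · positivity
    exact (Real.GammaSeq_tendsto_Gamma _).div (Real.GammaSeq_tendsto_Gamma _)
      (Real.Gamma_pos_of_pos hy).ne'

theorem gamma_add_le {x h : ℝ} (hx : 0 < x) (hh : 0 < h) :
    Real.Gamma (x + h) ≤ (x + h) ^ h * Real.Gamma x := by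
  have hxh : 0 < x + h := by positivity
  have := Real.convexOn_log_Gamma.slope_mono_adjacent (x := x) (y := x + h) (z := x + h + 1)
    hx (by show (0 : ℝ) < _; positivity) (by linarith) (by linarith)
  simp only [Function.comp] at this
  rw [Real.Gamma_add_one hxh.ne', Real.log_mul hxh.ne' (Real.Gamma_pos_of_pos hxh).ne',
    add_sub_cancel_left, add_sub_cancel_left, div_one, add_sub_cancel_right, div_le_iff₀ hh] at this
  rw [← Real.log_le_log_iff (Real.Gamma_pos_of_pos hxh)
    (mul_pos (Real.rpow_pos_of_pos hxh _) (Real.Gamma_pos_of_pos hx)),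
    Real.log_mul (Real.rpow_pos_of_pos hxh _).ne' (Real.Gamma_pos_of_pos hx).ne',
    Real.log_rpow hxh]
  linarith

theorem le_gamma_add {x h : ℝ} (hx : 0 < x) (hh : 0 < h) :
    x ^ h * Real.Gamma (x + 1) ≤ Real.Gamma (x + 1 + h) := by
  have hx1 : 0 < x + 1 := by positivity
  have hxh : 0 < x + 1 + h := by positivity
  have := Real.convexOn_log_Gamma.slope_mono_adjacent (x := x) (y := x + 1) (z := x + 1 + h)
    hx hxh (by linarith) (by linarith)
  simp only [Function.comp] at this
  rw [add_sub_cancel_left, add_sub_cancel_left, div_one, le_div_iff₀ hh,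
    Real.Gamma_add_one hx.ne', Real.log_mul hx.ne' (Real.Gamma_pos_of_pos hx).ne',
    add_sub_cancel_right] at this
  rw [← Real.log_le_log_iff (mul_pos (Real.rpow_pos_of_pos hx _) (Real.Gamma_pos_of_pos hx1))
    (Real.Gamma_pos_of_pos hxh),
    Real.log_mul (Real.rpow_pos_of_pos hx _).ne' (Real.Gamma_pos_of_pos hx1).ne',
    Real.log_rpow hx, Real.Gamma_add_one hx.ne',
    Real.log_mul hx.ne' (Real.Gamma_pos_of_pos hx).ne']
  linarith

theorem gamma_ratio_isBigO {A B : ℝ} (hA : 0 < A) (hB : 0 < B) :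
    (fun n : ℕ => Real.Gamma (A + B * (n + 1 : ℕ)) / Real.Gamma (A + B * n))
      =O[atTop] fun n : ℕ => (n : ℝ) ^ B := by
  refine Asymptotics.IsBigO.of_bound ((A + 2 * B) ^ B) ?_
  filter_upwards [eventually_ge_atTop 1] with n hn
  have hn' : (1 : ℝ) ≤ n := by exact_mod_cast hn
  have hx : 0 < A + B * (n : ℝ) := by positivity
  have hx' : 0 < A + B * ((n + 1 : ℕ) : ℝ) := by positivity
  have hG := Real.Gamma_pos_of_pos hx
  have hG' := Real.Gamma_pos_of_pos hx'
  rw [Real.norm_of_nonneg (by positivity), Real.norm_of_nonneg (by positivity),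
    ← Real.mul_rpow (by positivity) (by positivity), div_le_iff₀ hG]
  have heq : A + B * ((n + 1 : ℕ) : ℝ) = A + B * n + B := by push_cast; ring
  rw [heq]
  refine (gamma_add_le hx hB).trans ?_
  gcongr
  nlinarith

theorem gamma_ratio_inv_isBigO {A B : ℝ} (hA : 0 < A) (hB : 0 ≤ B) :
    (fun n : ℕ => Real.Gamma (A + B * n) / Real.Gamma (A + B * (n + 1 : ℕ)))
      =O[atTop] fun n : ℕ => (n : ℝ) ^ (-B) := by
  rcases hB.eq_or_lt with rfl | hB
  · simp [div_self (Real.Gamma_pos_of_pos hA).ne', Asymptotics.isBigO_refl]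
  refine Asymptotics.IsBigO.of_bound ((B / 2) ^ (-B)) ?_
  have hlarge : ∀ᶠ n : ℕ in atTop, 1 ≤ B / 2 * (n : ℝ) :=
    (tendsto_natCast_atTop_atTop.const_mul_atTop (half_pos hB)).eventually_ge_atTop 1
  filter_upwards [eventually_ge_atTop 1, hlarge] with n hn hn2
  have hn' : (1 : ℝ) ≤ n := by exact_mod_cast hn
  have hx : 0 < A + B * (n : ℝ) := by positivity
  have hx' : 0 < A + B * ((n + 1 : ℕ) : ℝ) := by positivity
  have hG := Real.Gamma_pos_of_pos hx
  have hG' := Real.Gamma_pos_of_pos hx'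
  have hBn : 0 < B / 2 * (n : ℝ) := by positivity
  rw [Real.norm_of_nonneg (by positivity), Real.norm_of_nonneg (by positivity),
    ← Real.mul_rpow (by positivity) (by positivity), div_le_iff₀ hG',
    Real.rpow_neg hBn.le, ← div_eq_inv_mul, le_div_iff₀ (Real.rpow_pos_of_pos hBn _), mul_comm]
  have hle : B / 2 * n ≤ A + B * n - 1 := by linarith
  have key := le_gamma_add (hBn.trans_le hle) hB
  rw [sub_add_cancel] at key
  rw [show A + B * ((n + 1 : ℕ) : ℝ) = A + B * n + B by push_cast; ring]
  refine le_trans ?_ key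
  gcongr

/-- A positive Stieltjes moment sequence whose successive ratios grow at most like `n ^ δ`. -/
structure IsMomentOfOrder (u : ℕ → ℝ) (δ : ℝ) : Prop where
  pos : ∀ n, 0 < u n
  isStieltjes : IsStieltjes u
  ratio : (fun n : ℕ => u (n + 1) / u n) =O[atTop] fun n : ℕ => (n : ℝ) ^ δ

namespace IsMomentOfOrder

theorem mul {u v : ℕ → ℝ} {δ ε : ℝ} (hu : IsMomentOfOrder u δ) (hv : IsMomentOfOrder v ε) :
    IsMomentOfOrder (fun n => u n * v n) (δ + ε) where
  pos n := mul_pos (hu.pos n) (hv.pos n)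
  isStieltjes := hu.isStieltjes.mul hv.isStieltjes
  ratio := by
    refine (hu.ratio.mul hv.ratio).congr' (.of_forall fun n => div_mul_div_comm ..) ?_
    filter_upwards [eventually_gt_atTop 0] with n hn
    rw [Real.rpow_add (by exact_mod_cast hn)]

theorem prod {ι : Type*} (s : Finset ι) {u : ι → ℕ → ℝ} {δ : ι → ℝ}
    (h : ∀ i ∈ s, IsMomentOfOrder (u i) (δ i)) :
    IsMomentOfOrder (fun n => ∏ i ∈ s, u i n) (∑ i ∈ s, δ i) := by
  classical
  induction s using Finset.induction_on with
  | empty =>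
    exact ⟨by simp, by simpa using IsStieltjes.one, by simp [Asymptotics.isBigO_refl]⟩
  | insert i s hi ih =>
    simp only [Finset.prod_insert hi, Finset.sum_insert hi]
    exact (h i (by simp)).mul (ih fun j hj => h j (by simp [hj]))

theorem gamma_div_gamma {A B κ β : ℝ} (hA : 0 < A) (hB : 0 < B) (hκ : 0 ≤ κ)
    (hβ : β ∈ Set.Icc (0 : ℝ) 1) (hκβ : 0 < κ + β) :
    IsMomentOfOrder (fun n => Real.Gamma (A + B * n) / Real.Gamma (κ + β * (A + B * n)))
      (B * (1 - β)) := by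
  have hpos : ∀ x : ℝ, 0 < x → 0 < κ + β * x := fun x hx => by
    obtain ⟨hβ0, hβ1⟩ := hβ
    rcases hκ.eq_or_lt with h | h
    · have : 0 < β := by linarith
      positivity
    · positivity
  refine ⟨fun n => ?_, gamma_div_gamma_isStieltjes hA hB hκ hβ hκβ, ?_⟩
  · have hx : 0 < A + B * (n : ℝ) := by positivity
    exact div_pos (Real.Gamma_pos_of_pos hx) (Real.Gamma_pos_of_pos (hpos _ hx))
  · refine ((gamma_ratio_isBigO hA hB).mul (gamma_ratio_inv_isBigO (hpos A hA)
      (mul_nonneg hβ.1 hB.le))).congr' (.of_forall fun n => ?_) ?_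
    · simp only [mul_add, ← mul_assoc, ← add_assoc]
      rw [div_mul_div_comm, div_div_div_eq, mul_comm (Real.Gamma (A + B * n))]
    · filter_upwards [eventually_gt_atTop 0] with n hn
      rw [← Real.rpow_add (by exact_mod_cast hn)]
      ring_nf

theorem summable {u : ℕ → ℝ} {δ : ℝ} (hu : IsMomentOfOrder u δ) (hδ : δ < 1) (r : ℝ) :
    Summable fun n : ℕ => u n * r ^ n / (n.factorial : ℝ) := by
  rcases eq_or_ne r 0 with rfl | hr
  · exact summable_of_ne_finset_zero (s := {0}) fun n hn => by
      simp [zero_pow (Finset.notMem_singleton.1 hn)]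
  refine summable_of_ratio_test_tendsto_lt_one zero_lt_one (.of_forall fun n =>
    div_ne_zero (mul_ne_zero (hu.pos n).ne' (pow_ne_zero _ hr)) (by positivity)) ?_
  have hinv : (fun n : ℕ => ((n : ℝ) + 1)⁻¹) =O[atTop] fun n : ℕ => (n : ℝ) ^ (-1 : ℝ) := by
    refine Asymptotics.IsBigO.of_bound 1 ?_
    filter_upwards [eventually_gt_atTop 0] with n hn
    have hn' : (0 : ℝ) < n := by exact_mod_cast hn
    rw [Real.rpow_neg_one, one_mul, Real.norm_of_nonneg (by positivity),
      Real.norm_of_nonneg (by positivity)]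
    gcongr
    linarith
  have hO : (fun n : ℕ => u (n + 1) / u n * ((n : ℝ) + 1)⁻¹) =O[atTop]
      fun n : ℕ => (n : ℝ) ^ (-(1 - δ)) := by
    refine (hu.ratio.mul hinv).congr' .rfl ?_
    filter_upwards [eventually_gt_atTop 0] with n hn
    rw [← Real.rpow_add (by exact_mod_cast hn)]
    ring_nf
  have hlim := (hO.trans_tendsto ((tendsto_rpow_neg_atTop (sub_pos.2 hδ)).comp
    tendsto_natCast_atTop_atTop)).const_mul |r|
  rw [mul_zero] at hlim
  refine hlim.congr fun n => ?_
  have h0 := hu.pos n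
  have h1 := hu.pos (n + 1)
  have hr' : 0 < |r| := abs_pos.2 hr
  rw [norm_div, norm_div, norm_mul, norm_mul, norm_pow, norm_pow, Real.norm_of_nonneg h0.le,
    Real.norm_of_nonneg h1.le, Real.norm_natCast, Real.norm_natCast, Real.norm_eq_abs,
    Nat.factorial_succ]
  push_cast
  field_simp
  ring

end IsMomentOfOrder

theorem summable_shift {c : ℕ → ℝ}
    (hc : ∀ r : ℝ, Summable fun n : ℕ => c n * r ^ n / (n.factorial : ℝ)) (k : ℕ) (r : ℝ) :
    Summable fun n : ℕ => c (n + k) * r ^ n / (n.factorial : ℝ) := by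
  induction k generalizing r with
  | zero => exact hc r
  | succ k ih =>
    have h := ((summable_nat_add_iff 1).2 (ih (2 * (|r| + 1)))).norm
    refine Summable.of_norm_bounded h fun n => ?_
    have hfac : ((n + 1).factorial : ℝ) ≤ 2 ^ (n + 1) * n.factorial := by
      rw [Nat.factorial_succ]
      exact_mod_cast Nat.mul_le_mul_right _ (Nat.lt_two_pow_self (n := n + 1)).le
    have hpow : |r| ^ n ≤ (|r| + 1) ^ (n + 1) :=
      (pow_le_pow_left₀ (abs_nonneg r) (by linarith) n).trans
        (pow_le_pow_right₀ (by linarith [abs_nonneg r]) n.le_succ)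
    rw [show n + (k + 1) = n + 1 + k by ring, norm_div, norm_div, norm_mul, norm_mul, norm_pow,
      norm_pow, Real.norm_natCast, Real.norm_natCast, mul_div_assoc, mul_div_assoc,
      Real.norm_of_nonneg (by positivity : 0 ≤ 2 * (|r| + 1)), Real.norm_eq_abs r]
    gcongr ‖c (n + 1 + k)‖ * ?_
    rw [div_le_div_iff₀ (by positivity) (by positivity), mul_pow]
    calc |r| ^ n * ((n + 1).factorial : ℝ)
        ≤ (|r| + 1) ^ (n + 1) * (2 ^ (n + 1) * n.factorial) := by gcongr
      _ = _ := by ring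

theorem hasDerivAt_exponential_series {c : ℕ → ℝ}
    (hc : ∀ r : ℝ, Summable fun n : ℕ => c n * r ^ n / (n.factorial : ℝ)) (s : ℝ) :
    HasDerivAt (fun s : ℝ => ∑' n : ℕ, c n * (-s) ^ n / (n.factorial : ℝ))
      (-∑' n : ℕ, c (n + 1) * (-s) ^ n / (n.factorial : ℝ)) s := by
  have hterm (y : ℝ) : (fun n : ℕ => c (n + 1) * y ^ n / (n.factorial : ℝ)) =
      fun n : ℕ => c (n + 1) * (((n + 1 : ℕ) : ℝ) * y ^ n) / ((n + 1).factorial : ℝ) := by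
    ext n
    rw [Nat.factorial_succ]
    push_cast
    field_simp
  have hsum' (y : ℝ) : Summable fun n : ℕ => c n * ((n : ℝ) * y ^ (n - 1)) / (n.factorial : ℝ) := by
    have := summable_shift hc 1 y
    rw [hterm y] at this
    exact (summable_nat_add_iff 1).1 this
  have hs : s ∈ Metric.ball (0 : ℝ) (|s| + 1) := by simp
  have h := hasDerivAt_tsum_of_isPreconnected (hsum' (|s| + 1)).norm Metric.isOpen_ball
    (convex_ball (0 : ℝ) (|s| + 1)).isPreconnected
    (g := fun n s => c n * (-s) ^ n / (n.factorial : ℝ))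
    (g' := fun n s => -(c n * ((n : ℝ) * (-s) ^ (n - 1)) / (n.factorial : ℝ)))
    (fun n y _ => ((((hasDerivAt_neg y).pow n).const_mul (c n)).div_const _).congr_deriv
      (by ring)) (fun n y hy => ?_) hs (hc (-s)) hs
  · refine h.congr_deriv ?_
    rw [tsum_neg, (hsum' (-s)).tsum_eq_zero_add, hterm]
    simp
  · have hy' : |y| ≤ |s| + 1 := by simpa using (mem_ball_zero_iff.1 hy).le
    have hs1 : 0 ≤ |s| + 1 := by positivity
    rw [norm_neg, norm_div, norm_div, norm_mul, norm_mul, norm_mul, norm_mul, norm_pow, norm_pow,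
      norm_neg, Real.norm_eq_abs y, Real.norm_of_nonneg hs1]
    gcongr

theorem iteratedDeriv_exponential_series {c : ℕ → ℝ}
    (hc : ∀ r : ℝ, Summable fun n : ℕ => c n * r ^ n / (n.factorial : ℝ)) (k : ℕ) :
    iteratedDeriv k (fun s : ℝ => ∑' n : ℕ, c n * (-s) ^ n / (n.factorial : ℝ)) =
      fun s => (-1) ^ k * ∑' n : ℕ, c (n + k) * (-s) ^ n / (n.factorial : ℝ) := by
  induction k with
  | zero => simp
  | succ k ih =>
    rw [iteratedDeriv_succ, ih]
    ext s
    rw [((hasDerivAt_exponential_series (summable_shift hc k) s).const_mul _).deriv, pow_succ]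
    simp only [add_right_comm _ 1 k, add_assoc]
    ring

theorem contDiff_exponential_series {c : ℕ → ℝ}
    (hc : ∀ r : ℝ, Summable fun n : ℕ => c n * r ^ n / (n.factorial : ℝ)) :
    ContDiff ℝ (⊤ : ℕ∞) fun s : ℝ => ∑' n : ℕ, c n * (-s) ^ n / (n.factorial : ℝ) := by
  refine contDiff_of_differentiable_iteratedDeriv fun k _ s => ?_
  rw [iteratedDeriv_exponential_series hc]
  exact ((hasDerivAt_exponential_series (summable_shift hc k) s).const_mul _).differentiableAt

/-- the generalized Wright function `(1/K₇)·_{m+p+l}Ψ_{p+l}[−s]` (Laplace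
transform of the class (C7) Fox-H density) is entire and completely monotone on `(0,∞)`. -/
theorem wright_C7_completely_monotone
    (m p l : ℕ) (hm : 1 ≤ m) (hp : 1 ≤ p) (hl : 1 ≤ l)
    (e η b a α g βw : ℕ → ℝ)
    (hη : ∀ i < m + p, 0 < η i) (heη : ∀ i < m + p, 0 < e i + η i)
    (hb : ∀ i < p, 0 < b i) (hbsum : 1 < ∑ i ∈ Finset.range p, b i)
    (hα : ∀ k < l, 0 < α k) (hg : ∀ k < l, 0 < g k)
    (hβw : ∀ k < l, βw k ∈ Set.Ioo (0 : ℝ) 1) (haα : ∀ k < l, 0 < a k + α k)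
    (hsum : ∑ i ∈ Finset.Ico p (p + m), η i +
      ∑ k ∈ Finset.range l, α k * g k * (1 - βw k) < 1)
    (K₇ : ℝ)
    (hK₇ : K₇ = (∏ i ∈ Finset.range p, (Real.Gamma (e i + η i) / Real.Gamma (e i + b i + η i))) *
      (∏ i ∈ Finset.Ico p (p + m), Real.Gamma (e i + η i)) *
      ∏ k ∈ Finset.range l,
        (Real.Gamma (a k + α k) / Real.Gamma (1 + βw k * (a k + α k - 1))))
    (c : ℕ → ℝ)
    (hc : ∀ n : ℕ, c n =
      ((∏ i ∈ Finset.range (m + p), Real.Gamma (e i + η i * (1 + n))) *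
        ∏ k ∈ Finset.range l, Real.Gamma (a k + α k + α k * g k * n)) /
      ((∏ i ∈ Finset.range p, Real.Gamma (e i + b i + η i * (1 + n))) *
        ∏ k ∈ Finset.range l, Real.Gamma (1 + βw k * (a k + α k - 1) + α k * βw k * g k * n)))
    (f : ℝ → ℝ)
    (hf : ∀ s : ℝ, f s = (1 / K₇) * ∑' n : ℕ, c n * (-s) ^ n / (n.factorial : ℝ)) :
    (∀ z : ℂ, Summable fun n : ℕ => ‖((c n : ℝ) : ℂ) * z ^ n / (n.factorial : ℝ)‖) ∧
    ContDiffOn ℝ (⊤ : ℕ∞) f (Set.Ioi 0) ∧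
    ∀ k : ℕ, ∀ s > (0 : ℝ), 0 ≤ (-1 : ℝ) ^ k * iteratedDerivWithin k f (Set.Ioi 0) s := by
  have hbeta : ∀ i ∈ Finset.range p, IsMomentOfOrder (fun n => Real.Gamma (e i + η i + η i * n) /
      Real.Gamma (b i + 1 * (e i + η i + η i * n))) (η i * (1 - 1)) := fun i hi => by
    have hi := Finset.mem_range.1 hi
    exact .gamma_div_gamma (heη i (by omega)) (hη i (by omega)) (hb i hi).le (by simp)
      (by linarith [hb i hi])
  have hgamma : ∀ i ∈ Finset.Ico p (p + m),
      IsMomentOfOrder (fun n => Real.Gamma (e i + η i + η i * n) /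
        Real.Gamma (1 + 0 * (e i + η i + η i * n))) (η i * (1 - 0)) := fun i hi => by
    have hi := (Finset.mem_Ico.1 hi).2
    exact .gamma_div_gamma (heη i (by omega)) (hη i (by omega)) zero_le_one (by simp) (by simp)
  have hstable : ∀ k ∈ Finset.range l,
      IsMomentOfOrder (fun n => Real.Gamma (a k + α k + α k * g k * n) /
        Real.Gamma (1 - βw k + βw k * (a k + α k + α k * g k * n)))
        (α k * g k * (1 - βw k)) := fun k hk => by
    have hk := Finset.mem_range.1 hk
    obtain ⟨h0, h1⟩ := hβw k hk
    exact .gamma_div_gamma (haα k hk) (mul_pos (hα k hk) (hg k hk)) (by linarith)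
      ⟨h0.le, h1.le⟩ (by linarith)
  have hmom : IsMomentOfOrder c (∑ i ∈ Finset.Ico p (p + m), η i +
      ∑ k ∈ Finset.range l, α k * g k * (1 - βw k)) := by
    convert ((IsMomentOfOrder.prod _ hbeta).mul (.prod _ hgamma)).mul (.prod _ hstable) using 1
    · ext n
      rw [hc n, add_comm m p, ← Finset.prod_range_mul_prod_Ico _ (Nat.le_add_right p m)]
      simp only [zero_mul, add_zero, Real.Gamma_one, div_one, one_mul, Finset.prod_div_distrib]
      rw [div_mul_eq_mul_div, div_mul_div_comm]
      have hη' (i : ℕ) : e i + η i * (1 + n) = e i + η i + η i * n := by ring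
      have hb' (i : ℕ) : e i + b i + η i * (1 + n) = b i + (e i + η i + η i * n) := by ring
      have hβ' (k : ℕ) : 1 + βw k * (a k + α k - 1) + α k * βw k * g k * n =
        1 - βw k + βw k * (a k + α k + α k * g k * n) := by ring
      simp only [hη', hb', hβ']
    · simp
  have hsummable : ∀ r : ℝ, Summable fun n : ℕ => c n * r ^ n / (n.factorial : ℝ) :=
    hmom.summable hsum
  have hK : 0 ≤ 1 / K₇ := by
    have hK0 : K₇ = c 0 := by
      rw [hK₇, hc 0, add_comm m p, ← Finset.prod_range_mul_prod_Ico _ (Nat.le_add_right p m)]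
      simp only [Nat.cast_zero, add_zero, mul_one, mul_zero, Finset.prod_div_distrib]
      rw [div_mul_eq_mul_div, div_mul_div_comm]
    rw [hK0]
    exact (one_div_pos.2 (hmom.pos 0)).le
  obtain rfl : f = fun s => (1 / K₇) * ∑' n : ℕ, c n * (-s) ^ n / (n.factorial : ℝ) := funext hf
  refine ⟨fun z => ?_, ((contDiff_exponential_series hsummable).const_smul (1 / K₇)).contDiffOn,
    fun k s hs => ?_⟩
  · simpa [abs_of_pos (hmom.pos _)] using hsummable ‖z‖
  · rw [iteratedDerivWithin_of_isOpen isOpen_Ioi hs, iteratedDeriv_const_mul_field,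
      iteratedDeriv_exponential_series hsummable, mul_left_comm, ← mul_assoc ((-1 : ℝ) ^ k),
      ← mul_pow, neg_one_mul, neg_neg, one_pow, one_mul]
    exact mul_nonneg hK
      (hmom.isStieltjes.tsum_nonneg k hs.le (summable_shift hsummable k (-s)))
end

section
/- Let β ∈ (0,1), a ∈ ℝ and α > 0 with a + α > 0, and let M_β(x) = Σ_{n≥0} (−x)^n/(n!·Γ(1−β(n+1))) be the M-Wright function. Then the function ρ(x) = [Γ(1−β+β(a+α)) / (α·Γ(a+α))] · x^{a/α} · M_β(x^{1/α}) is a probability density on (0,∞): ρ(x) ≥ 0 for every x > 0 and ∫₀^∞ ρ(x) dx = 1. Equivalently, M_β(x) ≥ 0 for all x > 0 and ∫₀^∞ x^{a+α−1} M_β(x) dx = Γ(a+α)/Γ(1+β(a+α−1)). -/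
open MeasureTheory Finset Filter Real

/-- The M-Wright (Mainardi) function `M_β(x) = Σ_{n≥0} (−x)^n/(n!·Γ(1−β(n+1)))`. -/
noncomputable def mWright (β x : ℝ) : ℝ :=
  ∑' n : ℕ, (-x) ^ n / ((n.factorial : ℝ) * Real.Gamma (1 - β * (n + 1)))

theorem integrableOn_rpow_mul_exp_neg_mul {w r : ℝ} (hw : 0 < w) (hr : 0 < r) :
    IntegrableOn (fun t : ℝ => t ^ (w - 1) * Real.exp (-(r * t))) (Set.Ioi 0) := by
  have h := integrableOn_rpow_mul_exp_neg_mul_rpow (p := 1) (s := w - 1) (b := r)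
    (by linarith) one_pos hr
  simpa [neg_mul] using h

theorem continuousOn_ofReal_rpow (p : ℝ) :
    ContinuousOn (fun t : ℝ => ((t ^ p : ℝ) : ℂ)) (Set.Ioi 0) := by
  refine Complex.continuous_ofReal.comp_continuousOn fun t ht => ?_
  exact (Real.continuousAt_rpow_const t p (Or.inl (ne_of_gt ht))).continuousWithinAt

theorem norm_rpow_mul_cexp_neg {t : ℝ} (ht : 0 < t) (p : ℝ) (c : ℂ) :
    ‖((t ^ p : ℝ) : ℂ) * Complex.exp (-(c * t))‖ = t ^ p * Real.exp (-(c.re * t)) := by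
  rw [norm_mul, Complex.norm_real, Complex.norm_exp, Real.norm_of_nonneg (by positivity)]
  simp

theorem integrableOn_rpow_mul_cexp_neg {w : ℝ} (hw : 0 < w) {c : ℂ} (hc : 0 < c.re) :
    IntegrableOn (fun t : ℝ => ((t ^ (w - 1) : ℝ) : ℂ) * Complex.exp (-(c * t)))
      (Set.Ioi 0) := by
  refine (integrableOn_rpow_mul_exp_neg_mul hw hc).mono' ?_ ?_
  · exact ((continuousOn_ofReal_rpow _).mul (by fun_prop)).aestronglyMeasurable
      measurableSet_Ioi
  · filter_upwards [ae_restrict_mem measurableSet_Ioi] with t ht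
    exact (norm_rpow_mul_cexp_neg ht _ _).le

/-- The Gamma integral with a complex rate of positive real part. -/
theorem integral_rpow_mul_cexp_neg {w : ℝ} (hw : 0 < w) {c : ℂ} (hc : 0 < c.re) :
    ∫ t : ℝ in Set.Ioi 0, ((t ^ (w - 1) : ℝ) : ℂ) * Complex.exp (-(c * t)) =
      (Real.Gamma w : ℂ) * c ^ (-(w : ℂ)) := by
  set U : Set ℂ := {z | 0 < z.re} with hU
  have hUo : IsOpen U := isOpen_lt continuous_const Complex.continuous_re
  have hd : DifferentiableOn ℂ (fun c : ℂ => ∫ t : ℝ in Set.Ioi 0,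
      ((t ^ (w - 1) : ℝ) : ℂ) * Complex.exp (-(c * t))) U := by
    intro c (hc : 0 < c.re)
    have key := hasDerivAt_integral_of_dominated_loc_of_deriv_le (μ := volume.restrict (Set.Ioi 0))
      (F := fun (c : ℂ) (t : ℝ) => ((t ^ (w - 1) : ℝ) : ℂ) * Complex.exp (-(c * t)))
      (F' := fun (c : ℂ) (t : ℝ) => ((t ^ (w - 1) : ℝ) : ℂ) * (Complex.exp (-(c * t)) * -t))
      (x₀ := c) (s := Metric.ball c (c.re / 2))
      (bound := fun t => t ^ (w + 1 - 1) * Real.exp (-(c.re / 2 * t)))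
      (Metric.ball_mem_nhds _ (by linarith)) ?_ (integrableOn_rpow_mul_cexp_neg hw hc) ?_ ?_
      (integrableOn_rpow_mul_exp_neg_mul (by linarith) (by linarith)) ?_
    · exact key.2.differentiableAt.differentiableWithinAt
    · refine Eventually.of_forall fun z => ?_
      exact ((continuousOn_ofReal_rpow _).mul (by fun_prop)).aestronglyMeasurable
        measurableSet_Ioi
    · exact ((continuousOn_ofReal_rpow _).mul (by fun_prop)).aestronglyMeasurable
        measurableSet_Ioi
    · filter_upwards [ae_restrict_mem measurableSet_Ioi] with t ht z hz
      have ht : 0 < t := ht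
      have hre : c.re / 2 ≤ z.re := by
        have h1 := Complex.abs_re_le_norm (z - c)
        rw [Metric.mem_ball, dist_eq_norm] at hz
        have := (abs_le.1 h1).1
        rw [Complex.sub_re] at this
        linarith
      rw [← mul_assoc, norm_mul, norm_rpow_mul_cexp_neg ht, norm_neg, Complex.norm_real,
        Real.norm_of_nonneg ht.le, add_sub_cancel_right]
      have : t ^ w = t ^ (w - 1) * t := by
        rw [Real.rpow_sub_one ht.ne']; field_simp
      rw [this, mul_right_comm]
      gcongr
    · filter_upwards with t z _
      have : HasDerivAt (fun c : ℂ => -(c * (t : ℂ))) (-(t : ℂ)) z := by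
        simpa using (hasDerivAt_id z).mul_const (t : ℂ) |>.fun_neg
      exact this.cexp.const_mul _
  have hd2 : DifferentiableOn ℂ (fun c : ℂ => (Real.Gamma w : ℂ) * c ^ (-(w : ℂ))) U := by
    intro c (hc : 0 < c.re)
    refine DifferentiableAt.differentiableWithinAt ?_
    exact ((differentiableAt_id).cpow_const (Or.inl hc)).const_mul _
  have hpre : IsPreconnected U := (convex_halfSpace_re_gt 0).isPreconnected
  refine (hd.analyticOnNhd hUo).eqOn_of_preconnected_of_frequently_eq (hd2.analyticOnNhd hUo) hpre
    (z₀ := 1) (by simp [U]) ?_ hc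
  have htend : Tendsto (fun n : ℕ => ((1 + 1 / ((n : ℝ) + 1) : ℝ) : ℂ)) atTop
      (nhdsWithin 1 {1}ᶜ) := by
    refine tendsto_nhdsWithin_iff.2 ⟨?_, Eventually.of_forall fun n => ?_⟩
    · have := (tendsto_one_div_add_atTop_nhds_zero_nat (𝕜 := ℝ)).const_add 1
      simpa [Function.comp_def] using (Complex.continuous_ofReal.tendsto _).comp this
    · have : (0 : ℝ) < 1 / ((n : ℝ) + 1) := by positivity
      simp only [Set.mem_compl_iff, Set.mem_singleton_iff]
      intro h
      have h := Complex.ofReal_eq_one.1 h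
      linarith
  refine htend.frequently (Eventually.of_forall fun n => ?_).frequently
  have hr : (0 : ℝ) < 1 + 1 / ((n : ℝ) + 1) := by positivity
  generalize 1 + 1 / ((n : ℝ) + 1) = r at hr
  have h := Real.integral_rpow_mul_exp_neg_mul_Ioi hw hr
  have h2 := congrArg (fun x : ℝ => (x : ℂ)) h
  rw [← integral_complex_ofReal] at h2
  calc _ = ∫ t : ℝ in Set.Ioi 0, ((t ^ (w - 1) * Real.exp (-(r * t)) : ℝ) : ℂ) := by
        simp
    _ = _ := by
        rw [h2, one_div, Real.inv_rpow hr.le, ← Real.rpow_neg hr.le]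
        push_cast [Complex.ofReal_cpow hr.le]
        ring

theorem integral_rpow_mul_cexp_neg_polar {w r ψ : ℝ} (hw : 0 < w) (hr : 0 < r)
    (hψ : |ψ| < π / 2) :
    ∫ t : ℝ in Set.Ioi 0,
        ((t ^ (w - 1) : ℝ) : ℂ) * Complex.exp (-(r * Complex.exp (ψ * Complex.I) * t)) =
      ((Real.Gamma w * r ^ (-w) : ℝ) : ℂ) * Complex.exp (-(w * ψ) * Complex.I) := by
  obtain ⟨h1, h2⟩ := abs_lt.1 hψ
  have hc : 0 < ((r : ℂ) * Complex.exp (ψ * Complex.I)).re := by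
    rw [Complex.re_ofReal_mul, Complex.exp_ofReal_mul_I_re]
    exact mul_pos hr (Real.cos_pos_of_mem_Ioo ⟨by linarith, h2⟩)
  rw [integral_rpow_mul_cexp_neg hw hc]
  have hpol : (r : ℂ) * Complex.exp (ψ * Complex.I) =
      Complex.exp ((Real.log r : ℝ) + ψ * Complex.I) := by
    rw [Complex.exp_add, ← Complex.ofReal_exp, Real.exp_log hr]
  have hlog : Complex.log (Complex.exp ((Real.log r : ℝ) + ψ * Complex.I)) =
      (Real.log r : ℝ) + ψ * Complex.I :=
    Complex.log_exp (by simp; linarith [Real.pi_pos]) (by simp; linarith [Real.pi_pos])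
  rw [hpol, Complex.cpow_def_of_ne_zero (Complex.exp_ne_zero _), hlog,
    Real.rpow_def_of_pos hr]
  push_cast
  rw [mul_assoc, ← Complex.exp_add]
  congr 2
  ring

/-- The pullback of `exp (σ - x σ^β) σ^(β-1) dσ` to the ray `σ = t e^{iθ}`, `t > 0`. -/
noncomputable def mWrightRay (β x θ t : ℝ) : ℂ :=
  ((t ^ (β - 1) : ℝ) : ℂ) * Complex.exp (t * Complex.exp (θ * Complex.I) -
    x * (t ^ β : ℝ) * Complex.exp (β * θ * Complex.I) + β * θ * Complex.I)

theorem norm_mWrightRay (β x θ : ℝ) {t : ℝ} (ht : 0 < t) :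
    ‖mWrightRay β x θ t‖ =
      t ^ (β - 1) * Real.exp (t * Real.cos θ - x * t ^ β * Real.cos (β * θ)) := by
  rw [mWrightRay, norm_mul, Complex.norm_real, Complex.norm_exp,
    Real.norm_of_nonneg (by positivity)]
  congr 2
  rw [Complex.add_re, Complex.sub_re, Complex.re_ofReal_mul, ← Complex.ofReal_mul,
    Complex.re_ofReal_mul, ← Complex.ofReal_mul, Complex.exp_ofReal_mul_I_re,
    Complex.exp_ofReal_mul_I_re]
  simp

theorem continuousOn_mWrightRay {β : ℝ} (hβ : 0 < β) (x θ : ℝ) :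
    ContinuousOn (mWrightRay β x θ) (Set.Ioi 0) := by
  have h : Continuous fun t : ℝ => ((t ^ β : ℝ) : ℂ) :=
    Complex.continuous_ofReal.comp (Real.continuous_rpow_const hβ.le)
  exact (continuousOn_ofReal_rpow _).mul (by fun_prop)

theorem exists_mul_rpow_le {β : ℝ} (hβ : β ∈ Set.Ioo (0 : ℝ) 1) {y ε : ℝ} (hy : 0 ≤ y)
    (hε : 0 < ε) : ∃ K : ℝ, ∀ t : ℝ, 0 < t → y * t ^ β ≤ ε * t + K := by
  have hlim : Tendsto (fun T : ℝ => y * T ^ (-(1 - β))) atTop (nhds (y * 0)) :=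
    (tendsto_rpow_neg_atTop (by linarith [hβ.2])).const_mul y
  rw [mul_zero] at hlim
  obtain ⟨T, hT, hT0⟩ := ((hlim.eventually (gt_mem_nhds hε)).and (eventually_gt_atTop 0)).exists
  refine ⟨y * T ^ β, fun t ht => ?_⟩
  rcases le_total t T with h | h
  · have : t ^ β ≤ T ^ β := Real.rpow_le_rpow ht.le h hβ.1.le
    have := mul_le_mul_of_nonneg_left this hy
    nlinarith [mul_pos hε ht]
  · have h1 : t ^ (-(1 - β)) ≤ T ^ (-(1 - β)) :=
      Real.rpow_le_rpow_of_nonpos hT0 h (by linarith [hβ.2])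
    have h2 : t ^ β = t ^ (-(1 - β)) * t := by
      rw [← Real.rpow_add_one ht.ne']; congr 1; ring
    have h3 : y * t ^ (-(1 - β)) ≤ ε := (mul_le_mul_of_nonneg_left h1 hy).trans hT.le
    have h4 : 0 ≤ y * T ^ β := by positivity
    rw [h2, ← mul_assoc]
    nlinarith [mul_le_mul_of_nonneg_right h3 ht.le]

theorem integrableOn_rpow_mul_exp_add_rpow {β : ℝ} (hβ : β ∈ Set.Ioo (0 : ℝ) 1) {y c : ℝ}
    (hy : 0 ≤ y) (hc : 0 < c) :
    IntegrableOn (fun t : ℝ => t ^ (β - 1) * Real.exp (-(c * t) + y * t ^ β)) (Set.Ioi 0) := by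
  obtain ⟨K, hK⟩ := exists_mul_rpow_le hβ hy (half_pos hc)
  refine ((integrableOn_rpow_mul_exp_neg_mul hβ.1 (half_pos hc)).mul_const (Real.exp K)).mono' ?_ ?_
  · refine ContinuousOn.aestronglyMeasurable ?_ measurableSet_Ioi
    have h : Continuous fun t : ℝ => t ^ β := Real.continuous_rpow_const hβ.1.le
    refine ContinuousOn.mul (fun t ht => ?_) (by fun_prop)
    exact (Real.continuousAt_rpow_const t _ (Or.inl (ne_of_gt ht))).continuousWithinAt
  · filter_upwards [ae_restrict_mem measurableSet_Ioi] with t ht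
    have ht : 0 < t := ht
    rw [Real.norm_of_nonneg (by positivity), mul_assoc, ← Real.exp_add]
    have := hK t ht
    refine mul_le_mul_of_nonneg_left (Real.exp_le_exp.2 ?_) (by positivity)
    linarith

theorem norm_mWrightRay_le (β x θ : ℝ) {t : ℝ} (ht : 0 < t) :
    ‖mWrightRay β x θ t‖ ≤ t ^ (β - 1) * Real.exp (-(-Real.cos θ * t) + |x| * t ^ β) := by
  rw [norm_mWrightRay β x θ ht]
  have h : 0 ≤ t ^ β := by positivity
  have h2 : -(x * Real.cos (β * θ)) ≤ |x| := by
    refine (neg_le_abs _).trans ?_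
    rw [abs_mul]
    exact mul_le_of_le_one_right (abs_nonneg _) (Real.abs_cos_le_one _)
  gcongr
  nlinarith [mul_le_mul_of_nonneg_right h2 h]

theorem integrableOn_mWrightRay {β : ℝ} (hβ : β ∈ Set.Ioo (0 : ℝ) 1) (x : ℝ) {θ : ℝ}
    (hθ : Real.cos θ < 0) : IntegrableOn (mWrightRay β x θ) (Set.Ioi 0) := by
  refine (integrableOn_rpow_mul_exp_add_rpow hβ (abs_nonneg x) (neg_pos.2 hθ)).mono'
    ((continuousOn_mWrightRay hβ.1 x θ).aestronglyMeasurable measurableSet_Ioi) ?_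
  filter_upwards [ae_restrict_mem measurableSet_Ioi] with t ht
  exact norm_mWrightRay_le β x θ ht

/-- Euler's reflection formula in the form `Γ(w) sin(πw) = π / Γ(1 - w)`, valid for all `w > 0`. -/
theorem Gamma_mul_sin_eq {w : ℝ} (hw : 0 < w) :
    Real.Gamma w * Real.sin (π * w) = π / Real.Gamma (1 - w) := by
  have h := Real.Gamma_mul_Gamma_one_sub w
  have hw' := Real.Gamma_pos_of_pos hw
  by_cases hs : Real.sin (π * w) = 0
  · rw [hs, div_zero] at h
    have : Real.Gamma (1 - w) = 0 := by simpa [hw'.ne'] using h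
    simp [hs, this]
  · have hne : Real.Gamma (1 - w) ≠ 0 := by
      intro h0
      rw [h0, mul_zero, eq_comm, div_eq_zero_iff] at h
      exact h.elim Real.pi_ne_zero hs
    rw [eq_div_iff hs] at h
    rw [eq_div_iff hne]
    linarith

theorem im_integral_mWrightRay {β : ℝ} (hβ : β ∈ Set.Ioo (0 : ℝ) 1) (x : ℝ) {θ : ℝ}
    (hθ : θ ∈ Set.Ioo (π / 2) π) :
    (∫ t : ℝ in Set.Ioi 0, mWrightRay β x θ t).im = π * mWright β x := by
  have hcos : Real.cos θ < 0 :=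
    Real.cos_neg_of_pi_div_two_lt_of_lt hθ.1 (by linarith [hθ.2, Real.pi_pos])
  let A : ℕ → ℂ := fun n =>
    (((-x) ^ n / n.factorial : ℝ) : ℂ) * Complex.exp (β * (n + 1) * θ * Complex.I)
  let E : ℝ → ℂ := fun t => Complex.exp (-((1 : ℝ) * Complex.exp ((θ - π : ℝ) * Complex.I) * t))
  have hexp : Complex.exp ((θ - π : ℝ) * Complex.I) = -Complex.exp (θ * Complex.I) := by
    push_cast
    rw [sub_mul, Complex.exp_sub, Complex.exp_pi_mul_I, div_neg, div_one]
  have hEnorm : ∀ t : ℝ, ‖E t‖ = Real.exp (-(-Real.cos θ * t)) := by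
    intro t
    simp only [E]
    rw [hexp, Complex.norm_exp]
    congr 1
    have : -(((1 : ℝ) : ℂ) * -Complex.exp (θ * Complex.I) * t) =
      t * Complex.exp (θ * Complex.I) := by push_cast; ring
    rw [this, Complex.re_ofReal_mul, Complex.exp_ofReal_mul_I_re]
    ring
  have hrp : ∀ (n : ℕ) (t : ℝ), 0 < t → t ^ (β * (n + 1) - 1) = t ^ (β - 1) * (t ^ β) ^ n := by
    intro n t ht
    rw [← Real.rpow_natCast, ← Real.rpow_mul ht.le, ← Real.rpow_add ht]
    congr 1
    ring
  have hsum := hasSum_integral_of_dominated_convergence (μ := volume.restrict (Set.Ioi 0))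
    (F := fun (n : ℕ) (t : ℝ) => A n * (((t ^ (β * (n + 1) - 1) : ℝ) : ℂ) * E t))
    (f := mWrightRay β x θ)
    (fun n t => t ^ (β - 1) * Real.exp (-(-Real.cos θ * t)) * ((|x| * t ^ β) ^ n / n.factorial))
    ?_ ?_ ?_ ?_ ?_
  · have hInt : ∀ n : ℕ,
        (∫ t : ℝ in Set.Ioi 0, A n * (((t ^ (β * (n + 1) - 1) : ℝ) : ℂ) * E t)).im =
        π * ((-x) ^ n / ((n.factorial : ℝ) * Real.Gamma (1 - β * (n + 1)))) := by
      intro n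
      have hw : 0 < β * ((n : ℝ) + 1) := mul_pos hβ.1 (by positivity)
      have h1 : |θ - π| < π / 2 := by
        rw [abs_lt]; constructor <;> linarith [hθ.1, hθ.2, Real.pi_pos]
      rw [integral_const_mul, integral_rpow_mul_cexp_neg_polar hw one_pos h1]
      have : A n * (((Real.Gamma (β * (n + 1)) * 1 ^ (-(β * ((n : ℝ) + 1))) : ℝ) : ℂ) *
          Complex.exp (-(((β * (n + 1) : ℝ) : ℂ) * ((θ - π : ℝ) : ℂ)) * Complex.I)) =
          (((-x) ^ n / n.factorial * Real.Gamma (β * (n + 1)) : ℝ) : ℂ) *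
            Complex.exp ((π * (β * (n + 1)) : ℝ) * Complex.I) := by
        simp only [A, Real.one_rpow, mul_one]
        rw [mul_mul_mul_comm, ← Complex.exp_add, ← Complex.ofReal_mul]
        congr 2
        push_cast
        ring
      rw [this, Complex.im_ofReal_mul, Complex.exp_ofReal_mul_I_im, mul_assoc,
        Gamma_mul_sin_eq hw]
      ring
    have h2 := Complex.hasSum_im hsum
    simp only [hInt] at h2
    rw [← h2.tsum_eq, tsum_mul_left, mWright]
  · intro n
    refine AEStronglyMeasurable.const_mul ?_ _
    exact ((continuousOn_ofReal_rpow _).mul (by fun_prop)).aestronglyMeasurable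
      measurableSet_Ioi
  · intro n
    filter_upwards [ae_restrict_mem measurableSet_Ioi] with t ht
    have ht : 0 < t := ht
    have hA : ‖A n‖ = |x| ^ n / n.factorial := by
      simp only [A]
      rw [norm_mul, Complex.norm_real]
      have : (β * (n + 1) * θ * Complex.I : ℂ) = ((β * (n + 1) * θ : ℝ) : ℂ) * Complex.I := by
        push_cast; ring
      rw [this, Complex.norm_exp_ofReal_mul_I, mul_one, norm_div, norm_pow, norm_neg,
        Real.norm_eq_abs, Real.norm_natCast]
    have key : ∀ z : ℂ, ‖A n * z‖ = |x| ^ n / n.factorial * ‖z‖ := fun z => by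
      rw [norm_mul, hA]
    refine (key _).trans_le ?_
    rw [norm_mul, hEnorm, Complex.norm_real, Real.norm_of_nonneg (by positivity),
      hrp n t ht, mul_pow]
    apply le_of_eq
    ring
  · filter_upwards with t
    exact (Real.summable_pow_div_factorial _).mul_left _
  · refine (integrableOn_rpow_mul_exp_add_rpow hβ (abs_nonneg x) (neg_pos.2 hcos)).congr ?_
    filter_upwards with t
    rw [tsum_mul_left, Real.exp_add, ← mul_assoc]
    congr 1
    rw [Real.exp_eq_exp_ℝ, NormedSpace.exp_eq_tsum_div]
  · filter_upwards [ae_restrict_mem measurableSet_Ioi] with t ht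
    have ht : 0 < t := ht
    have h1 := NormedSpace.expSeries_div_hasSum_exp
      (-(x : ℂ) * (t ^ β : ℝ) * Complex.exp (β * θ * Complex.I))
    rw [← Complex.exp_eq_exp_ℂ] at h1
    have h2 := h1.mul_left (((t ^ (β - 1) : ℝ) : ℂ) *
      Complex.exp (t * Complex.exp (θ * Complex.I)) * Complex.exp (β * θ * Complex.I))
    have hval : mWrightRay β x θ t = ((t ^ (β - 1) : ℝ) : ℂ) *
        Complex.exp (t * Complex.exp (θ * Complex.I)) * Complex.exp (β * θ * Complex.I) *
        Complex.exp (-(x : ℂ) * (t ^ β : ℝ) * Complex.exp (β * θ * Complex.I)) := by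
      simp only [mWrightRay]
      simp only [sub_eq_add_neg, Complex.exp_add, neg_mul]
      ring
    rw [hval]
    refine h2.congr_fun fun n => ?_
    · simp only [A, E]
      rw [hexp, hrp n t ht, mul_pow, mul_pow, ← Complex.exp_nat_mul]
      have e1 : Complex.exp (β * (n + 1) * θ * Complex.I) =
          Complex.exp (β * θ * Complex.I) * Complex.exp (n * (β * θ * Complex.I)) := by
        rw [← Complex.exp_add]; congr 1; ring
      have e2 : -(((1 : ℝ) : ℂ) * -Complex.exp (θ * Complex.I) * t) =
        t * Complex.exp (θ * Complex.I) := by push_cast; ring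
      rw [e1, e2]
      push_cast
      ring

/-- A primitive, in the logarithmic coordinate `w = log σ`, of `exp (σ - x σ^β) σ^(β-1) dσ`;
the integration variable is `v = u^β`, where `u σ` runs through the segment from `0` to `σ`. -/
noncomputable def mWrightPrim (β x : ℝ) (w : ℂ) : ℂ :=
  Complex.exp (β * w) / β * ∫ v : ℝ in (0 : ℝ)..1,
    Complex.exp ((v ^ (1 / β) : ℝ) * Complex.exp w - x * v * Complex.exp (β * w))

theorem hasDerivAt_mWrightPrim {β : ℝ} (hβ : 0 < β) (x : ℝ) (w : ℂ) :
    HasDerivAt (mWrightPrim β x)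
      (Complex.exp (Complex.exp w - x * Complex.exp (β * w) + β * w)) w := by
  have hβ' : (β : ℂ) ≠ 0 := by exact_mod_cast hβ.ne'
  have hrp : Continuous fun v : ℝ => ((v ^ (1 / β) : ℝ) : ℂ) :=
    Complex.continuous_ofReal.comp (Real.continuous_rpow_const (by positivity))
  let E : ℂ → ℝ → ℂ := fun w v =>
    Complex.exp ((v ^ (1 / β) : ℝ) * Complex.exp w - x * v * Complex.exp (β * w))
  let E' : ℂ → ℝ → ℂ := fun w v => E w v *
    ((v ^ (1 / β) : ℝ) * Complex.exp w - x * v * (Complex.exp (β * w) * β))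
  have hEc : ∀ w, Continuous (E w) := fun w => by fun_prop
  have hEc' : ∀ w, Continuous (E' w) := fun w => by fun_prop
  have hrp2 : Continuous fun p : ℂ × ℝ => ((p.2 ^ (1 / β) : ℝ) : ℂ) := hrp.comp continuous_snd
  have hjoint : Continuous fun p : ℂ × ℝ => E' p.1 p.2 := by fun_prop
  obtain ⟨C, hC⟩ := ((isCompact_closedBall w 1).prod (isCompact_Icc (a := (0 : ℝ))
    (b := 1))).exists_bound_of_continuousOn hjoint.continuousOn
  have hder := (intervalIntegral.hasDerivAt_integral_of_dominated_loc_of_deriv_le (μ := volume)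
    (a := 0) (b := 1) (F := E) (F' := E') (x₀ := w) (s := Metric.ball w 1) (bound := fun _ => C)
    (Metric.ball_mem_nhds _ one_pos)
    (Eventually.of_forall fun z => (hEc z).aestronglyMeasurable)
    ((hEc w).intervalIntegrable _ _) (hEc' w).aestronglyMeasurable ?_ (by simp) ?_).2
  · have hexp : HasDerivAt (fun w : ℂ => Complex.exp (β * w) / β) (Complex.exp (β * w)) w := by
      have h := ((((hasDerivAt_id w).const_mul (β : ℂ))).cexp).div_const (β : ℂ)
      simpa [hβ'] using h
    have hprod := hexp.mul hder
    have hparts : ∫ v : ℝ in (0 : ℝ)..1, (E w v + E w v *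
        ((1 / β : ℝ) * (v ^ (1 / β) : ℝ) * Complex.exp w - x * v * Complex.exp (β * w))) = E w 1 := by
      have h := intervalIntegral.integral_eq_sub_of_hasDerivAt_of_le (a := 0) (b := 1) zero_le_one
        (f := fun v : ℝ => (v : ℂ) * E w v) (f' := fun v => E w v + E w v *
        ((1 / β : ℝ) * (v ^ (1 / β) : ℝ) * Complex.exp w - x * v * Complex.exp (β * w)))
        (by fun_prop) ?_ (Continuous.intervalIntegrable (by fun_prop) _ _)
      · simpa using h
      · intro v hv
        have hv0 : v ≠ 0 := hv.1.ne'
        have h1 : HasDerivAt (fun v : ℝ => ((v ^ (1 / β) : ℝ) : ℂ))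
            ((1 / β * v ^ (1 / β - 1) : ℝ) : ℂ) v :=
          (Real.hasDerivAt_rpow_const (Or.inl hv0)).ofReal_comp
        have h2 : HasDerivAt (fun v : ℝ => (v : ℂ)) 1 v := (hasDerivAt_id v).ofReal_comp
        have h3 := h2.mul (((h1.mul_const (Complex.exp w)).sub
          ((h2.const_mul (x : ℂ)).mul_const (Complex.exp (β * w)))).cexp)
        refine h3.congr_deriv ?_
        have h4 : v ^ (1 / β) = v ^ (1 / β - 1) * v := by
          rw [← Real.rpow_add_one hv0]; congr 1; ring
        simp only [E, h4, Pi.sub_apply]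
        push_cast
        ring
    refine hprod.congr_deriv ?_
    have hI : ∀ f : ℝ → ℂ, Continuous f → IntervalIntegrable f volume 0 1 :=
      fun f hf => hf.intervalIntegrable _ _
    have hcomb : (∫ v : ℝ in (0 : ℝ)..1, E w v) + (∫ v : ℝ in (0 : ℝ)..1, E' w v) / β = E w 1 := by
      rw [← hparts, div_eq_mul_inv, ← intervalIntegral.integral_mul_const,
        ← intervalIntegral.integral_add (hI _ (hEc w)) (hI _ (by fun_prop))]
      congr 1
      ext v
      simp only [E']
      push_cast
      field_simp
    have hE1 : Complex.exp (Complex.exp w - x * Complex.exp (β * w) + β * w) =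
        Complex.exp (β * w) * E w 1 := by
      rw [Complex.exp_add]
      simp [E, mul_comm]
    rw [hE1, ← hcomb]
    ring
  · refine Eventually.of_forall fun v hv z hz => hC (z, v) ⟨Metric.ball_subset_closedBall hz, ?_⟩
    rw [Set.uIoc_of_le zero_le_one] at hv
    exact ⟨hv.1.le, hv.2⟩
  · refine Eventually.of_forall fun v hv z hz => ?_
    have h1 : HasDerivAt (fun z : ℂ => Complex.exp (β * z)) (Complex.exp (β * z) * β) z := by
      simpa using ((hasDerivAt_id z).const_mul (β : ℂ)).cexp
    exact (((Complex.hasDerivAt_exp z).const_mul _).sub (h1.const_mul _)).cexp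

theorem mWrightPrim_ofReal_im (β x u : ℝ) : (mWrightPrim β x u).im = 0 := by
  have h : mWrightPrim β x u = ((Real.exp (β * u) / β * ∫ v : ℝ in (0 : ℝ)..1,
      Real.exp (v ^ (1 / β) * Real.exp u - x * v * Real.exp (β * u)) : ℝ) : ℂ) := by
    rw [mWrightPrim]
    push_cast [← intervalIntegral.integral_ofReal]
    rfl
  rw [h, Complex.ofReal_im]

theorem norm_mWrightPrim_le {β : ℝ} (hβ : 0 < β) (x θ : ℝ) {t : ℝ} (ht : 0 < t) :
    ‖mWrightPrim β x (Real.log t + θ * Complex.I)‖ ≤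
      t ^ β / β * Real.exp (t + |x| * t ^ β) := by
  have h1 : ‖Complex.exp (β * (Real.log t + θ * Complex.I))‖ = t ^ β := by
    rw [Complex.norm_exp, Real.rpow_def_of_pos ht]
    congr 1
    simp [mul_comm]
  have h2 : ‖Complex.exp (Real.log t + θ * Complex.I)‖ = t := by
    rw [Complex.norm_exp]
    simp [Real.exp_log ht]
  rw [mWrightPrim, norm_mul, norm_div, h1, Complex.norm_real, Real.norm_of_nonneg hβ.le]
  gcongr
  have := intervalIntegral.norm_integral_le_of_norm_le_const (a := 0) (b := 1)
    (C := Real.exp (t + |x| * t ^ β)) (f := fun v : ℝ =>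
      Complex.exp ((v ^ (1 / β) : ℝ) * Complex.exp (Real.log t + θ * Complex.I) -
      x * v * Complex.exp (β * (Real.log t + θ * Complex.I)))) ?_
  · simpa using this
  · intro v hv
    rw [Set.uIoc_of_le zero_le_one] at hv
    refine (Complex.norm_exp_le_exp_norm _).trans (Real.exp_le_exp.2 ?_)
    refine (norm_sub_le _ _).trans ?_
    rw [norm_mul, norm_mul, norm_mul, h1, h2, Complex.norm_real, Complex.norm_real,
      Complex.norm_real, Real.norm_eq_abs x, Real.norm_of_nonneg hv.1.le,
      Real.norm_of_nonneg (by have := hv.1; positivity)]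
    have h3 : v ^ (1 / β) ≤ 1 := Real.rpow_le_one hv.1.le hv.2 (by positivity)
    have h4 : |x| * v ≤ |x| := mul_le_of_le_one_right (abs_nonneg _) hv.2
    have h5 : v ^ (1 / β) * t ≤ t := mul_le_of_le_one_left ht.le h3
    gcongr

theorem hasDerivAt_mWrightPrim_ray {β : ℝ} (hβ : 0 < β) (x θ : ℝ) {t : ℝ} (ht : 0 < t) :
    HasDerivAt (fun t : ℝ => mWrightPrim β x (Real.log t + θ * Complex.I))
      (mWrightRay β x θ t) t := by
  have h1 : HasDerivAt (fun t : ℝ => (Real.log t : ℂ) + θ * Complex.I) ((t⁻¹ : ℝ) : ℂ) t :=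
    ((Real.hasDerivAt_log ht.ne').ofReal_comp).add_const _
  refine ((hasDerivAt_mWrightPrim hβ x _).comp t h1).congr_deriv ?_
  have e1 : Complex.exp (Real.log t + θ * Complex.I) = t * Complex.exp (θ * Complex.I) := by
    rw [Complex.exp_add, ← Complex.ofReal_exp, Real.exp_log ht]
  have e2 : Complex.exp (β * Real.log t) = (t ^ β : ℝ) := by
    rw [Real.rpow_def_of_pos ht]; push_cast; rw [mul_comm]
  have e3 : Complex.exp (β * (Real.log t + θ * Complex.I)) =
      (t ^ β : ℝ) * Complex.exp (β * θ * Complex.I) := by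
    rw [mul_add, Complex.exp_add, e2, mul_assoc]
  have e4 : ((t ^ (β - 1) : ℝ) : ℂ) = (t ^ β : ℝ) * ((t⁻¹ : ℝ) : ℂ) := by
    rw [Real.rpow_sub_one ht.ne', div_eq_mul_inv, Complex.ofReal_mul]
  rw [mWrightRay, Complex.exp_add (_ - _), Complex.exp_add (_ - _), e3, e1, e4, mul_assoc (x : ℂ)]
  ring

theorem mWrightPrim_add_integral_Ioi {β : ℝ} (hβ : β ∈ Set.Ioo (0 : ℝ) 1) (x : ℝ) {θ : ℝ}
    (hθ : Real.cos θ < 0) {r : ℝ} (hr : 0 < r) :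
    mWrightPrim β x (Real.log r + θ * Complex.I) + ∫ t : ℝ in Set.Ioi r, mWrightRay β x θ t =
      ∫ t : ℝ in Set.Ioi 0, mWrightRay β x θ t := by
  have hInt := integrableOn_mWrightRay hβ x hθ
  have hsub : Set.Ioc 0 r ⊆ Set.Ioi 0 := fun t ht => ht.1
  have hlim : Tendsto (fun t : ℝ => mWrightPrim β x (Real.log t + θ * Complex.I))
      (nhdsWithin 0 (Set.Ioi 0)) (nhds 0) := by
    have hc : Continuous fun t : ℝ => t ^ β := Real.continuous_rpow_const hβ.1.le
    have hc2 : Continuous fun t : ℝ => t ^ β / β * Real.exp (t + |x| * t ^ β) := by fun_prop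
    have h0 : Tendsto (fun t : ℝ => t ^ β / β * Real.exp (t + |x| * t ^ β))
        (nhdsWithin 0 (Set.Ioi 0)) (nhds 0) := by
      have := (hc2.tendsto 0).mono_left (nhdsWithin_le_nhds (s := Set.Ioi 0))
      simpa [Real.zero_rpow hβ.1.ne'] using this
    refine squeeze_zero_norm' ?_ h0
    filter_upwards [self_mem_nhdsWithin] with t ht
    exact norm_mWrightPrim_le hβ.1 x θ ht
  have h := intervalIntegral.integral_eq_sub_of_hasDerivAt_of_tendsto hr
    (fun t ht => hasDerivAt_mWrightPrim_ray hβ.1 x θ ht.1)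
    ((intervalIntegrable_iff_integrableOn_Ioc_of_le hr.le).2 (hInt.mono_set hsub)) hlim
    ((hasDerivAt_mWrightPrim_ray hβ.1 x θ hr).continuousAt.tendsto.mono_left nhdsWithin_le_nhds)
  rw [sub_zero, intervalIntegral.integral_of_le hr.le] at h
  rw [← h, ← setIntegral_union (Set.Ioc_disjoint_Ioi le_rfl) measurableSet_Ioi
    (hInt.mono_set hsub) (hInt.mono_set (Set.Ioi_subset_Ioi hr.le)),
    Set.Ioc_union_Ioi_eq_Ioi hr.le]

theorem tendsto_integral_Ioi_atTop_zero {f : ℝ → ℝ} {a : ℝ} (hf : IntegrableOn f (Set.Ioi a)) :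
    Tendsto (fun r => ∫ t in Set.Ioi r, f t) atTop (nhds 0) := by
  have h1 := (intervalIntegral_tendsto_integral_Ioi a hf tendsto_id).const_sub
    (∫ t in Set.Ioi a, f t)
  rw [sub_self] at h1
  refine h1.congr' ?_
  filter_upwards [eventually_ge_atTop a] with r hr
  rw [id, intervalIntegral.integral_of_le hr, ← Set.Ioc_union_Ioi_eq_Ioi hr,
    setIntegral_union (Set.Ioc_disjoint_Ioi le_rfl) measurableSet_Ioi
    (hf.mono_set fun t ht => ht.1) (hf.mono_set (Set.Ioi_subset_Ioi hr)), add_sub_cancel_left]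

theorem sinc_pos_of_mem_Ico {φ : ℝ} (hφ : φ ∈ Set.Ico 0 π) : 0 < Real.sinc φ := by
  rcases hφ.1.eq_or_lt with h | h
  · rw [← h, Real.sinc_zero]; exact one_pos
  · rw [Real.sinc_of_ne_zero h.ne']
    exact div_pos (Real.sin_pos_of_pos_of_lt_pi h hφ.2) h

/-- The logarithm of the modulus, as a function of the argument `φ`, along the steepest descent
curve `Im (σ - x σ^β) = 0` through the saddle point of `σ - x σ^β`. -/
noncomputable def logDescentRadius (β x φ : ℝ) : ℝ :=
  (Real.log (x * β) + Real.log (Real.sinc (β * φ)) - Real.log (Real.sinc φ)) / (1 - β)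

section DescentCurve

variable {β x : ℝ}

theorem mul_mem_Ico_pi (hβ : β ∈ Set.Ioo (0 : ℝ) 1) {φ : ℝ} (hφ : φ ∈ Set.Ico 0 π) :
    β * φ ∈ Set.Ico 0 π :=
  ⟨mul_nonneg hβ.1.le hφ.1, (mul_le_of_le_one_left hφ.1 hβ.2.le).trans_lt hφ.2⟩

theorem continuousOn_logDescentRadius (hβ : β ∈ Set.Ioo (0 : ℝ) 1) :
    ContinuousOn (logDescentRadius β x) (Set.Ico 0 π) := by
  refine ContinuousOn.div_const (ContinuousOn.sub (continuousOn_const.add ?_) ?_) _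
  · exact (Real.continuous_sinc.comp (continuous_const.mul continuous_id)).continuousOn.log
      fun φ hφ => (sinc_pos_of_mem_Ico (mul_mem_Ico_pi hβ hφ)).ne'
  · exact Real.continuous_sinc.continuousOn.log fun φ hφ => (sinc_pos_of_mem_Ico hφ).ne'

theorem logDescentRadius_eq (hβ : β ∈ Set.Ioo (0 : ℝ) 1) (hx : 0 < x) {φ : ℝ}
    (hφ : φ ∈ Set.Ioo 0 π) : logDescentRadius β x φ =
      (Real.log x + Real.log (Real.sin (β * φ)) - Real.log (Real.sin φ)) / (1 - β) := by
  have h0 : β * φ ≠ 0 := (mul_pos hβ.1 hφ.1).ne'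
  have h1 := mul_mem_Ico_pi hβ (Set.Ioo_subset_Ico_self hφ)
  have h2 := Real.sin_pos_of_pos_of_lt_pi (mul_pos hβ.1 hφ.1) h1.2
  have h3 := Real.sin_pos_of_pos_of_lt_pi hφ.1 hφ.2
  rw [logDescentRadius, Real.sinc_of_ne_zero h0, Real.sinc_of_ne_zero hφ.1.ne',
    Real.log_div h2.ne' h0, Real.log_div h3.ne' hφ.1.ne', Real.log_mul hβ.1.ne' hφ.1.ne',
    Real.log_mul hx.ne' hβ.1.ne']
  congr 1
  ring

theorem hasDerivAt_logDescentRadius (hβ : β ∈ Set.Ioo (0 : ℝ) 1) (hx : 0 < x) {φ : ℝ}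
    (hφ : φ ∈ Set.Ioo 0 π) : HasDerivAt (logDescentRadius β x)
      ((Real.cos (β * φ) * β / Real.sin (β * φ) - Real.cos φ / Real.sin φ) / (1 - β)) φ := by
  have h1 := mul_mem_Ico_pi hβ (Set.Ioo_subset_Ico_self hφ)
  have h2 := Real.sin_pos_of_pos_of_lt_pi (mul_pos hβ.1 hφ.1) h1.2
  have h3 := Real.sin_pos_of_pos_of_lt_pi hφ.1 hφ.2
  have h4 : HasDerivAt (fun φ => Real.sin (β * φ)) (Real.cos (β * φ) * β) φ := by
    simpa using ((hasDerivAt_id φ).const_mul β).sin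
  have h5 := (((h4.log h2.ne').const_add (Real.log x)).sub
    ((Real.hasDerivAt_sin φ).log h3.ne')).div_const (1 - β)
  refine h5.congr_of_eventuallyEq ?_
  filter_upwards [Ioo_mem_nhds hφ.1 hφ.2] with ψ hψ
  exact logDescentRadius_eq hβ hx hψ

theorem exp_logDescentRadius_mul_sin (hβ : β ∈ Set.Ioo (0 : ℝ) 1) (hx : 0 < x) {φ : ℝ}
    (hφ : φ ∈ Set.Ioo 0 π) : Real.exp (logDescentRadius β x φ) * Real.sin φ =
      x * Real.exp (β * logDescentRadius β x φ) * Real.sin (β * φ) := by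
  have h1 := mul_mem_Ico_pi hβ (Set.Ioo_subset_Ico_self hφ)
  have h2 := Real.sin_pos_of_pos_of_lt_pi (mul_pos hβ.1 hφ.1) h1.2
  have h3 := Real.sin_pos_of_pos_of_lt_pi hφ.1 hφ.2
  have h4 : logDescentRadius β x φ + Real.log (Real.sin φ) =
      Real.log x + β * logDescentRadius β x φ + Real.log (Real.sin (β * φ)) := by
    have h5 : (1 - β) ≠ 0 := by linarith [hβ.2]
    have := logDescentRadius_eq hβ hx hφ
    rw [eq_div_iff h5] at this
    linarith
  have := congrArg Real.exp h4
  rwa [Real.exp_add, Real.exp_add, Real.exp_add, Real.exp_log h2, Real.exp_log h3,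
    Real.exp_log hx] at this

theorem tendsto_logDescentRadius (hβ : β ∈ Set.Ioo (0 : ℝ) 1) (hx : 0 < x) :
    Tendsto (logDescentRadius β x) (nhdsWithin π (Set.Iio π)) atTop := by
  have hmem : Set.Ioo 0 π ∈ nhdsWithin π (Set.Iio π) := Ioo_mem_nhdsLT Real.pi_pos
  have hsin : Tendsto Real.sin (nhdsWithin π (Set.Iio π)) (nhdsWithin 0 (Set.Ioi 0)) := by
    refine tendsto_nhdsWithin_iff.2 ⟨?_, ?_⟩
    · have := (Real.continuous_sin.tendsto π).mono_left (nhdsWithin_le_nhds (s := Set.Iio π))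
      rwa [Real.sin_pi] at this
    · filter_upwards [hmem] with φ hφ
      exact Real.sin_pos_of_pos_of_lt_pi hφ.1 hφ.2
  have h1 : Tendsto (fun φ => -Real.log (Real.sin φ)) (nhdsWithin π (Set.Iio π)) atTop :=
    tendsto_neg_atBot_atTop.comp (Real.tendsto_log_nhdsGT_zero.comp hsin)
  have hpos : 0 < Real.sin (β * π) := Real.sin_pos_of_pos_of_lt_pi (mul_pos hβ.1 Real.pi_pos)
    (mul_lt_of_lt_one_left Real.pi_pos hβ.2)
  have h2 : Tendsto (fun φ => Real.log x + Real.log (Real.sin (β * φ)))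
      (nhdsWithin π (Set.Iio π)) (nhds (Real.log x + Real.log (Real.sin (β * π)))) := by
    have hc : ContinuousAt (fun φ => Real.log x + Real.log (Real.sin (β * φ))) π :=
      continuousAt_const.add (ContinuousAt.log (by fun_prop) hpos.ne')
    exact hc.tendsto.mono_left nhdsWithin_le_nhds
  refine ((h2.add_atTop h1).atTop_div_const (sub_pos.2 hβ.2)).congr' ?_
  filter_upwards [hmem] with φ hφ
  rw [logDescentRadius_eq hβ hx hφ, ← sub_eq_add_neg]

theorem im_mWrightPrim_descent_nonneg (hβ : β ∈ Set.Ioo (0 : ℝ) 1) (hx : 0 < x) {φ : ℝ}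
    (hφ : φ ∈ Set.Ico 0 π) :
    0 ≤ (mWrightPrim β x (logDescentRadius β x φ + φ * Complex.I)).im := by
  set L := logDescentRadius β x with hL
  let g : ℝ → ℝ := fun φ => (mWrightPrim β x (L φ + φ * Complex.I)).im
  have hder : ∀ φ ∈ Set.Ioo 0 π, ∃ d, 0 ≤ d ∧ HasDerivAt g d φ := by
    intro φ hφ
    have h1 := mul_mem_Ico_pi hβ (Set.Ioo_subset_Ico_self hφ)
    have h2 := Real.sin_pos_of_pos_of_lt_pi (mul_pos hβ.1 hφ.1) h1.2
    have h3 := Real.sin_pos_of_pos_of_lt_pi hφ.1 hφ.2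
    have hLd := hasDerivAt_logDescentRadius hβ hx hφ
    set L' := (Real.cos (β * φ) * β / Real.sin (β * φ) - Real.cos φ / Real.sin φ) / (1 - β)
      with hL'
    have hw : HasDerivAt (fun φ : ℝ => (L φ : ℂ) + φ * Complex.I) (L' + 1 * Complex.I) φ :=
      hLd.ofReal_comp.add ((hasDerivAt_id φ).ofReal_comp.mul_const _)
    have hG := ((hasDerivAt_mWrightPrim hβ.1 x _).comp φ hw)
    have him := (Complex.imCLM.hasFDerivAt.comp_hasDerivAt φ hG)
    refine ⟨_, ?_, him⟩
    have e1 : Complex.exp (L φ + φ * Complex.I) =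
        (Real.exp (L φ) : ℝ) * (Real.cos φ + Real.sin φ * Complex.I) := by
      rw [Complex.exp_add, Complex.exp_mul_I]; push_cast; rfl
    have e2 : Complex.exp (β * (L φ + φ * Complex.I)) =
        (Real.exp (β * L φ) : ℝ) * (Real.cos (β * φ) + Real.sin (β * φ) * Complex.I) := by
      rw [mul_add, Complex.exp_add, ← mul_assoc, Complex.exp_mul_I]; push_cast; rfl
    have e3 : Complex.exp (L φ + φ * Complex.I) - x * Complex.exp (β * (L φ + φ * Complex.I)) =
        ((Real.exp (L φ) * Real.cos φ - x * Real.exp (β * L φ) * Real.cos (β * φ) : ℝ) : ℂ) := by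
      have h := congrArg (fun x : ℝ => (x : ℂ)) (exp_logDescentRadius_mul_sin hβ hx hφ)
      rw [← hL] at h
      rw [e1, e2]
      push_cast at h ⊢
      linear_combination Complex.I * h
    rw [Complex.exp_add, e3, e2, ← Complex.ofReal_exp]
    have hE := Real.exp_pos (Real.exp (L φ) * Real.cos φ -
      x * Real.exp (β * L φ) * Real.cos (β * φ))
    generalize Real.exp (Real.exp (L φ) * Real.cos φ -
      x * Real.exp (β * L φ) * Real.cos (β * φ)) = E at hE ⊢
    have hval : Complex.imCLM ((E : ℂ) * ((Real.exp (β * L φ) : ℝ) *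
        (Real.cos (β * φ) + Real.sin (β * φ) * Complex.I)) * (L' + 1 * Complex.I)) =
        E * Real.exp (β * L φ) * (Real.cos (β * φ) + L' * Real.sin (β * φ)) := by
      rw [Complex.imCLM_apply, mul_assoc, mul_assoc, Complex.im_ofReal_mul,
        Complex.im_ofReal_mul]
      simp only [Complex.mul_im, Complex.add_im, Complex.add_re, Complex.mul_re,
        Complex.ofReal_re, Complex.ofReal_im, Complex.I_re, Complex.I_im, Complex.one_re,
        Complex.one_im]
      ring
    have hkey : Real.cos (β * φ) + L' * Real.sin (β * φ) =
        Real.sin (φ - β * φ) / ((1 - β) * Real.sin φ) := by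
      have h5 : (1 - β) ≠ 0 := by linarith [hβ.2]
      rw [hL', Real.sin_sub]
      field_simp
      ring
    rw [hval, hkey]
    have h6 : 0 ≤ Real.sin (φ - β * φ) := by
      refine Real.sin_nonneg_of_nonneg_of_le_pi ?_ ?_ <;> nlinarith [hφ.1, hφ.2, hβ.1, hβ.2]
    have h7 : 0 < 1 - β := by linarith [hβ.2]
    positivity
  have hcont : ContinuousOn g (Set.Ico 0 π) := by
    have hG : Continuous (mWrightPrim β x) := continuous_iff_continuousAt.2 fun w =>
      (hasDerivAt_mWrightPrim hβ.1 x w).continuousAt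
    refine Complex.continuous_im.comp_continuousOn (hG.comp_continuousOn ?_)
    exact (Complex.continuous_ofReal.comp_continuousOn (continuousOn_logDescentRadius hβ)).add
      (by fun_prop)
  have hmono : MonotoneOn g (Set.Ico 0 π) := by
    refine monotoneOn_of_deriv_nonneg (convex_Ico 0 π) hcont ?_ ?_
    · rw [interior_Ico]
      intro φ hφ
      obtain ⟨d, -, hd⟩ := hder φ hφ
      exact hd.differentiableAt.differentiableWithinAt
    · rw [interior_Ico]
      intro φ hφ
      obtain ⟨d, hd0, hd⟩ := hder φ hφ
      rwa [hd.deriv]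
  have h0 : g 0 = 0 := by
    simp only [g, Complex.ofReal_zero, zero_mul, add_zero]
    exact mWrightPrim_ofReal_im β x (L 0)
  have := hmono ⟨le_rfl, Real.pi_pos⟩ hφ hφ.1
  rwa [h0] at this

end DescentCurve

theorem mWright_nonneg {β x : ℝ} (hβ : β ∈ Set.Ioo (0 : ℝ) 1) (hx : 0 < x) :
    0 ≤ mWright β x := by
  have hD := integrableOn_rpow_mul_exp_add_rpow hβ (abs_nonneg x) (c := 1 / 2) (by norm_num)
  have htail := ((tendsto_integral_Ioi_atTop_zero hD).comp
    (Real.tendsto_exp_atTop.comp (tendsto_logDescentRadius hβ hx))).neg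
  rw [neg_zero] at htail
  have hle : 0 ≤ π * mWright β x := by
    refine le_of_tendsto htail ?_
    have hmem : Set.Ioo (2 * π / 3) π ∈ nhdsWithin π (Set.Iio π) :=
      Ioo_mem_nhdsLT (by linarith [Real.pi_pos])
    filter_upwards [hmem] with φ hφ
    have hφ0 : φ ∈ Set.Ioo (π / 2) π := ⟨by linarith [hφ.1, Real.pi_pos], hφ.2⟩
    have hcos : Real.cos φ ≤ -(1 / 2) := by
      have h := Real.cos_le_cos_of_nonneg_of_le_pi (x := 2 * π / 3) (by positivity) hφ.2.le hφ.1.le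
      have h2 : Real.cos (2 * π / 3) = -(1 / 2) := by
        rw [show 2 * π / 3 = π - π / 3 by ring, Real.cos_pi_sub, Real.cos_pi_div_three]
      rwa [h2] at h
    have hsplit := mWrightPrim_add_integral_Ioi hβ x (θ := φ) (by linarith)
      (Real.exp_pos (logDescentRadius β x φ))
    have him := im_integral_mWrightRay hβ x hφ0
    rw [← hsplit, Complex.add_im, Real.log_exp] at him
    have hpos := im_mWrightPrim_descent_nonneg hβ hx
      (φ := φ) ⟨by linarith [hφ0.1, Real.pi_pos], hφ.2⟩
    have hb : ‖∫ t : ℝ in Set.Ioi (Real.exp (logDescentRadius β x φ)), mWrightRay β x φ t‖ ≤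
        ∫ t : ℝ in Set.Ioi (Real.exp (logDescentRadius β x φ)),
          t ^ (β - 1) * Real.exp (-(1 / 2 * t) + |x| * t ^ β) := by
      refine norm_integral_le_of_norm_le
        (hD.mono_set (Set.Ioi_subset_Ioi (Real.exp_pos _).le)) ?_
      filter_upwards [ae_restrict_mem measurableSet_Ioi] with t ht
      have ht : 0 < t := (Real.exp_pos _).trans ht
      refine (norm_mWrightRay_le β x φ ht).trans ?_
      gcongr
      linarith
    have hn := (abs_le.1 (Complex.abs_im_le_norm
      (∫ t : ℝ in Set.Ioi (Real.exp (logDescentRadius β x φ)), mWrightRay β x φ t))).1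
    simp only [Function.comp_apply]
    linarith
  exact nonneg_of_mul_nonneg_right hle Real.pi_pos

theorem exists_mWrightRay_angle {β : ℝ} (hβ : β ∈ Set.Ioo (0 : ℝ) 1) :
    ∃ θ, θ ∈ Set.Ioo (π / 2) π ∧ β * θ ∈ Set.Ioo 0 (π / 2) := by
  have h1 : 0 < 1 + β := by linarith [hβ.1]
  refine ⟨π / (1 + β), ⟨?_, ?_⟩, ?_, ?_⟩
  · exact div_lt_div_of_pos_left Real.pi_pos h1 (by linarith [hβ.2])
  · exact div_lt_self Real.pi_pos (by linarith [hβ.1])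
  · exact mul_pos hβ.1 (by positivity)
  · rw [← mul_div_assoc, div_lt_div_iff₀ h1 two_pos]
    nlinarith [Real.pi_pos, hβ.2]

theorem exists_abs_mWright_le {β : ℝ} (hβ : β ∈ Set.Ioo (0 : ℝ) 1) :
    ∃ c C, 0 < c ∧ ∀ x > 0, |mWright β x| ≤ C * Real.exp (-c * x) := by
  obtain ⟨θ, hθ, hβθ⟩ := exists_mWrightRay_angle hβ
  have hθ0 : 0 < θ := by linarith [hθ.1, Real.pi_pos]
  have hcos : Real.cos θ < 0 :=
    Real.cos_neg_of_pi_div_two_lt_of_lt hθ.1 (by linarith [hθ.2, Real.pi_pos])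
  have hc : 0 < Real.cos (β * θ) :=
    Real.cos_pos_of_mem_Ioo ⟨by linarith [hβθ.1, Real.pi_pos], hβθ.2⟩
  have hDi : IntegrableOn (fun t : ℝ => t ^ (β - 1) * Real.exp (-(-Real.cos θ * t)))
      (Set.Ioi 1) := (integrableOn_rpow_mul_exp_neg_mul hβ.1 (neg_pos.2 hcos)).mono_set
        (Set.Ioi_subset_Ioi zero_le_one)
  set D := ∫ t : ℝ in Set.Ioi 1, t ^ (β - 1) * Real.exp (-(-Real.cos θ * t))
  set c := Real.cos (β * θ)
  refine ⟨c, (Real.exp 1 * θ + D) / π, hc, fun x hx => ?_⟩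
  have hsplit := mWrightPrim_add_integral_Ioi hβ x hcos one_pos
  have him := im_integral_mWrightRay hβ x hθ
  rw [← hsplit, Complex.add_im, Real.log_one, Complex.ofReal_zero, zero_add] at him
  have harc : |(mWrightPrim β x (θ * Complex.I)).im| ≤ Real.exp 1 * θ * Real.exp (-c * x) := by
    have hder : ∀ φ : ℝ, HasDerivAt (fun φ : ℝ => mWrightPrim β x (φ * Complex.I))
        (Complex.exp (Complex.exp (φ * Complex.I) - x * Complex.exp (β * (φ * Complex.I)) +
          β * (φ * Complex.I)) * (1 * Complex.I)) φ := fun φ =>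
      (hasDerivAt_mWrightPrim hβ.1 x _).comp φ
        (((hasDerivAt_id φ).ofReal_comp).mul_const Complex.I)
    have h := norm_image_sub_le_of_norm_deriv_le_segment'
      (C := Real.exp 1 * Real.exp (-c * x)) (fun φ (_ : φ ∈ Set.Icc 0 θ) =>
        (hder φ).hasDerivWithinAt) (fun φ hφ => ?_) θ ⟨hθ0.le, le_rfl⟩
    · have h0 : ((mWrightPrim β x (θ * Complex.I)) - mWrightPrim β x ((0 : ℝ) * Complex.I)).im =
          (mWrightPrim β x (θ * Complex.I)).im := by
        have := mWrightPrim_ofReal_im β x 0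
        simp only [Complex.ofReal_zero] at this
        rw [Complex.sub_im, Complex.ofReal_zero, zero_mul, this, sub_zero]
      rw [← h0]
      refine (Complex.abs_im_le_norm _).trans (h.trans_eq ?_)
      ring
    · rw [one_mul, norm_mul, Complex.norm_I, mul_one, Complex.norm_exp, ← Real.exp_add,
        ← mul_assoc, ← Complex.ofReal_mul]
      refine Real.exp_le_exp.2 ?_
      have hre : (Complex.exp (φ * Complex.I) - x * Complex.exp ((β * φ : ℝ) * Complex.I) +
          (β * φ : ℝ) * Complex.I).re = Real.cos φ - x * Real.cos (β * φ) := by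
        rw [Complex.add_re, Complex.sub_re, Complex.re_ofReal_mul, Complex.exp_ofReal_mul_I_re,
          Complex.exp_ofReal_mul_I_re]
        simp
      rw [hre]
      have h1 : c ≤ Real.cos (β * φ) := by
        refine Real.cos_le_cos_of_nonneg_of_le_pi (mul_nonneg hβ.1.le hφ.1)
          (by linarith [hβθ.2, Real.pi_pos]) ?_
        exact mul_le_mul_of_nonneg_left hφ.2.le hβ.1.le
      nlinarith [Real.cos_le_one φ]
  have htail : |(∫ t : ℝ in Set.Ioi 1, mWrightRay β x θ t).im| ≤ D * Real.exp (-c * x) := by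
    refine (Complex.abs_im_le_norm _).trans ?_
    rw [← integral_mul_const]
    refine norm_integral_le_of_norm_le (hDi.mul_const _) ?_
    filter_upwards [ae_restrict_mem measurableSet_Ioi] with t ht
    have ht : 1 < t := ht
    rw [norm_mWrightRay β x θ (one_pos.trans ht), mul_assoc (t ^ (β - 1)) (Real.exp _),
      ← Real.exp_add]
    change t ^ (β - 1) * Real.exp (t * Real.cos θ - x * t ^ β * c) ≤ _
    have h1 : 1 ≤ t ^ β := Real.one_le_rpow ht.le hβ.1.le
    have h2 : 0 ≤ t ^ (β - 1) := Real.rpow_nonneg (by linarith) _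
    refine mul_le_mul_of_nonneg_left (Real.exp_le_exp.2 ?_) h2
    nlinarith [mul_pos hx hc]
  have hpi : |π * mWright β x| ≤ (Real.exp 1 * θ + D) * Real.exp (-c * x) := by
    rw [← him]
    refine (abs_add_le _ _).trans ?_
    linarith
  rw [abs_mul, abs_of_pos Real.pi_pos] at hpi
  rw [div_mul_eq_mul_div, le_div_iff₀ Real.pi_pos]
  linarith

theorem integrable_prod_mWrightRay {β s θ : ℝ} (hβ : β ∈ Set.Ioo (0 : ℝ) 1)
    (hs : s ∈ Set.Ioo (0 : ℝ) 1) (hθ : Real.cos θ < 0) (hβθ : 0 < Real.cos (β * θ)) :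
    Integrable (fun p : ℝ × ℝ => ((p.1 ^ (s - 1) : ℝ) : ℂ) * mWrightRay β p.1 θ p.2)
      ((volume.restrict (Set.Ioi 0)).prod (volume.restrict (Set.Ioi 0))) := by
  have hnorm : ∀ x > 0, ∀ t > 0, ‖((x ^ (s - 1) : ℝ) : ℂ) * mWrightRay β x θ t‖ =
      t ^ (β - 1) * Real.exp (t * Real.cos θ) *
        (x ^ (s - 1) * Real.exp (-(t ^ β * Real.cos (β * θ) * x))) := by
    intro x hx t ht
    rw [norm_mul, norm_mWrightRay β x θ ht, Complex.norm_real,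
      Real.norm_of_nonneg (by positivity)]
    rw [show t * Real.cos θ - x * t ^ β * Real.cos (β * θ) =
      t * Real.cos θ + -(t ^ β * Real.cos (β * θ) * x) by ring, Real.exp_add]
    ring
  have hmeas : AEStronglyMeasurable
      (fun p : ℝ × ℝ => ((p.1 ^ (s - 1) : ℝ) : ℂ) * mWrightRay β p.1 θ p.2)
      ((volume.restrict (Set.Ioi 0)).prod (volume.restrict (Set.Ioi 0))) := by
    refine Measurable.aestronglyMeasurable ?_
    unfold mWrightRay
    fun_prop
  rw [integrable_prod_iff' hmeas]
  constructor
  · filter_upwards [ae_restrict_mem measurableSet_Ioi] with t ht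
    have ht : 0 < t := ht
    have hr : 0 < t ^ β * Real.cos (β * θ) := by positivity
    refine (((integrableOn_rpow_mul_exp_neg_mul hs.1 hr).const_mul
      (t ^ (β - 1) * Real.exp (t * Real.cos θ)))).mono' ?_ ?_
    · refine Measurable.aestronglyMeasurable ?_
      unfold mWrightRay
      fun_prop
    · filter_upwards [ae_restrict_mem measurableSet_Ioi] with x hx
      exact (hnorm x hx t ht).le
  · have hw : 0 < β * (1 - s) := mul_pos hβ.1 (sub_pos.2 hs.2)
    refine ((integrableOn_rpow_mul_exp_neg_mul hw (neg_pos.2 hθ)).const_mul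
      (Real.Gamma s * Real.cos (β * θ) ^ (-s))).congr ?_
    filter_upwards [ae_restrict_mem measurableSet_Ioi] with t ht
    have ht : 0 < t := ht
    have hr : 0 < t ^ β * Real.cos (β * θ) := by positivity
    rw [setIntegral_congr_fun measurableSet_Ioi fun x hx => hnorm x hx t ht,
      integral_const_mul, Real.integral_rpow_mul_exp_neg_mul_Ioi hs.1 hr, one_div,
      Real.inv_rpow hr.le, ← Real.rpow_neg hr.le, Real.mul_rpow (by positivity) hβθ.le,
      ← Real.rpow_mul ht.le, show β * (1 - s) - 1 = (β - 1) + β * -s by ring,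
      Real.rpow_add ht, show -(-Real.cos θ * t) = t * Real.cos θ by ring]
    ring

/-- Inner Mellin integral of the ray representation, for a fixed point of the ray. -/
theorem integral_rpow_mul_mWrightRay {β s θ t : ℝ} (hs : 0 < s)
    (hβθ : β * θ ∈ Set.Ioo 0 (π / 2)) (ht : 0 < t) :
    ∫ x : ℝ in Set.Ioi 0, ((x ^ (s - 1) : ℝ) : ℂ) * mWrightRay β x θ t =
      Real.Gamma s * Complex.exp ((β * (1 - s) * θ : ℝ) * Complex.I) *
        (((t ^ (β * (1 - s) - 1) : ℝ) : ℂ) *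
          Complex.exp (-((1 : ℝ) * Complex.exp ((θ - π : ℝ) * Complex.I) * t))) := by
  have h1 : |β * θ| < π / 2 := by rw [abs_of_pos hβθ.1]; exact hβθ.2
  have hexp : Complex.exp ((θ - π : ℝ) * Complex.I) = -Complex.exp (θ * Complex.I) := by
    push_cast
    rw [sub_mul, Complex.exp_sub, Complex.exp_pi_mul_I, div_neg, div_one]
  have hre : ∀ x : ℝ, ((x ^ (s - 1) : ℝ) : ℂ) * mWrightRay β x θ t =
      ((t ^ (β - 1) : ℝ) : ℂ) * Complex.exp (t * Complex.exp (θ * Complex.I)) *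
        Complex.exp (β * θ * Complex.I) * (((x ^ (s - 1) : ℝ) : ℂ) *
        Complex.exp (-((t ^ β : ℝ) * Complex.exp ((β * θ : ℝ) * Complex.I) * x))) := by
    intro x
    rw [mWrightRay, Complex.exp_add, sub_eq_add_neg ((t : ℂ) * _), Complex.exp_add]
    have : -((t ^ β : ℝ) * Complex.exp ((β * θ : ℝ) * Complex.I) * x) =
        -(x * (t ^ β : ℝ) * Complex.exp (β * θ * Complex.I)) := by push_cast; ring
    rw [this]
    ring
  simp_rw [hre]
  rw [integral_const_mul, integral_rpow_mul_cexp_neg_polar hs (by positivity) h1, hexp,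
    ← Real.rpow_mul ht.le, show β * (1 - s) - 1 = (β - 1) + β * -s by ring, Real.rpow_add ht]
  have e1 : Complex.exp ((β * (1 - s) * θ : ℝ) * Complex.I) = Complex.exp (β * θ * Complex.I) *
      Complex.exp (-(s * (β * θ : ℝ)) * Complex.I) := by
    rw [← Complex.exp_add]; congr 1; push_cast; ring
  have e2 : -(((1 : ℝ) : ℂ) * -Complex.exp (θ * Complex.I) * t) =
    t * Complex.exp (θ * Complex.I) := by push_cast; ring
  rw [e1, e2]
  push_cast
  ring

theorem integrableOn_and_integral_mWright_of_lt_one {β s : ℝ} (hβ : β ∈ Set.Ioo (0 : ℝ) 1)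
    (hs : s ∈ Set.Ioo (0 : ℝ) 1) :
    IntegrableOn (fun x : ℝ => x ^ (s - 1) * mWright β x) (Set.Ioi 0) ∧
    ∫ x : ℝ in Set.Ioi 0, x ^ (s - 1) * mWright β x =
      Real.Gamma s / Real.Gamma (1 + β * (s - 1)) := by
  obtain ⟨θ, hθ, hβθ⟩ := exists_mWrightRay_angle hβ
  have hcos : Real.cos θ < 0 :=
    Real.cos_neg_of_pi_div_two_lt_of_lt hθ.1 (by linarith [hθ.2, Real.pi_pos])
  have hc : 0 < Real.cos (β * θ) :=
    Real.cos_pos_of_mem_Ioo ⟨by linarith [hβθ.1, Real.pi_pos], hβθ.2⟩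
  have hInt := integrable_prod_mWrightRay hβ hs hcos hc
  have hinner : ∀ x : ℝ, (∫ t : ℝ in Set.Ioi 0, ((x ^ (s - 1) : ℝ) : ℂ) *
      mWrightRay β x θ t).im = π * (x ^ (s - 1) * mWright β x) := by
    intro x
    rw [integral_const_mul, Complex.im_ofReal_mul, im_integral_mWrightRay hβ x hθ]
    ring
  have hI := hInt.integral_prod_left
  have hI' := hI.im.const_mul π⁻¹
  have hswap := congrArg Complex.im (integral_integral_swap
    (f := fun x t => ((x ^ (s - 1) : ℝ) : ℂ) * mWrightRay β x θ t) hInt)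
  have hout : Complex.im (∫ x : ℝ in Set.Ioi 0, ∫ t : ℝ in Set.Ioi 0,
      ((x ^ (s - 1) : ℝ) : ℂ) * mWrightRay β x θ t) =
      ∫ x : ℝ in Set.Ioi 0, π * (x ^ (s - 1) * mWright β x) := by
    simp_rw [← hinner]
    exact (integral_im hI).symm
  constructor
  · refine hI'.congr (Eventually.of_forall fun x => ?_)
    have := hinner x
    simp only [RCLike.im_to_complex]
    rw [this, inv_mul_cancel_left₀ Real.pi_ne_zero]
  · have hw : 0 < β * (1 - s) := mul_pos hβ.1 (sub_pos.2 hs.2)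
    have h1 : |θ - π| < π / 2 := by
      rw [abs_lt]; constructor <;> linarith [hθ.1, hθ.2, Real.pi_pos]
    rw [hout, integral_const_mul, setIntegral_congr_fun measurableSet_Ioi
      fun t ht => integral_rpow_mul_mWrightRay hs.1 hβθ ht, integral_const_mul,
      integral_rpow_mul_cexp_neg_polar hw one_pos h1] at hswap
    have e : (Real.Gamma s * Complex.exp ((β * (1 - s) * θ : ℝ) * Complex.I) *
        (((Real.Gamma (β * (1 - s)) * 1 ^ (-(β * (1 - s))) : ℝ) : ℂ) *
          Complex.exp (-((β * (1 - s) : ℝ) * (θ - π : ℝ)) * Complex.I))) =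
        ((Real.Gamma s * Real.Gamma (β * (1 - s)) : ℝ) : ℂ) *
          Complex.exp ((π * (β * (1 - s)) : ℝ) * Complex.I) := by
      rw [Real.one_rpow, mul_one, mul_mul_mul_comm, ← Complex.exp_add, ← Complex.ofReal_mul]
      congr 2
      push_cast
      ring
    rw [e, Complex.im_ofReal_mul, Complex.exp_ofReal_mul_I_im, mul_assoc,
      Gamma_mul_sin_eq hw, show 1 - β * (1 - s) = 1 + β * (s - 1) by ring] at hswap
    have hp := Real.pi_ne_zero
    refine mul_left_cancel₀ hp (hswap.trans ?_)
    ring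

theorem aestronglyMeasurable_mWright {β : ℝ} (hβ : β ∈ Set.Ioo (0 : ℝ) 1) :
    AEStronglyMeasurable (mWright β) (volume.restrict (Set.Ioi 0)) := by
  have h := (integrableOn_and_integral_mWright_of_lt_one hβ (s := 1 / 2)
    (by norm_num)).1.aestronglyMeasurable
  have h2 : AEStronglyMeasurable (fun x : ℝ => x ^ (-(1 / 2 - 1) : ℝ))
      (volume.restrict (Set.Ioi 0)) := Measurable.aestronglyMeasurable (by fun_prop)
  refine (h2.mul h).congr ?_
  filter_upwards [ae_restrict_mem measurableSet_Ioi] with x hx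
  have hx : 0 < x := hx
  simp only [Pi.mul_apply]
  rw [← mul_assoc, ← Real.rpow_add hx, neg_add_cancel, Real.rpow_zero, one_mul]

theorem integrableOn_rpow_mul_mWright {β s : ℝ} (hβ : β ∈ Set.Ioo (0 : ℝ) 1) (hs : 0 < s) :
    IntegrableOn (fun x : ℝ => x ^ (s - 1) * mWright β x) (Set.Ioi 0) := by
  obtain ⟨c, C, hc, hC⟩ := exists_abs_mWright_le hβ
  refine ((integrableOn_rpow_mul_exp_neg_mul hs hc).const_mul C).mono'
    (AEStronglyMeasurable.mul (Measurable.aestronglyMeasurable (by fun_prop))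
      (aestronglyMeasurable_mWright hβ)) ?_
  filter_upwards [ae_restrict_mem measurableSet_Ioi] with x hx
  have hx : 0 < x := hx
  rw [norm_mul, Real.norm_of_nonneg (by positivity), Real.norm_eq_abs]
  refine (mul_le_mul_of_nonneg_left (hC x hx) (by positivity)).trans_eq ?_
  rw [neg_mul]
  ring

theorem mellin_mWright_ofReal {β : ℝ} (s : ℝ) :
    mellin (fun x => (mWright β x : ℂ)) s =
      ((∫ x : ℝ in Set.Ioi 0, x ^ (s - 1) * mWright β x : ℝ) : ℂ) := by
  rw [mellin, ← integral_complex_ofReal]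
  refine setIntegral_congr_fun measurableSet_Ioi fun x hx => ?_
  have hx : 0 < x := hx
  simp only [smul_eq_mul, Complex.ofReal_mul, Complex.ofReal_cpow hx.le, Complex.ofReal_sub,
    Complex.ofReal_one]

theorem differentiableAt_mellin_mWright {β : ℝ} (hβ : β ∈ Set.Ioo (0 : ℝ) 1) {s : ℂ}
    (hs : 0 < s.re) : DifferentiableAt ℂ (mellin fun x => (mWright β x : ℂ)) s := by
  obtain ⟨c, C, hc, hC⟩ := exists_abs_mWright_le hβ
  refine mellin_differentiableAt_of_isBigO_rpow_exp (b := 0) hc ?_ ?_ ?_ hs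
  · have h := integrableOn_rpow_mul_mWright hβ one_pos
    simp only [sub_self, Real.rpow_zero, one_mul] at h
    exact IntegrableOn.locallyIntegrableOn h.ofReal
  · refine Asymptotics.IsBigO.of_bound C ?_
    filter_upwards [eventually_gt_atTop 0] with x hx
    rw [Complex.norm_real, Real.norm_eq_abs, Real.norm_of_nonneg (Real.exp_pos _).le]
    exact hC x hx
  · refine Asymptotics.IsBigO.of_bound |C| ?_
    filter_upwards [self_mem_nhdsWithin] with x hx
    have hx : 0 < x := hx
    rw [Complex.norm_real, Real.norm_eq_abs, neg_zero, Real.rpow_zero, norm_one, mul_one]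
    refine (hC x hx).trans ?_
    refine (mul_le_mul_of_nonneg_right (le_abs_self C) (Real.exp_pos _).le).trans ?_
    exact mul_le_of_le_one_right (abs_nonneg C)
      (Real.exp_le_one_iff.2 (by nlinarith [mul_pos hc hx]))

theorem integral_rpow_mul_mWright {β s : ℝ} (hβ : β ∈ Set.Ioo (0 : ℝ) 1) (hs : 0 < s) :
    ∫ x : ℝ in Set.Ioi 0, x ^ (s - 1) * mWright β x =
      Real.Gamma s / Real.Gamma (1 + β * (s - 1)) := by
  let U : Set ℂ := {z | 0 < z.re}
  have hU : IsOpen U := isOpen_lt continuous_const Complex.continuous_re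
  let F : ℂ → ℂ := mellin fun x => (mWright β x : ℂ)
  let G : ℂ → ℂ := fun z => Complex.Gamma z * (Complex.Gamma (1 + β * (z - 1)))⁻¹
  have hF : AnalyticOnNhd ℂ F U := DifferentiableOn.analyticOnNhd
    (fun z hz => (differentiableAt_mellin_mWright hβ hz).differentiableWithinAt) hU
  have hG : AnalyticOnNhd ℂ G U := by
    refine DifferentiableOn.analyticOnNhd (fun z hz => ?_) hU
    have hz : 0 < z.re := hz
    refine DifferentiableAt.differentiableWithinAt (DifferentiableAt.mul ?_ ?_)
    · refine Complex.differentiableAt_Gamma z fun m h => ?_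
      rw [h, Complex.neg_re, Complex.natCast_re] at hz
      linarith [(Nat.cast_nonneg m : (0 : ℝ) ≤ m)]
    · exact Complex.differentiable_one_div_Gamma.differentiableAt.comp z
        (f := fun z : ℂ => 1 + β * (z - 1)) (by fun_prop)
  have hGr : ∀ r : ℝ, G r = ((Real.Gamma r / Real.Gamma (1 + β * (r - 1)) : ℝ) : ℂ) := by
    intro r
    simp only [G]
    rw [div_eq_mul_inv, Complex.ofReal_mul, Complex.ofReal_inv, ← Complex.Gamma_ofReal,
      ← Complex.Gamma_ofReal]
    push_cast
    rfl
  have hfreq : ∃ᶠ z in nhdsWithin (1 / 2 : ℂ) {1 / 2}ᶜ, F z = G z := by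
    have htend : Tendsto (fun r : ℝ => (r : ℂ)) (nhdsWithin (1 / 2) {1 / 2}ᶜ)
        (nhdsWithin (1 / 2 : ℂ) {1 / 2}ᶜ) := by
      refine tendsto_nhdsWithin_iff.2 ⟨?_, ?_⟩
      · have := Complex.continuous_ofReal.tendsto (1 / 2 : ℝ)
        push_cast at this
        exact this.mono_left nhdsWithin_le_nhds
      · filter_upwards [self_mem_nhdsWithin] with r hr h
        refine hr ?_
        have h : (r : ℂ) = 1 / 2 := h
        have : (r : ℂ) = ((1 / 2 : ℝ) : ℂ) := by rw [h]; push_cast; rfl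
        exact Complex.ofReal_injective this
    refine htend.frequently (Eventually.frequently ?_)
    filter_upwards [nhdsWithin_le_nhds (Ioo_mem_nhds (a := (0 : ℝ)) (b := 1)
      (by norm_num : (0 : ℝ) < 1 / 2) (by norm_num))] with r hr
    rw [hGr, ← (integrableOn_and_integral_mWright_of_lt_one hβ hr).2]
    exact mellin_mWright_ofReal r
  have heq := hF.eqOn_of_preconnected_of_frequently_eq hG
    (convex_halfSpace_re_gt 0).isPreconnected (z₀ := 1 / 2) (by simp [U]) hfreq
    (show (s : ℂ) ∈ U from by simpa [U] using hs)
  have heq : F s = G s := heq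
  rw [hGr] at heq
  exact Complex.ofReal_injective ((mellin_mWright_ofReal s).symm.trans heq)

/-- the generalized M-Wright density
`ρ(x) = [Γ(1−β+β(a+α))/(α Γ(a+α))] x^{a/α} M_β(x^{1/α})` is a probability density on
`(0,∞)`; equivalently `M_β ≥ 0` on `(0,∞)` and
`∫₀^∞ x^{a+α−1} M_β(x) dx = Γ(a+α)/Γ(1+β(a+α−1))`. -/
theorem generalized_mWright_density
    (β a α : ℝ) (hβ : β ∈ Set.Ioo (0 : ℝ) 1) (hα : 0 < α) (haα : 0 < a + α)
    (ρ : ℝ → ℝ)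
    (hρ : ∀ x : ℝ, ρ x = Real.Gamma (1 - β + β * (a + α)) / (α * Real.Gamma (a + α)) *
      x ^ (a / α) * mWright β (x ^ (1 / α))) :
    (∀ x > (0 : ℝ), 0 ≤ ρ x) ∧
    IntegrableOn ρ (Set.Ioi 0) volume ∧
    (∫ x in Set.Ioi (0 : ℝ), ρ x) = 1 ∧
    (∀ x > (0 : ℝ), 0 ≤ mWright β x) ∧
    IntegrableOn (fun x : ℝ => x ^ (a + α - 1) * mWright β x) (Set.Ioi 0) volume ∧
    (∫ x in Set.Ioi (0 : ℝ), x ^ (a + α - 1) * mWright β x) =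
      Real.Gamma (a + α) / Real.Gamma (1 + β * (a + α - 1)) := by
  obtain ⟨s, rfl⟩ : ∃ s, a = s - α := ⟨a + α, by ring⟩
  simp only [sub_add_cancel] at haα hρ ⊢
  have hB : 0 < 1 + β * (s - 1) := by nlinarith [hβ.1, hβ.2, mul_pos hβ.1 haα]
  have hBeq : 1 - β + β * s = 1 + β * (s - 1) := by ring
  rw [hBeq] at hρ
  have hΓB := Real.Gamma_pos_of_pos hB
  have hΓs := Real.Gamma_pos_of_pos haα
  have hp : 1 / α ≠ 0 := by positivity
  have hInt := integrableOn_rpow_mul_mWright hβ haα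
  have hval := integral_rpow_mul_mWright hβ haα
  have hsub : ∀ x ∈ Set.Ioi (0 : ℝ), Real.Gamma (1 + β * (s - 1)) / Real.Gamma s *
      ((|1 / α| * x ^ (1 / α - 1)) • ((x ^ (1 / α)) ^ (s - 1) * mWright β (x ^ (1 / α)))) =
      ρ x := by
    intro x hx
    have hx : 0 < x := hx
    rw [hρ, abs_of_pos (by positivity), smul_eq_mul, ← Real.rpow_mul hx.le,
      show (s - α) / α = (1 / α - 1) + 1 / α * (s - 1) by field_simp; ring, Real.rpow_add hx]
    field_simp
  refine ⟨fun x hx => ?_, ?_, ?_, fun x hx => mWright_nonneg hβ hx, hInt, hval⟩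
  · rw [hρ]
    have := mWright_nonneg hβ (Real.rpow_pos_of_pos hx (1 / α))
    positivity
  · exact IntegrableOn.congr_fun (((integrableOn_Ioi_comp_rpow_iff
      (fun y => y ^ (s - 1) * mWright β y) hp).2 hInt).const_mul _) hsub measurableSet_Ioi
  · rw [← setIntegral_congr_fun measurableSet_Ioi hsub, integral_const_mul,
      integral_comp_rpow_Ioi (fun y => y ^ (s - 1) * mWright β y) hp, hval]
    field_simp
end
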